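/- arXiv:1510.06663 — 2 statements merged into one kernel-verified Lean document; each statement's English description precedes it below -/
import Mathlib

section
/- (Cartwright–Littlewood fixed point theorem, as a special case of Theorem 1.) Let f : ℝ² → ℝ² be an orientation preserving homeomorphism and let C ⊆ ℝ² be an acyclic continuum invariant under f, i.e., f(C) = C. Then C contains a fixed point of f. -/
/-- A (planar) continuum: a compact connected subset of the plane
containing more than one point. -/
def IsContinuum (C : Set (ℝ × ℝ)) : Prop :=
  IsCompact C ∧ IsConnected C ∧ C.Nontrivial

/-- A planar set is acyclic if its complement is connected
(it does not separate the plane). -/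
def IsAcyclic (K : Set (ℝ × ℝ)) : Prop :=
  IsConnected Kᶜ

/-- A homeomorphism of the plane is isotopic to the identity if there is a
continuous family of homeomorphisms joining the identity to it. -/
def IsotopicToIdentity (h : (ℝ × ℝ) ≃ₜ (ℝ × ℝ)) : Prop :=
  ∃ F : ℝ → (ℝ × ℝ) → (ℝ × ℝ),
    Continuous (fun q : ℝ × (ℝ × ℝ) => F q.1 q.2) ∧
    (∀ t : ℝ, ∃ g : (ℝ × ℝ) ≃ₜ (ℝ × ℝ), ⇑g = F t) ∧
    F 0 = id ∧ F 1 = ⇑h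

/-! ### Continuous functions with values in a lattice, and arguments -/

lemma eq_of_continuousOn_two_pi_int {X : Type*} [TopologicalSpace X] {S : Set X}
    (hS : IsPreconnected S) {g : X → ℝ} (hg : ContinuousOn g S)
    (hint : ∀ x ∈ S, ∃ n : ℤ, g x = 2 * Real.pi * n) {x y : X} (hx : x ∈ S) (hy : y ∈ S) :
    g x = g y := by
  have key : ∀ a ∈ S, ∀ b ∈ S, ¬ g a < g b := by
    intro a ha b hb hab
    obtain ⟨n, hn⟩ := hint a ha
    obtain ⟨m, hm⟩ := hint b hb
    have hpi := Real.pi_pos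
    have hnm : n < m := by
      rw [hn, hm] at hab
      have := lt_of_mul_lt_mul_left hab (by positivity)
      exact_mod_cast this
    have hnm' : (n : ℝ) + 1 ≤ m := by exact_mod_cast hnm
    have : 2 * Real.pi * (n + 1 / 2) ∈ Set.Icc (g a) (g b) := by
      rw [hn, hm]; constructor <;> nlinarith
    obtain ⟨c, hc, hgc⟩ := hS.intermediate_value ha hb hg this
    obtain ⟨k, hk⟩ := hint c hc
    rw [hk] at hgc
    have h2 : (k : ℝ) = n + 1 / 2 := mul_left_cancel₀ (by positivity) hgc
    have h3 : (2 * k : ℝ) = 2 * n + 1 := by linarith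
    have h4 : 2 * k = 2 * n + 1 := by exact_mod_cast h3
    omega
  exact le_antisymm (not_lt.1 (key y hy x hx)) (not_lt.1 (key x hx y hy))

lemma eq_of_continuousOn_exp_eq {X : Type*} [TopologicalSpace X] {S : Set X}
    (hS : IsPreconnected S) {g : X → ℂ} (hg : ContinuousOn g S)
    (hexp : ∀ x ∈ S, ∀ y ∈ S, Complex.exp (g x) = Complex.exp (g y)) {x y : X}
    (hx : x ∈ S) (hy : y ∈ S) : g x = g y := by
  have h : ∀ z ∈ S, ∃ n : ℤ, g z = g x + n * (2 * Real.pi * Complex.I) := fun z hz =>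
    Complex.exp_eq_exp_iff_exists_int.1 (hexp z hz x hx)
  apply Complex.ext
  · obtain ⟨n, hn⟩ := h y hy
    rw [hn]; simp
  · have hc : ContinuousOn (fun z => (g z).im - (g x).im) S :=
      (Complex.continuous_im.comp_continuousOn hg).sub continuousOn_const
    have := eq_of_continuousOn_two_pi_int hS hc (fun z hz => by
      obtain ⟨n, hn⟩ := h z hz
      refine ⟨n, ?_⟩
      rw [hn]; simp; ring) hx hy
    linarith

lemma Complex.im_coe_angle_of_exp_eq {w z : ℂ} (h : Complex.exp w = z) :
    (w.im : Real.Angle) = (z.arg : Real.Angle) := by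
  obtain ⟨n, hn⟩ := Complex.exp_eq_exp_iff_exists_int.1
    (h.trans (Complex.exp_log (h ▸ Complex.exp_ne_zero w)).symm)
  rw [Real.Angle.angle_eq_iff_two_pi_dvd_sub]
  refine ⟨n, ?_⟩
  rw [hn]
  simp [Complex.log_im]
  ring

lemma Complex.arg_div_eq_of_re_pos {x y : ℂ} (hx : 0 < x.re) (hy : 0 < y.re) :
    (x / y).arg = x.arg - y.arg := by
  have hx0 : x ≠ 0 := fun h => by simp [h] at hx
  have hy0 : y ≠ 0 := fun h => by simp [h] at hy
  have h1 := abs_lt.1 (Complex.abs_arg_lt_pi_div_two_iff.2 (Or.inl hx))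
  have h2 := abs_lt.1 (Complex.abs_arg_lt_pi_div_two_iff.2 (Or.inl hy))
  have h3 : y⁻¹.arg = - y.arg := by
    rw [Complex.arg_inv, if_neg]; linarith [Real.pi_pos]
  rw [div_eq_mul_inv, sub_eq_add_neg, ← h3]
  rw [Complex.arg_mul_eq_add_arg_iff hx0 (inv_ne_zero hy0), h3]
  constructor <;> linarith

lemma Complex.arg_div_one_add {x : ℂ} (hx : x ≠ 0) (h1 : ‖x‖ < 1) :
    (x / (1 + x)).arg = x.arg - (1 + x).arg ∧ ((1 + x) / x).arg = (1 + x).arg + x⁻¹.arg := by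
  have hre : 0 < (1 + x).re := by
    have := (abs_lt.1 ((Complex.abs_re_le_norm x).trans_lt h1)).1
    simp; linarith
  have h0 : 1 + x ≠ 0 := fun h => by simp [h] at hre
  have hb := abs_lt.1 (Complex.abs_arg_lt_pi_div_two_iff.2 (Or.inl hre))
  have hpi := Real.pi_pos
  have h3 : (1 + x)⁻¹.arg = - (1 + x).arg := by
    rw [Complex.arg_inv, if_neg]; linarith
  have hx1 := Complex.neg_pi_lt_arg x
  have hx2 := Complex.arg_le_pi x
  rcases lt_trichotomy x.im 0 with him | him | him
  · have ha : x.arg < 0 := Complex.arg_neg_iff.2 him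
    have hb' : (1 + x).arg < 0 := Complex.arg_neg_iff.2 (by simpa using him)
    have h4 : x⁻¹.arg = - x.arg := by rw [Complex.arg_inv, if_neg]; linarith
    constructor
    · rw [div_eq_mul_inv, sub_eq_add_neg, ← h3,
        Complex.arg_mul_eq_add_arg_iff hx (inv_ne_zero h0), h3]
      constructor <;> linarith
    · rw [div_eq_mul_inv, Complex.arg_mul_eq_add_arg_iff h0 (inv_ne_zero hx), h4]
      constructor <;> linarith
  · have hz : (1 + x).arg = 0 := Complex.arg_eq_zero_iff.2 ⟨hre.le, by simpa using him⟩
    constructor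
    · rw [div_eq_mul_inv, sub_eq_add_neg, ← h3,
        Complex.arg_mul_eq_add_arg_iff hx (inv_ne_zero h0), h3, hz]
      constructor <;> linarith
    · rw [div_eq_mul_inv, Complex.arg_mul_eq_add_arg_iff h0 (inv_ne_zero hx), hz, zero_add]
      exact ⟨Complex.neg_pi_lt_arg _, Complex.arg_le_pi _⟩
  · have ha : 0 ≤ x.arg := Complex.arg_nonneg_iff.2 him.le
    have hb' : 0 ≤ (1 + x).arg := Complex.arg_nonneg_iff.2 (by simpa using him.le)
    have hne : x.arg ≠ Real.pi := fun h => by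
      have := (Complex.arg_eq_pi_iff.1 h).2
      exact him.ne' this
    have h4 : x⁻¹.arg = - x.arg := by rw [Complex.arg_inv, if_neg hne]
    constructor
    · rw [div_eq_mul_inv, sub_eq_add_neg, ← h3,
        Complex.arg_mul_eq_add_arg_iff hx (inv_ne_zero h0), h3]
      constructor <;> linarith
    · rw [div_eq_mul_inv, Complex.arg_mul_eq_add_arg_iff h0 (inv_ne_zero hx), h4]
      constructor
      · have := lt_of_le_of_ne hx2 hne; linarith
      · linarith

/-- The argument is upper semicontinuous away from the origin. -/
lemma Complex.eventually_arg_lt {z : ℂ} (hz : z ≠ 0) {ε : ℝ} (hε : 0 < ε) :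
    ∀ᶠ w in nhds z, w.arg < z.arg + ε := by
  by_cases h : z ∈ Complex.slitPlane
  · exact (Complex.continuousAt_arg h).eventually_lt continuousAt_const (by linarith)
  · rw [Complex.mem_slitPlane_iff_arg] at h
    have : z.arg = Real.pi := by
      by_contra h'; exact h ⟨h', hz⟩
    rw [this]
    exact Filter.Eventually.of_forall fun w => by linarith [Complex.arg_le_pi w]

lemma mem_segment_of_div_notMem_slitPlane {q v a : ℂ} (hqa : q ≠ a) (hqv : q ≠ v)
    (h : (q - v) / (q - a) ∉ Complex.slitPlane) : q ∈ openSegment ℝ v a := by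
  have hqa' : q - a ≠ 0 := sub_ne_zero.2 hqa
  have hqv' : q - v ≠ 0 := sub_ne_zero.2 hqv
  have h0 : (q - v) / (q - a) ≠ 0 := div_ne_zero hqv' hqa'
  rw [Complex.mem_slitPlane_iff_arg] at h
  have harg : ((q - v) / (q - a)).arg = Real.pi := by
    by_contra h'; exact h ⟨h', h0⟩
  obtain ⟨hre, him⟩ := Complex.arg_eq_pi_iff.1 harg
  set t := -((q - v) / (q - a)).re with ht
  have ht0 : 0 < t := by linarith
  have heq : (q - v) / (q - a) = ((-t : ℝ) : ℂ) := by
    apply Complex.ext <;> simp [ht, him]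
  rw [div_eq_iff hqa'] at heq
  refine ⟨1 / (1 + t), t / (1 + t), by positivity, by positivity, by field_simp, ?_⟩
  have h1t : (1 + t : ℂ) ≠ 0 := by exact_mod_cast (by positivity : (1 + t : ℝ) ≠ 0)
  simp only [Complex.real_smul]
  push_cast at heq ⊢
  field_simp
  linear_combination -heq

/-! ### Branches of the logarithm along a continuum -/

lemma exists_forall_lt_norm_sub {C : Set ℂ} (hC : IsCompact C) {q : ℂ} (hq : q ∉ C) :
    ∃ r > 0, ∀ y ∈ C, r < ‖q - y‖ := by
  obtain ⟨r, hr, h⟩ := Metric.isOpen_iff.1 hC.isClosed.isOpen_compl q hq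
  refine ⟨r / 2, by positivity, fun y hy => ?_⟩
  by_contra hlt
  exact h (show y ∈ Metric.ball q r by
    rw [Metric.mem_ball, dist_comm, dist_eq_norm]; linarith) hy

lemma div_sub_mem_slitPlane {q q' y : ℂ} (h : ‖q' - q‖ < ‖q - y‖) :
    0 < ((q' - y) / (q - y)).re := by
  have h0 : q - y ≠ 0 := fun h0 => by
    rw [h0, norm_zero] at h; exact absurd h (not_lt.2 (norm_nonneg _))
  have : (q' - y) / (q - y) = 1 + (q' - q) / (q - y) := by field_simp; ring
  rw [this]
  have h1 : ‖(q' - q) / (q - y)‖ < 1 := by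
    rw [norm_div, div_lt_one (norm_pos_iff.2 h0)]; exact h
  have := (abs_lt.1 ((Complex.abs_re_le_norm _).trans_lt h1)).1
  simp only [Complex.add_re, Complex.one_re]; linarith

/-- `m` is a continuous branch of `y ↦ log (q - y)` on `C`. -/
def IsLogBranch (C : Set ℂ) (q : ℂ) (m : ℂ → ℂ) : Prop :=
  ContinuousOn m C ∧ ∀ y ∈ C, Complex.exp (m y) = q - y

lemma IsLogBranch.move {C : Set ℂ} {q q' : ℂ} {m : ℂ → ℂ} (hm : IsLogBranch C q m)
    (h : ∀ y ∈ C, ‖q' - q‖ < ‖q - y‖) :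
    IsLogBranch C q' (fun y => m y + Complex.log ((q' - y) / (q - y))) := by
  have hne : ∀ y ∈ C, q - y ≠ 0 := fun y hy h0 => by
    have := h y hy
    rw [h0, norm_zero] at this; exact absurd this (not_lt.2 (norm_nonneg _))
  refine ⟨hm.1.add (ContinuousOn.clog ?_ ?_), fun y hy => ?_⟩
  · exact ContinuousOn.div (by fun_prop) (by fun_prop) hne
  · exact fun y hy => Or.inl (div_sub_mem_slitPlane (h y hy))
  · have h1 := div_sub_mem_slitPlane (h y hy)
    rw [Complex.exp_add, hm.2 y hy, Complex.exp_log]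
    · field_simp [hne y hy]
    · intro h0; rw [h0] at h1; simp at h1

lemma isLogBranch_of_norm_lt {C : Set ℂ} {q : ℂ} (hq : ∀ y ∈ C, ‖y‖ < ‖q‖) (hq0 : q ≠ 0) :
    (∀ y ∈ C, 0 < ((q - y) / q).re) ∧
      IsLogBranch C q fun y => Complex.log q + Complex.log ((q - y) / q) := by
  have h1 : ∀ y ∈ C, 0 < ((q - y) / q).re := fun y hy => by
    have := @div_sub_mem_slitPlane (-q) (y - q) 0 (by simpa using hq y hy)
    simpa [neg_div, div_neg, sub_div] using this
  refine ⟨h1, continuousOn_const.add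
    (ContinuousOn.clog (by fun_prop) fun y hy => Or.inl (h1 y hy)), fun y hy => ?_⟩
  rw [Complex.exp_add, Complex.exp_log hq0, Complex.exp_log]
  · field_simp
  · intro h0; have := h1 y hy; rw [h0] at this; simp at this

lemma exists_isLogBranch {C : Set ℂ} (hC : IsCompact C) (hconn : IsConnected Cᶜ) {q : ℂ}
    (hq : q ∉ C) : ∃ m, IsLogBranch C q m := by
  obtain ⟨R, hR⟩ := hC.isBounded.exists_norm_le
  have hfar : ∀ p : ℂ, |R| < ‖p‖ → ∃ m, IsLogBranch C p m := by
    intro p hp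
    have hp0 : p ≠ 0 := fun h => by
      rw [h, norm_zero] at hp; exact absurd hp (not_lt.2 (abs_nonneg _))
    exact ⟨_, (isLogBranch_of_norm_lt (fun y hy =>
      (hR y hy).trans_lt ((le_abs_self R).trans_lt hp)) hp0).2⟩
  have hopen : IsOpen {p | p ∉ C ∧ ∃ m, IsLogBranch C p m} := by
    rw [Metric.isOpen_iff]
    rintro p ⟨hp, m, hm⟩
    obtain ⟨r, hr, h⟩ := exists_forall_lt_norm_sub hC hp
    refine ⟨r, hr, fun p' hp' => ?_⟩
    rw [Metric.mem_ball, dist_eq_norm] at hp'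
    refine ⟨fun hC' => ?_, _, hm.move fun y hy => hp'.trans (h y hy)⟩
    have := h p' hC'
    rw [norm_sub_rev] at this; linarith
  have hopen' : IsOpen {p | p ∉ C ∧ ¬ ∃ m, IsLogBranch C p m} := by
    rw [Metric.isOpen_iff]
    rintro p ⟨hp, hm⟩
    obtain ⟨r, hr, h⟩ := exists_forall_lt_norm_sub hC hp
    refine ⟨r / 2, by positivity, fun p' hp' => ?_⟩
    rw [Metric.mem_ball, dist_eq_norm] at hp'
    refine ⟨fun hC' => ?_, ?_⟩
    · have := h p' hC'
      rw [norm_sub_rev] at this; linarith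
    · rintro ⟨m, hm'⟩
      refine hm ⟨_, hm'.move fun y hy => ?_⟩
      have h2 := h y hy
      have h3 : ‖p - y‖ ≤ ‖p - p'‖ + ‖p' - y‖ := norm_sub_le_norm_sub_add_norm_sub _ _ _
      rw [norm_sub_rev p p'] at h3
      rw [norm_sub_rev p p']
      linarith
  obtain ⟨K, hK⟩ : ∃ K, K = abs R := ⟨_, rfl⟩
  have hK0 : 0 ≤ K := hK ▸ abs_nonneg R
  have hRK : R ≤ K := hK ▸ le_abs_self R
  rw [← hK] at hfar
  have hfarpt : K + 1 = ‖((K + 1 : ℝ) : ℂ)‖ := by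
    rw [Complex.norm_real, Real.norm_eq_abs, abs_of_pos (by positivity)]
  by_contra hcon
  have := hconn.isPreconnected _ _ hopen hopen'
    (fun p hp => by
      by_cases h : ∃ m, IsLogBranch C p m
      · exact Or.inl ⟨hp, h⟩
      · exact Or.inr ⟨hp, h⟩)
    ⟨((K + 1 : ℝ) : ℂ), fun h => by
      have := hR _ h
      linarith, fun h => by
      have := hR _ h
      linarith, hfar _ (by linarith)⟩
    ⟨q, hq, hq, hcon⟩
  obtain ⟨p, -, ⟨-, h1⟩, -, h2⟩ := this
  exact h2 h1

open Classical in
/-- The variation from `a` to `b` of a branch of `y ↦ log (q - y)` along `C`. -/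
noncomputable def logVar (C : Set ℂ) (q a b : ℂ) : ℂ :=
  if h : ∃ m, IsLogBranch C q m then h.choose b - h.choose a else 0

lemma IsLogBranch.logVar_eq {C : Set ℂ} (hCc : IsPreconnected C) {q : ℂ} {m : ℂ → ℂ}
    (hm : IsLogBranch C q m) {a b : ℂ} (ha : a ∈ C) (hb : b ∈ C) :
    logVar C q a b = m b - m a := by
  have h : ∃ m, IsLogBranch C q m := ⟨m, hm⟩
  rw [logVar, dif_pos h]
  have hs := h.choose_spec
  have hexp : ∀ x ∈ C, Complex.exp (h.choose x - m x) = 1 := fun x hx => by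
    rw [Complex.exp_sub, hs.2 x hx, hm.2 x hx, div_self]
    rw [← hm.2 x hx]; exact Complex.exp_ne_zero _
  have := eq_of_continuousOn_exp_eq hCc (hs.1.sub hm.1)
    (fun x hx y hy => (hexp x hx).trans (hexp y hy).symm) ha hb
  simp only [Pi.sub_apply] at this
  linear_combination -this

lemma exp_logVar {C : Set ℂ} (hC : IsCompact C) (hCc : IsPreconnected C)
    (hconn : IsConnected Cᶜ) {q a b : ℂ} (hq : q ∉ C) (ha : a ∈ C) (hb : b ∈ C) :
    Complex.exp (logVar C q a b) = (q - b) / (q - a) := by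
  obtain ⟨m, hm⟩ := exists_isLogBranch hC hconn hq
  rw [hm.logVar_eq hCc ha hb, Complex.exp_sub, hm.2 a ha, hm.2 b hb]

lemma logVar_add {C : Set ℂ} (hC : IsCompact C) (hCc : IsPreconnected C)
    (hconn : IsConnected Cᶜ) {q a b c : ℂ} (hq : q ∉ C) (ha : a ∈ C) (hb : b ∈ C) (hc : c ∈ C) :
    logVar C q a b + logVar C q b c = logVar C q a c := by
  obtain ⟨m, hm⟩ := exists_isLogBranch hC hconn hq
  rw [hm.logVar_eq hCc ha hb, hm.logVar_eq hCc hb hc, hm.logVar_eq hCc ha hc]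
  ring

lemma logVar_move {C : Set ℂ} (hC : IsCompact C) (hCc : IsPreconnected C)
    (hconn : IsConnected Cᶜ) {q q' a b : ℂ} (hq : q ∉ C) (ha : a ∈ C) (hb : b ∈ C)
    (h : ∀ y ∈ C, ‖q' - q‖ < ‖q - y‖) :
    logVar C q' a b = logVar C q a b + Complex.log ((q' - b) / (q - b))
      - Complex.log ((q' - a) / (q - a)) := by
  obtain ⟨m, hm⟩ := exists_isLogBranch hC hconn hq
  rw [hm.logVar_eq hCc ha hb, (hm.move h).logVar_eq hCc ha hb]
  ring

lemma continuousAt_logVar {C : Set ℂ} (hC : IsCompact C) (hCc : IsPreconnected C)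
    (hconn : IsConnected Cᶜ) {q a b : ℂ} (hq : q ∉ C) (ha : a ∈ C) (hb : b ∈ C) :
    ContinuousAt (fun q => logVar C q a b) q := by
  obtain ⟨r, hr, h⟩ := exists_forall_lt_norm_sub hC hq
  have hev : (fun q' => logVar C q' a b) =ᶠ[nhds q] fun q' => logVar C q a b +
      Complex.log ((q' - b) / (q - b)) - Complex.log ((q' - a) / (q - a)) := by
    filter_upwards [Metric.ball_mem_nhds q hr] with q' hq'
    rw [Metric.mem_ball, dist_eq_norm] at hq'
    exact logVar_move hC hCc hconn hq ha hb fun y hy => hq'.trans (h y hy)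
  refine ContinuousAt.congr ?_ hev.symm
  have hs : ∀ y ∈ C, ContinuousAt (fun q' => Complex.log ((q' - y) / (q - y))) q := fun y hy => by
    refine ContinuousAt.clog (by fun_prop) (Or.inl (div_sub_mem_slitPlane ?_))
    rw [sub_self, norm_zero]; exact hr.trans (h y hy)
  exact (continuousAt_const.add (hs b hb)).sub (hs a ha)

lemma abs_im_log_lt {z : ℂ} (h : 0 < z.re) : |(Complex.log z).im| < Real.pi / 2 := by
  rw [Complex.log_im]; exact Complex.abs_arg_lt_pi_div_two_iff.2 (Or.inl h)

lemma sub_div_sub_re_pos {q x y : ℂ} {K : ℝ} (hx : ‖x‖ ≤ K) (hy : ‖y‖ ≤ K) (hq : 3 * K < ‖q‖) :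
    0 < ((q - x) / (q - y)).re := by
  have h1 : ‖q‖ - ‖y‖ ≤ ‖q - y‖ := norm_sub_norm_le q y
  have h2 : ‖y - x‖ ≤ ‖y‖ + ‖x‖ := norm_sub_le y x
  have := @div_sub_mem_slitPlane (q - y) (q - x) 0 (by
    rw [sub_zero, show q - x - (q - y) = y - x by ring]; linarith)
  simpa using this

/-- Far away from `C` the variation of the argument is small. -/
lemma abs_im_logVar_lt {C : Set ℂ} (hCc : IsPreconnected C) {K : ℝ}
    (hK : ∀ y ∈ C, ‖y‖ ≤ K) {q a b : ℂ} (ha : a ∈ C) (hb : b ∈ C) (hq : K < ‖q‖) :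
    |(logVar C q a b).im| < Real.pi := by
  have hq0 : q ≠ 0 := fun h => by
    rw [h, norm_zero] at hq; linarith [norm_nonneg a, hK a ha]
  obtain ⟨h1, hm⟩ := isLogBranch_of_norm_lt (fun y hy => (hK y hy).trans_lt hq) hq0
  rw [hm.logVar_eq hCc ha hb]
  have h2 := abs_lt.1 (abs_im_log_lt (h1 a ha))
  have h3 := abs_lt.1 (abs_im_log_lt (h1 b hb))
  rw [abs_lt]
  simp only [Complex.sub_im, Complex.add_im]
  constructor <;> linarith

/-! ### Crosscuts of the complement of a continuum -/

lemma Complex.arg_ofReal_mul_exp_mul_I {r θ : ℝ} (hr : 0 < r)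
    (hθ : θ ∈ Set.Ioc (-Real.pi) Real.pi) :
    ((r : ℂ) * Complex.exp (θ * Complex.I)).arg = θ := by
  rw [Complex.exp_mul_I]; exact Complex.arg_mul_cos_add_sin_mul_I hr hθ

/-- The variation of the argument of `y - q`, as `y` runs along `C` from `a` to `b` and then back
to `a` through the broken line `b`, `v`, `a`. -/
noncomputable def crossArg (C : Set ℂ) (v a b q : ℂ) : ℝ :=
  (logVar C q a b).im - ((q - b) / (q - v)).arg - ((q - v) / (q - a)).arg

lemma sub_ne_zero_of_notMem {C : Set ℂ} {q y : ℂ} (hq : q ∉ C) (hy : y ∈ C) : q - y ≠ 0 :=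
  sub_ne_zero.2 fun h => hq (h ▸ hy)

lemma exists_int_crossArg {C : Set ℂ} (hC : IsCompact C) (hCc : IsPreconnected C)
    (hconn : IsConnected Cᶜ) {v a b q : ℂ} (ha : a ∈ C) (hb : b ∈ C) (hq : q ∉ C) (hqv : q ≠ v) :
    ∃ n : ℤ, crossArg C v a b q = 2 * Real.pi * n := by
  have h1 := sub_ne_zero_of_notMem hq ha
  have h2 := sub_ne_zero_of_notMem hq hb
  have h3 := sub_ne_zero.2 hqv
  have h : (crossArg C v a b q : Real.Angle) = (0 : ℝ) := by
    rw [crossArg, Real.Angle.coe_sub, Real.Angle.coe_sub,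
      Complex.im_coe_angle_of_exp_eq (exp_logVar hC hCc hconn hq ha hb),
      Complex.arg_div_coe_angle h2 h1, Complex.arg_div_coe_angle h2 h3,
      Complex.arg_div_coe_angle h3 h1]
    simp
  obtain ⟨n, hn⟩ := Real.Angle.angle_eq_iff_two_pi_dvd_sub.1 h
  exact ⟨n, by rw [← hn, sub_zero]⟩

lemma crossArg_nonneg_of_gt {C : Set ℂ} (hC : IsCompact C) (hCc : IsPreconnected C)
    (hconn : IsConnected Cᶜ) {v a b q : ℂ} (ha : a ∈ C) (hb : b ∈ C) (hq : q ∉ C) (hqv : q ≠ v)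
    (h : -(2 * Real.pi) < crossArg C v a b q) : 0 ≤ crossArg C v a b q := by
  obtain ⟨n, hn⟩ := exists_int_crossArg hC hCc hconn ha hb hq hqv
  rw [hn] at h ⊢
  have hpi := Real.pi_pos
  have : (-1 : ℝ) < n := by
    by_contra hcon
    rw [not_lt] at hcon
    nlinarith
  have : (-1 : ℤ) < n := by exact_mod_cast this
  have : (0 : ℝ) ≤ n := by exact_mod_cast (by omega : 0 ≤ n)
  positivity

lemma continuousAt_crossArg {C : Set ℂ} (hC : IsCompact C) (hCc : IsPreconnected C)
    (hconn : IsConnected Cᶜ) {v a b q : ℂ} (ha : a ∈ C) (hb : b ∈ C) (hq : q ∉ C) (hqv : q ≠ v)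
    (hqa : q ∉ openSegment ℝ v a) (hqb : q ∉ openSegment ℝ v b) :
    ContinuousAt (crossArg C v a b) q := by
  have h1 := sub_ne_zero_of_notMem hq ha
  have h2 := sub_ne_zero_of_notMem hq hb
  have h3 := sub_ne_zero.2 hqv
  have s1 : (q - v) / (q - a) ∈ Complex.slitPlane := by
    by_contra h
    exact hqa (mem_segment_of_div_notMem_slitPlane (sub_ne_zero.1 h1) hqv h)
  have s2 : (q - b) / (q - v) ∈ Complex.slitPlane := by
    by_contra h
    refine hqb ?_
    rw [openSegment_symm]
    exact mem_segment_of_div_notMem_slitPlane hqv (sub_ne_zero.1 h2) h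
  unfold crossArg
  have hl := Complex.continuous_im.continuousAt.comp (continuousAt_logVar hC hCc hconn hq ha hb)
  refine (hl.sub ?_).sub ?_
  · exact ContinuousAt.comp (g := Complex.arg) (Complex.continuousAt_arg s2)
      (ContinuousAt.div (by fun_prop) (by fun_prop) h3)
  · exact ContinuousAt.comp (g := Complex.arg) (Complex.continuousAt_arg s1)
      (ContinuousAt.div (by fun_prop) (by fun_prop) h1)

/-- Near a point off `C` the cross argument is bounded below by slightly less than its value. -/
lemma eventually_lt_crossArg {C : Set ℂ} (hC : IsCompact C) (hCc : IsPreconnected C)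
    (hconn : IsConnected Cᶜ) {v a b q : ℂ} (ha : a ∈ C) (hb : b ∈ C) (hq : q ∉ C) (hqv : q ≠ v) :
    ∀ᶠ p in nhds q, crossArg C v a b q - 2 * Real.pi < crossArg C v a b p := by
  have h1 := sub_ne_zero_of_notMem hq ha
  have h2 := sub_ne_zero_of_notMem hq hb
  have h3 := sub_ne_zero.2 hqv
  have hpi := Real.pi_pos
  have hl := Complex.continuous_im.continuousAt.comp (continuousAt_logVar hC hCc hconn hq ha hb)
  have e1 := hl.eventually (lt_mem_nhds (show (logVar C q a b).im - 1 < _ by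
    simp only [Function.comp]; linarith))
  have c1 : ContinuousAt (fun p => (p - b) / (p - v)) q :=
    ContinuousAt.div (by fun_prop) (by fun_prop) h3
  have c2 : ContinuousAt (fun p => (p - v) / (p - a)) q :=
    ContinuousAt.div (by fun_prop) (by fun_prop) h1
  have e2 := c1.eventually (Complex.eventually_arg_lt (div_ne_zero h2 h3) one_pos)
  have e3 := c2.eventually (Complex.eventually_arg_lt (div_ne_zero h3 h1) one_pos)
  filter_upwards [e1, e2, e3] with p p1 p2 p3
  simp only [Function.comp] at p1
  unfold crossArg
  linarith [Real.pi_gt_three]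

lemma crossArg_near {C : Set ℂ} (hC : IsCompact C) (hCc : IsPreconnected C)
    (hconn : IsConnected Cᶜ) {v a b u : ℂ} (ha : a ∈ C) (hb : b ∈ C) (hv : v ∉ C) (hu : u ≠ 0)
    (hr : ∀ y ∈ C, ‖u‖ < ‖v - y‖) :
    crossArg C v a b (v + u) =
      (logVar C v a b).im - ((v - b) / u).arg - (u / (v - a)).arg := by
  have h1 := sub_ne_zero_of_notMem hv ha
  have h2 := sub_ne_zero_of_notMem hv hb
  have hlt : ∀ y ∈ C, ‖u / (v - y)‖ < 1 := fun y hy => by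
    rw [norm_div, div_lt_one ((norm_nonneg u).trans_lt (hr y hy))]; exact hr y hy
  have hadd : ∀ y ∈ C, (v + u - y) / (v - y) = 1 + u / (v - y) := fun y hy => by
    have := sub_ne_zero_of_notMem hv hy
    field_simp; ring
  have hpos : ∀ y ∈ C, 1 + u / (v - y) ≠ 0 := fun y hy h0 => by
    have h := hlt y hy
    rw [show u / (v - y) = -1 by linear_combination h0] at h
    simp at h
  rw [crossArg, logVar_move hC hCc hconn hv ha hb (q' := v + u) (by simpa using hr),
    hadd a ha, hadd b hb]
  have e1 : (v + u - b) / (v + u - v) = (1 + u / (v - b)) / (u / (v - b)) := by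
    rw [add_sub_cancel_left]; field_simp; ring
  have e2 : (v + u - v) / (v + u - a) = (u / (v - a)) / (1 + u / (v - a)) := by
    rw [add_sub_cancel_left, ← hadd a ha, div_div_div_cancel_right₀ h1]
  rw [e1, e2, (Complex.arg_div_one_add (div_ne_zero hu h2) (hlt b hb)).2,
    (Complex.arg_div_one_add (div_ne_zero hu h1) (hlt a ha)).1, inv_div]
  simp only [Complex.sub_im, Complex.add_im, Complex.log_im]
  ring

lemma crossArg_eq_zero_of_far {C : Set ℂ} (hC : IsCompact C) (hCc : IsPreconnected C)
    (hconn : IsConnected Cᶜ) {v a b q : ℂ} (ha : a ∈ C) (hb : b ∈ C) (hq : q ∉ C) {K : ℝ}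
    (hK : ∀ y ∈ C, ‖y‖ ≤ K) (hvK : ‖v‖ ≤ K) (hqK : 3 * K < ‖q‖) : crossArg C v a b q = 0 := by
  have hpi := Real.pi_pos
  have hqv : q ≠ v := fun h => by
    rw [h] at hqK; linarith [norm_nonneg v]
  obtain ⟨n, hn⟩ := exists_int_crossArg hC hCc hconn ha hb hq hqv
  have h1 := abs_lt.1 (abs_im_logVar_lt hCc hK ha hb (q := q) (by linarith [norm_nonneg v]))
  have h2 := abs_lt.1 (Complex.abs_arg_lt_pi_div_two_iff.2
    (Or.inl (sub_div_sub_re_pos (hK b hb) hvK hqK)))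
  have h3 := abs_lt.1 (Complex.abs_arg_lt_pi_div_two_iff.2
    (Or.inl (sub_div_sub_re_pos hvK (hK a ha) hqK)))
  have hlt : |crossArg C v a b q| < 2 * Real.pi := by
    rw [crossArg, abs_lt]; constructor <;> linarith
  rw [hn, abs_mul, abs_of_pos (by positivity : 0 < 2 * Real.pi)] at hlt
  have h4 : |(n : ℝ)| < 1 := by
    by_contra hcon
    rw [not_lt] at hcon
    nlinarith
  have h5 : |n| < 1 := by exact_mod_cast h4
  rw [hn, Int.abs_lt_one_iff.1 h5]; simp

lemma arg_div_of_mem_openSegment {v a p : ℂ} (hva : v ≠ a) (hp : p ∈ openSegment ℝ v a) :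
    ((p - v) / (p - a)).arg = Real.pi := by
  obtain ⟨s, t, hs, ht, hst, rfl⟩ := hp
  have hs' : (s : ℂ) = 1 - t := by rw [← Complex.ofReal_one, ← hst]; push_cast; ring
  have hs0 : (s : ℂ) ≠ 0 := by exact_mod_cast hs.ne'
  have h : (s • v + t • a - v) / (s • v + t • a - a) = ((-(t / s) : ℝ) : ℂ) := by
    have h1 : s • v + t • a - a = s * (v - a) := by
      simp only [Complex.real_smul]; linear_combination a * hs'
    have h2 : s • v + t • a - v = -t * (v - a) := by
      simp only [Complex.real_smul]; linear_combination v * hs'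
    have h3 := sub_ne_zero.2 hva
    rw [h1, h2]
    push_cast
    field_simp
  rw [h, Complex.arg_ofReal_of_neg]
  have : 0 < t / s := by positivity
  linarith

/-- Let `a`, `b` be points of a continuum `C` visible from `v`, and let `v` be joined to infinity
off `C` in the direction `d`. If `d`, `a - v`, `b - v` are in counterclockwise order, then the
loop `v → a → b → v`, running through `C` between `a` and `b`, has nonnegative winding numbers. -/
theorem crossArg_nonneg {C : Set ℂ} (hC : IsCompact C) (hCc : IsPreconnected C)
    (hconn : IsConnected Cᶜ) {v a b d : ℂ} (ha : a ∈ C) (hb : b ∈ C) (hv : v ∉ C)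
    (hva : Disjoint (openSegment ℝ v a) C) (hvb : Disjoint (openSegment ℝ v b) C)
    {U : Set ℂ} (hU : IsPreconnected U) (hUub : ¬ Bornology.IsBounded U) (hUC : Disjoint U C)
    (hUa : Disjoint U (segment ℝ v a)) (hUb : Disjoint U (segment ℝ v b))
    (hd0 : d ≠ 0) (hd : ∀ t : ℝ, 0 < t → t ≤ 1 → v + t * d ∈ U)
    {ra rb A B : ℝ} (hra : 0 < ra) (hrb : 0 < rb)
    (hA : v - a = d * (ra * Complex.exp (A * Complex.I)))
    (hB : v - b = d * (rb * Complex.exp (B * Complex.I)))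
    (hA1 : -Real.pi < A) (hAB : A < B) (hB1 : B < Real.pi) {q : ℂ} (hq : q ∉ C) (hqv : q ≠ v) :
    0 ≤ crossArg C v a b q := by
  have hpi := Real.pi_pos
  obtain ⟨r, hr, hrC⟩ := exists_forall_lt_norm_sub hC hv
  have hUv : ∀ p ∈ U, p ≠ v := fun p hp h =>
    Set.disjoint_left.1 hUa hp (h ▸ left_mem_segment ℝ v a)
  have hUq : ∀ p ∈ U, p ∉ C := fun p hp => Set.disjoint_left.1 hUC hp
  -- the value on `U`
  have hU0 : ∀ p ∈ U, crossArg C v a b p = 0 := by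
    obtain ⟨K, hK⟩ := hC.isBounded.exists_norm_le
    obtain ⟨p0, hp0U, hp0⟩ : ∃ p0 ∈ U, 3 * max K ‖v‖ < ‖p0‖ := by
      by_contra hcon
      push Not at hcon
      exact hUub (isBounded_iff_forall_norm_le.2 ⟨_, hcon⟩)
    have h0 := crossArg_eq_zero_of_far hC hCc hconn ha hb (hUq p0 hp0U)
      (fun y hy => (hK y hy).trans (le_max_left K ‖v‖)) (le_max_right K ‖v‖) hp0
    intro p hp
    rw [← h0]
    refine eq_of_continuousOn_two_pi_int hU (fun x hx => ContinuousAt.continuousWithinAt ?_)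
      (fun x hx => exists_int_crossArg hC hCc hconn ha hb (hUq x hx) (hUv x hx)) hp hp0U
    exact continuousAt_crossArg hC hCc hconn ha hb (hUq x hx) (hUv x hx)
      (fun h => Set.disjoint_left.1 hUa hx (openSegment_subset_segment ℝ _ _ h))
      (fun h => Set.disjoint_left.1 hUb hx (openSegment_subset_segment ℝ _ _ h))
  have hvim : (logVar C v a b).im = B - A := by
    have hdn := norm_pos_iff.2 hd0
    set t := min 1 (r / ‖d‖) with ht
    have ht0 : 0 < t := by positivity
    have h1 := hU0 _ (hd t ht0 (min_le_left _ _))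
    have htC : (t : ℂ) ≠ 0 := by exact_mod_cast ht0.ne'
    have hraC : (ra : ℂ) ≠ 0 := by exact_mod_cast hra.ne'
    rw [crossArg_near hC hCc hconn ha hb hv (mul_ne_zero htC hd0), hA, hB] at h1
    · have e1 : d * (rb * Complex.exp (B * Complex.I)) / (t * d) =
          ((rb / t : ℝ) : ℂ) * Complex.exp (B * Complex.I) := by
        push_cast; field_simp
      have e2 : t * d / (d * (ra * Complex.exp (A * Complex.I))) =
          ((t / ra : ℝ) : ℂ) * Complex.exp ((-A : ℝ) * Complex.I) := by
        push_cast; rw [neg_mul, Complex.exp_neg]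
        have := Complex.exp_ne_zero (A * Complex.I)
        field_simp
      rw [e1, e2, Complex.arg_ofReal_mul_exp_mul_I (by positivity) ⟨by linarith, hB1.le⟩,
        Complex.arg_ofReal_mul_exp_mul_I (by positivity) ⟨by linarith, by linarith⟩] at h1
      linarith
    · intro y hy
      refine lt_of_le_of_lt ?_ (hrC y hy)
      rw [norm_mul, Complex.norm_real, Real.norm_eq_abs, abs_of_pos ht0]
      calc t * ‖d‖ ≤ r / ‖d‖ * ‖d‖ := by gcongr; exact min_le_right _ _
        _ = r := by field_simp
  have hball : ∀ p ∈ Metric.ball v r, p ∉ C := fun p hp h => by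
    rw [Metric.mem_ball, dist_comm, dist_eq_norm] at hp
    linarith [hrC p h]
  have hnear : ∀ p ∈ Metric.ball v r, p ≠ v → 0 ≤ crossArg C v a b p := by
    intro p hp hpv
    refine crossArg_nonneg_of_gt hC hCc hconn ha hb (hball p hp) hpv ?_
    rw [Metric.mem_ball, dist_eq_norm] at hp
    have := crossArg_near hC hCc hconn ha hb hv (sub_ne_zero.2 hpv)
      (fun y hy => hp.trans (hrC y hy))
    rw [add_sub_cancel] at this
    rw [this, hvim]
    linarith [Complex.arg_le_pi ((v - b) / (p - v)), Complex.arg_le_pi ((p - v) / (v - a))]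
  -- points of the two open segments
  have hray : ∀ {c : ℂ} {rc T : ℝ}, 0 < rc → T ∈ Set.Ioc (-Real.pi) Real.pi →
      v - c = d * (rc * Complex.exp (T * Complex.I)) →
      ∀ p ∈ openSegment ℝ v c, ((v - p) / d).arg = T := by
    rintro c rc T hrc hT hc p ⟨s, t, hs, ht, hst, rfl⟩
    have : (v - (s • v + t • c)) / d = ((t * rc : ℝ) : ℂ) * Complex.exp (T * Complex.I) := by
      have hs' : (s : ℂ) = 1 - t := by rw [← Complex.ofReal_one, ← hst]; push_cast; ring
      rw [Complex.real_smul, Complex.real_smul, hs', div_eq_iff hd0]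
      push_cast
      linear_combination (t : ℂ) * hc
    rw [this, Complex.arg_ofReal_mul_exp_mul_I (by positivity) hT]
  have hAmem : A ∈ Set.Ioc (-Real.pi) Real.pi := ⟨hA1, by linarith⟩
  have hBmem : B ∈ Set.Ioc (-Real.pi) Real.pi := ⟨by linarith, hB1.le⟩
  have hab : ∀ p ∈ openSegment ℝ v a, p ∉ openSegment ℝ v b := fun p h1 h2 => by
    rw [← hray hra hAmem hA p h1, ← hray hrb hBmem hB p h2] at hAB
    exact lt_irrefl _ hAB
  have hsegne : ∀ c ∈ C, ∀ p ∈ openSegment ℝ v c, p ≠ v := by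
    rintro c hc p ⟨s, t, hs, ht, hst, rfl⟩ h
    have hs' : (s : ℂ) = 1 - t := by rw [← Complex.ofReal_one, ← hst]; push_cast; ring
    rw [Complex.real_smul, Complex.real_smul, hs'] at h
    have : (t : ℂ) * (v - c) = 0 := by linear_combination -h
    rcases mul_eq_zero.1 this with h | h
    · exact ht.ne' (by exact_mod_cast h)
    · exact sub_ne_zero_of_notMem hv hc h
  have hsegnear : ∀ c ∈ C, ∃ p ∈ openSegment ℝ v c, p ∈ Metric.ball v r := by
    intro c hc
    have hn := norm_pos_iff.2 (sub_ne_zero_of_notMem hv hc)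
    have hrc := hrC c hc
    set t := r / 2 / ‖v - c‖ with ht
    have ht0 : 0 < t := by positivity
    have ht1 : t < 1 := by rw [ht, div_lt_one hn]; linarith
    refine ⟨(1 - t) • v + t • c, ⟨1 - t, t, by linarith, ht0, by ring, rfl⟩, ?_⟩
    rw [Metric.mem_ball, dist_comm, dist_eq_norm]
    have : v - ((1 - t) • v + t • c) = (t : ℂ) * (v - c) := by
      simp only [Complex.real_smul]; push_cast; ring
    rw [this, norm_mul, Complex.norm_real, Real.norm_eq_abs, abs_of_pos ht0, ht]
    have : r / 2 / ‖v - c‖ * ‖v - c‖ = r / 2 := by field_simp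
    rw [this]; linarith
  have hsega : ∀ p ∈ openSegment ℝ v a, 0 ≤ crossArg C v a b p := by
    intro p hp
    obtain ⟨p', hp', hpr⟩ := hsegnear a ha
    rw [show crossArg C v a b p = crossArg C v a b p' from ?_]
    · exact hnear p' hpr (hsegne a ha p' hp')
    refine eq_of_continuousOn_two_pi_int (convex_openSegment v a).isPreconnected ?_
      (fun x hx => exists_int_crossArg hC hCc hconn ha hb (Set.disjoint_left.1 hva hx)
        (hsegne a ha x hx)) hp hp'
    have hcl : ContinuousOn (fun q => (logVar C q a b).im - ((q - b) / (q - v)).arg - Real.pi)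
        (openSegment ℝ v a) := fun x hx => by
      have hx' := Set.disjoint_left.1 hva hx
      refine ContinuousAt.continuousWithinAt (ContinuousAt.sub (ContinuousAt.sub
        (Complex.continuous_im.continuousAt.comp
          (continuousAt_logVar hC hCc hconn hx' ha hb)) ?_) continuousAt_const)
      refine ContinuousAt.comp (g := Complex.arg) (Complex.continuousAt_arg ?_)
        ((continuousAt_id.sub continuousAt_const).div
          (continuousAt_id.sub continuousAt_const) (sub_ne_zero.2 (hsegne a ha x hx)))
      by_contra hcon
      refine hab x hx ?_
      rw [openSegment_symm]
      exact mem_segment_of_div_notMem_slitPlane (hsegne a ha x hx)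
        (fun h => hx' (h ▸ hb)) hcon
    refine hcl.congr fun x hx => ?_
    rw [crossArg, arg_div_of_mem_openSegment (fun h : v = a => hv (h ▸ ha)) hx]
  have hsegb : ∀ p ∈ openSegment ℝ v b, 0 ≤ crossArg C v a b p := by
    intro p hp
    obtain ⟨p', hp', hpr⟩ := hsegnear b hb
    rw [show crossArg C v a b p = crossArg C v a b p' from ?_]
    · exact hnear p' hpr (hsegne b hb p' hp')
    refine eq_of_continuousOn_two_pi_int (convex_openSegment v b).isPreconnected ?_
      (fun x hx => exists_int_crossArg hC hCc hconn ha hb (Set.disjoint_left.1 hvb hx)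
        (hsegne b hb x hx)) hp hp'
    have hcl : ContinuousOn (fun q => (logVar C q a b).im - Real.pi - ((q - v) / (q - a)).arg)
        (openSegment ℝ v b) := fun x hx => by
      have hx' := Set.disjoint_left.1 hvb hx
      refine ContinuousAt.continuousWithinAt (ContinuousAt.sub (ContinuousAt.sub
        (Complex.continuous_im.continuousAt.comp
          (continuousAt_logVar hC hCc hconn hx' ha hb)) continuousAt_const) ?_)
      refine ContinuousAt.comp (g := Complex.arg) (Complex.continuousAt_arg ?_)
        ((continuousAt_id.sub continuousAt_const).div
          (continuousAt_id.sub continuousAt_const) (sub_ne_zero_of_notMem hx' ha))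
      by_contra hcon
      refine hab x ?_ hx
      exact mem_segment_of_div_notMem_slitPlane (fun h => hx' (h ▸ ha))
        (hsegne b hb x hx) hcon
    refine hcl.congr fun x hx => ?_
    rw [crossArg, arg_div_of_mem_openSegment (fun h : b = v => hv (h ▸ hb))
      (openSegment_symm ℝ v b ▸ hx)]
  -- a clopen argument
  have hgood : IsOpen {p | p ∉ C ∧ (p = v ∨ 0 ≤ crossArg C v a b p)} := by
    rw [isOpen_iff_mem_nhds]
    rintro p ⟨hp, hp'⟩
    by_cases hpv : p = v
    · rw [hpv]
      filter_upwards [Metric.ball_mem_nhds v hr] with x hx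
      refine ⟨hball x hx, ?_⟩
      by_cases hxv : x = v
      · exact Or.inl hxv
      · exact Or.inr (hnear x hx hxv)
    · have hp0 := hp'.resolve_left hpv
      filter_upwards [hC.isClosed.isOpen_compl.mem_nhds hp, isOpen_ne.mem_nhds hpv,
        eventually_lt_crossArg hC hCc hconn ha hb hp hpv] with x h1 h2 h3
      exact ⟨h1, Or.inr (crossArg_nonneg_of_gt hC hCc hconn ha hb h1 h2 (by linarith))⟩
  have hbad : IsOpen {p | p ∉ C ∧ p ≠ v ∧ crossArg C v a b p < 0} := by
    rw [isOpen_iff_mem_nhds]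
    rintro p ⟨hp, hpv, hp'⟩
    have hc := continuousAt_crossArg hC hCc hconn ha hb hp hpv
      (fun h => absurd (hsega p h) (not_le.2 hp')) (fun h => absurd (hsegb p h) (not_le.2 hp'))
    filter_upwards [hC.isClosed.isOpen_compl.mem_nhds hp, isOpen_ne.mem_nhds hpv,
      hc.eventually (gt_mem_nhds hp')] with x h1 h2 h3
    exact ⟨h1, h2, h3⟩
  by_contra hcon
  obtain ⟨p, -, ⟨-, h1⟩, -, h2, h3⟩ := hconn.isPreconnected _ _ hgood hbad
    (fun p hp => by
      by_cases h : p ≠ v ∧ crossArg C v a b p < 0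
      · exact Or.inr ⟨hp, h⟩
      · refine Or.inl ⟨hp, ?_⟩
        by_cases hpv : p = v
        · exact Or.inl hpv
        · exact Or.inr (not_lt.1 fun h' => h ⟨hpv, h'⟩))
    ⟨v, hv, hv, Or.inl rfl⟩ ⟨q, hq, hq, hqv, not_le.1 hcon⟩
  rcases h1 with h1 | h1
  · exact h2 h1
  · linarith

/-! ### Boundary sums over finite sets of grid cells -/

/-- The `k`-th of the four cells around the grid vertex `0`, in counterclockwise order. -/
def quad : Fin 4 → ℤ × ℤ := ![(0, 0), (-1, 0), (-1, -1), (0, -1)]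

/-- The neighbour of the cell `c` across the edge from its `k`-th to its `k + 1`-st corner. -/
def nbr (c : ℤ × ℤ) (k : Fin 4) : ℤ × ℤ := c - quad k + quad (k + 3)

lemma quad_add (k : Fin 4) : quad k + quad (k + 2) = quad (k + 1) + quad (k + 3) := by
  revert k; decide

lemma Fin.four_add (k : Fin 4) : k + 3 + 1 = k ∧ k + 1 + 3 = k ∧ k + 2 + 2 = k ∧
    k + 2 + 1 = k + 3 ∧ k + 2 + 3 = k + 1 ∧ k + 3 + 3 = k + 2 ∧ k + 2 ≠ k ∧ k + 1 + 1 = k + 2 := by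
  revert k; decide

lemma nbr_nbr (c : ℤ × ℤ) (k : Fin 4) : nbr (nbr c k) (k + 2) = c := by
  have := quad_add k
  simp only [nbr, (Fin.four_add k).2.2.2.2.1]
  linear_combination (exp := 1) -this

lemma sum_boundary_eq {N : Finset (ℤ × ℤ)} {g : ℤ × ℤ → Fin 4 → ℝ}
    (hg : ∀ c ∈ N, ∀ k, nbr c k ∈ N → g c k + g (nbr c k) (k + 2) = 0) :
    ∑ c ∈ N, ∑ k, (if nbr c k ∉ N then g c k else 0) = ∑ c ∈ N, ∑ k, g c k := by
  have h0 : ∑ c ∈ N, ∑ k, (if nbr c k ∈ N then g c k else 0) = 0 := by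
    rw [← Finset.sum_product', ← Finset.sum_filter]
    refine Finset.sum_involution (fun x _ => (nbr x.1 x.2, x.2 + 2)) ?_ ?_ ?_ ?_
    · rintro ⟨c, k⟩ h
      simp only [Finset.mem_filter, Finset.mem_product, Finset.mem_univ, and_true] at h
      exact hg c h.1 k h.2
    · rintro ⟨c, k⟩ _ _ h
      exact (Fin.four_add k).2.2.2.2.2.2.1 (Prod.mk.inj h).2
    · rintro ⟨c, k⟩ h
      simp only [Finset.mem_filter, Finset.mem_product, Finset.mem_univ, and_true] at h ⊢
      exact ⟨h.2, (nbr_nbr c k).symm ▸ h.1⟩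
    · rintro ⟨c, k⟩ _
      simp [nbr_nbr, (Fin.four_add k).2.2.1]
  refine Eq.trans ?_ ((congrArg (_ - ·) h0).trans (sub_zero (∑ c ∈ N, ∑ k, g c k)))
  rw [← Finset.sum_sub_distrib]
  refine Finset.sum_congr rfl fun c _ => ?_
  rw [← Finset.sum_sub_distrib]
  refine Finset.sum_congr rfl fun k _ => ?_
  by_cases h : nbr c k ∈ N <;> simp [h]

lemma sum_cells_eq_sum_vertices (N : Finset (ℤ × ℤ)) (F : ℤ × ℤ → Fin 4 → ℝ) :
    ∑ c ∈ N, ∑ k, F c k = ∑ v ∈ (N ×ˢ Finset.univ).image (fun x : _ × Fin 4 => x.1 - quad x.2),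
      ∑ k, if v + quad k ∈ N then F (v + quad k) k else 0 := by
  rw [Finset.sum_comm, Finset.sum_comm (t := Finset.univ)]
  refine Finset.sum_congr rfl fun k _ => ?_
  rw [← Finset.sum_filter]
  refine Finset.sum_nbij' (fun c => c - quad k) (fun v => v + quad k) ?_ ?_ ?_ ?_ ?_
  · intro c hc
    simp only [Finset.mem_filter, Finset.mem_image, Finset.mem_product, Finset.mem_univ, and_true,
      sub_add_cancel]
    exact ⟨⟨(c, k), hc, rfl⟩, hc⟩
  · intro v hv
    exact (Finset.mem_filter.1 hv).2
  · simp
  · simp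
  · simp

lemma sum_around_vertex_nonneg {χ : Fin 4 → Prop} [DecidablePred χ] {s t : Fin 4 → ℝ}
    (h : ∀ k l, l ≠ 3 → ¬ χ (k + 3) → χ k → χ (k + l) → ¬ χ (k + l + 1) → s k ≤ t (k + l)) :
    0 ≤ ∑ k, ((if χ k then (if ¬ χ (k + 1) then t k else 0) else 0) -
      if χ k then (if ¬ χ (k + 3) then s k else 0) else 0) := by
  have h00 := h 0 0; have h01 := h 0 1; have h02 := h 0 2
  have h10 := h 1 0; have h11 := h 1 1; have h12 := h 1 2
  have h20 := h 2 0; have h21 := h 2 1; have h22 := h 2 2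
  have h30 := h 3 0; have h31 := h 3 1; have h32 := h 3 2
  clear h
  simp only [Fin.sum_univ_four, Fin.isValue, show (0 : Fin 4) + 1 = 1 from rfl,
    show (0 : Fin 4) + 2 = 2 from rfl, show (0 : Fin 4) + 3 = 3 from rfl,
    show (1 : Fin 4) + 1 = 2 from rfl, show (1 : Fin 4) + 2 = 3 from rfl,
    show (1 : Fin 4) + 3 = 0 from rfl, show (2 : Fin 4) + 1 = 3 from rfl,
    show (2 : Fin 4) + 2 = 0 from rfl, show (2 : Fin 4) + 3 = 1 from rfl,
    show (3 : Fin 4) + 1 = 0 from rfl, show (3 : Fin 4) + 2 = 1 from rfl,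
    show (3 : Fin 4) + 3 = 2 from rfl, show (0 : Fin 4) + 0 = 0 from rfl,
    show (1 : Fin 4) + 0 = 1 from rfl, show (2 : Fin 4) + 0 = 2 from rfl,
    show (3 : Fin 4) + 0 = 3 from rfl, ne_eq, show ¬ (0 : Fin 4) = 3 by decide,
    show ¬ (1 : Fin 4) = 3 by decide, show ¬ (2 : Fin 4) = 3 by decide, not_false_eq_true,
    forall_const] at *
  by_cases c0 : χ 0 <;> by_cases c1 : χ 1 <;> by_cases c2 : χ 2 <;> by_cases c3 : χ 3 <;>
    simp only [c0, c1, c2, c3, not_true_eq_false, not_false_eq_true, if_true, if_false,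
      forall_const, false_imp_iff] at * <;> linarith

lemma sum_boundary_nonneg {N : Finset (ℤ × ℤ)} {S T : ℤ × ℤ → Fin 4 → ℝ}
    (h : ∀ (v : ℤ × ℤ) (k l : Fin 4), l ≠ 3 → v + quad (k + 3) ∉ N → v + quad k ∈ N →
      v + quad (k + l) ∈ N → v + quad (k + l + 1) ∉ N →
      S (v + quad k) k ≤ T (v + quad (k + l)) (k + l + 3)) :
    0 ≤ ∑ c ∈ N, ∑ k, (if nbr c k ∉ N then T c k - S c k else 0) := by
  have hT : ∑ c ∈ N, ∑ k, (if nbr c k ∉ N then T c k else 0) =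
      ∑ c ∈ N, ∑ k, (if c - quad k + quad (k + 1) ∉ N then T c (k + 3) else 0) := by
    refine Finset.sum_congr rfl fun c _ => ?_
    rw [← Equiv.sum_comp (Equiv.addRight (3 : Fin 4))]
    refine Finset.sum_congr rfl fun k _ => ?_
    have : nbr c (k + 3) = c - quad k + quad (k + 1) := by
      have := quad_add k
      simp only [nbr, (Fin.four_add k).2.2.2.2.2.1]
      linear_combination (exp := 1) this
    simp only [Equiv.coe_addRight, this]
  have hsplit : ∑ c ∈ N, ∑ k, (if nbr c k ∉ N then T c k - S c k else 0) =
      ∑ c ∈ N, ∑ k, (if nbr c k ∉ N then T c k else 0) -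
        ∑ c ∈ N, ∑ k, (if nbr c k ∉ N then S c k else 0) := by
    simp only [← Finset.sum_sub_distrib]
    refine Finset.sum_congr rfl fun c _ => Finset.sum_congr rfl fun k _ => ?_
    by_cases h : nbr c k ∈ N <;> simp [h]
  rw [hsplit, hT, sum_cells_eq_sum_vertices, sum_cells_eq_sum_vertices N
    (fun c k => if nbr c k ∉ N then S c k else 0), ← Finset.sum_sub_distrib]
  refine Finset.sum_nonneg fun v _ => ?_
  rw [← Finset.sum_sub_distrib]
  simp only [nbr, add_sub_cancel_right]
  exact sum_around_vertex_nonneg (χ := fun k => v + quad k ∈ N)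
    (s := fun k => S (v + quad k) k) (t := fun k => T (v + quad k) (k + 3)) (h v)

/-! ### The unit grid in the complex plane -/

open Complex in
/-- The four unit directions, in counterclockwise order. -/
noncomputable def dir : Fin 4 → ℂ := ![1, I, -1, -I]

/-- The center of a grid cell. -/
noncomputable def cellCenter (c : ℤ × ℤ) : ℂ := ⟨c.1, c.2⟩

/-- The position of a grid vertex; `gridVertex v` is the lower left corner of `gridCell v`. -/
noncomputable def gridVertex (v : ℤ × ℤ) : ℂ := ⟨v.1 - 1 / 2, v.2 - 1 / 2⟩

/-- The closed unit square centered at `cellCenter c`. -/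
def gridCell (c : ℤ × ℤ) : Set ℂ := {x | |x.re - c.1| ≤ 1 / 2 ∧ |x.im - c.2| ≤ 1 / 2}

lemma dir_ne_zero (k : Fin 4) : dir k ≠ 0 := by
  fin_cases k <;> simp [dir]

lemma dir_add (k l : Fin 4) : dir (k + l) = dir k * dir l := by
  fin_cases k <;> fin_cases l <;> simp [dir]

lemma gridVertex_sub_quad_add_one (c : ℤ × ℤ) (k : Fin 4) :
    gridVertex (c - quad (k + 1)) = gridVertex (c - quad k) + dir k := by
  fin_cases k <;> apply Complex.ext <;> simp [gridVertex, quad, dir] <;> ring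

lemma mem_gridCell_add_quad_iff {v : ℤ × ℤ} {k : Fin 4} {u : ℂ} :
    gridVertex v + dir k * u ∈ gridCell (v + quad k) ↔
      (0 ≤ u.re ∧ u.re ≤ 1) ∧ 0 ≤ u.im ∧ u.im ≤ 1 := by
  fin_cases k <;> simp [gridVertex, gridCell, quad, dir, abs_le] <;> constructor <;>
    rintro ⟨⟨h1, h2⟩, h3, h4⟩ <;> refine ⟨⟨?_, ?_⟩, ?_, ?_⟩ <;> linarith

lemma cellCenter_add_quad (v : ℤ × ℤ) (k : Fin 4) :
    cellCenter (v + quad k) = gridVertex v + dir k * ((1 + Complex.I) / 2) := by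
  fin_cases k <;> apply Complex.ext <;> simp [gridVertex, cellCenter, quad, dir] <;> ring

lemma gridCell_eq (c : ℤ × ℤ) : gridCell c =
    Complex.re ⁻¹' Set.Icc ((c.1 : ℝ) - 1 / 2) (c.1 + 1 / 2) ∩
      Complex.im ⁻¹' Set.Icc ((c.2 : ℝ) - 1 / 2) (c.2 + 1 / 2) := by
  ext x
  simp only [gridCell, abs_le, Set.mem_ofPred_eq, Set.mem_inter_iff, Set.mem_preimage, Set.mem_Icc]
  constructor <;> rintro ⟨⟨h1, h2⟩, h3, h4⟩ <;> refine ⟨⟨?_, ?_⟩, ?_, ?_⟩ <;> linarith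

lemma convex_gridCell (c : ℤ × ℤ) : Convex ℝ (gridCell c) := by
  rw [gridCell_eq]
  exact ((convex_Icc _ _).linear_preimage Complex.reLm).inter
    ((convex_Icc _ _).linear_preimage Complex.imLm)

lemma isClosed_gridCell (c : ℤ × ℤ) : IsClosed (gridCell c) := by
  rw [gridCell_eq]
  exact (isClosed_Icc.preimage Complex.continuous_re).inter
    (isClosed_Icc.preimage Complex.continuous_im)

lemma gridVertex_sub_quad_mem (c : ℤ × ℤ) (k : Fin 4) :
    gridVertex (c - quad k) ∈ gridCell c := by
  have := (mem_gridCell_add_quad_iff (v := c - quad k) (k := k) (u := 0)).2 (by simp)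
  simpa using this

lemma exists_mem_gridCell (x : ℂ) : ∃ c, x ∈ gridCell c :=
  ⟨(round x.re, round x.im), abs_sub_round _, abs_sub_round _⟩

lemma dist_le_of_mem_gridCell {c : ℤ × ℤ} {x y : ℂ} (hx : x ∈ gridCell c) (hy : y ∈ gridCell c) :
    dist x y < 2 := by
  obtain ⟨h1, h2⟩ := hx
  obtain ⟨h3, h4⟩ := hy
  rw [abs_le] at h1 h2 h3 h4
  rw [dist_eq_norm]
  have h5 : ‖x - y‖ ^ 2 ≤ 2 := by
    rw [Complex.sq_norm, Complex.normSq_apply, Complex.sub_re, Complex.sub_im]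
    nlinarith
  nlinarith [norm_nonneg (x - y)]

lemma eq_of_mem_gridCell_of_lt {c c' : ℤ × ℤ} {x : ℂ} (hx : x ∈ gridCell c')
    (h1 : |x.re - c.1| < 1 / 2) (h2 : |x.im - c.2| < 1 / 2) : c' = c := by
  obtain ⟨h3, h4⟩ := hx
  rw [abs_le] at h3 h4
  rw [abs_lt] at h1 h2
  apply Prod.ext
  · have a1 : (c'.1 : ℝ) < c.1 + 1 := by linarith
    have a2 : (c.1 : ℝ) < c'.1 + 1 := by linarith
    have a1' : c'.1 < c.1 + 1 := by exact_mod_cast a1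
    have a2' : c.1 < c'.1 + 1 := by exact_mod_cast a2
    omega
  · have a1 : (c'.2 : ℝ) < c.2 + 1 := by linarith
    have a2 : (c.2 : ℝ) < c'.2 + 1 := by linarith
    have a1' : c'.2 < c.2 + 1 := by exact_mod_cast a1
    have a2' : c.2 < c'.2 + 1 := by exact_mod_cast a2
    omega

/-- Points on the diagonal of a cell are interior to it. -/
lemma eq_of_mem_gridCell_diagonal {v c : ℤ × ℤ} {k : Fin 4} {t : ℝ} (ht0 : 0 < t) (ht1 : t ≤ 1)
    (h : gridVertex v + t * (dir k * ((1 - Complex.I) / 2)) ∈ gridCell c) :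
    c = v + quad (k + 3) := by
  refine eq_of_mem_gridCell_of_lt h ?_ ?_ <;> fin_cases k <;>
    simp [gridVertex, quad, dir, abs_lt] <;> constructor <;> linarith

/-- Points on the segment joining the centers of adjacent cells lie in no other cell. -/
lemma eq_or_eq_of_mem_gridCell {v c : ℤ × ℤ} {k : Fin 4} {t : ℝ} (ht0 : -1 / 2 ≤ t)
    (ht1 : t ≤ 1 / 2) (h : gridVertex v + dir k * (1 / 2 + t * Complex.I) ∈ gridCell c) :
    c = v + quad k ∨ c = v + quad (k + 3) := by
  obtain ⟨h3, h4⟩ := h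
  rw [abs_le] at h3 h4
  obtain ⟨m, n⟩ := c
  obtain ⟨a, b⟩ := v
  have key : ∀ {i j : ℤ} {s : ℝ}, -1 / 2 ≤ s → s ≤ 1 / 2 → -(1 / 2) ≤ i - 1 / 2 + s - j →
      i - 1 / 2 + s - j ≤ 1 / 2 → j = i ∨ j = i - 1 := fun {i j s} h1 h2 h3 h4 => by
    have a1 : (j : ℝ) < i + 1 := by linarith
    have a2 : (i : ℝ) < j + 2 := by linarith
    have a1' : j < i + 1 := by exact_mod_cast a1
    have a2' : i < j + 2 := by exact_mod_cast a2
    omega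
  have key' : ∀ {i j : ℤ}, -(1 / 2) ≤ (i : ℝ) - j → (i : ℝ) - j ≤ 1 / 2 → j = i :=
      fun {i j} h1 h2 => by
    have a1 : (j : ℝ) < i + 1 := by linarith
    have a2 : (i : ℝ) < j + 1 := by linarith
    have a1' : j < i + 1 := by exact_mod_cast a1
    have a2' : i < j + 1 := by exact_mod_cast a2
    omega
  fin_cases k <;> simp [gridVertex, dir] at h3 h4 <;> simp [quad]
  · have e1 : m = a := key' (by linarith) (by linarith)
    have e2 := key (i := b) (j := n) ht0 ht1 (by linarith) (by linarith)
    omega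
  · have e1 : n = b := key' (by linarith) (by linarith)
    have e2 := key (i := a) (j := m) (s := -t) (by linarith) (by linarith) (by linarith)
      (by linarith)
    omega
  · have e1 : m = a - 1 := key' (by push_cast; linarith) (by push_cast; linarith)
    have e2 := key (i := b) (j := n) (s := -t) (by linarith) (by linarith) (by linarith)
      (by linarith)
    omega
  · have e1 : n = b - 1 := key' (by push_cast; linarith) (by push_cast; linarith)
    have e2 := key (i := a) (j := m) (s := t) (by linarith) (by linarith) (by linarith)
      (by linarith)
    omega

/-! ### The unbounded grid region around a compact set, and points visible from it -/

/-- `U` is an unbounded component of the set of points no cell around which meets `C`. -/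
structure IsGridExterior (C U : Set ℂ) : Prop where
  isCompact : IsCompact C
  isPreconnected : IsPreconnected C
  isConnected_compl : IsConnected Cᶜ
  isPreconnected_exterior : IsPreconnected U
  not_isBounded : ¬ Bornology.IsBounded U
  disjoint_gridCell : ∀ x ∈ U, ∀ c, x ∈ gridCell c → Disjoint (gridCell c) C
  maximal : ∀ K, IsPreconnected K → (∀ x ∈ K, ∀ c, x ∈ gridCell c → Disjoint (gridCell c) C) →
    (K ∩ U).Nonempty → K ⊆ U

/-- The height of `x` over the `k`-th edge of the cell `c`. -/
noncomputable def edgeHeight (c : ℤ × ℤ) (k : Fin 4) (x : ℂ) : ℝ :=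
  ((x - gridVertex (c - quad k)) / dir k).im

/-- A point of `C ∩ gridCell c` nearest to the `k`-th edge of `c`. -/
noncomputable def lowPoint (C : Set ℂ) (c : ℤ × ℤ) (k : Fin 4) : ℂ :=
  Classical.epsilon fun p => p ∈ C ∩ gridCell c ∧
    ∀ y ∈ C ∩ gridCell c, edgeHeight c k p ≤ edgeHeight c k y

lemma edgeHeight_add (v : ℤ × ℤ) (k : Fin 4) (u : ℂ) :
    edgeHeight (v + quad k) k (gridVertex v + dir k * u) = u.im := by
  rw [edgeHeight, add_sub_cancel_right, add_sub_cancel_left, mul_div_cancel_left₀ _ (dir_ne_zero k)]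

lemma cellCenter_mem (c : ℤ × ℤ) : cellCenter c ∈ gridCell c := by
  simp [cellCenter, gridCell]

lemma edge_mem_gridCell (v : ℤ × ℤ) (k : Fin 4) {t : ℝ} (h0 : 0 ≤ t) (h1 : t ≤ 1) :
    gridVertex v + dir k * t ∈ gridCell (v + quad (k + 3)) := by
  have h : dir k = dir (k + 3) * Complex.I := by
    rw [dir_add]; fin_cases k <;> simp [dir]
  rw [h, mul_assoc, mem_gridCell_add_quad_iff]
  simp [h0, h1]

lemma exists_lowPoint {C : Set ℂ} (hC : IsCompact C) {c : ℤ × ℤ} (k : Fin 4)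
    (h : (C ∩ gridCell c).Nonempty) : lowPoint C c k ∈ C ∩ gridCell c ∧
      ∀ y ∈ C ∩ gridCell c, edgeHeight c k (lowPoint C c k) ≤ edgeHeight c k y := by
  refine Classical.epsilon_spec (p := fun p => p ∈ C ∩ gridCell c ∧
    ∀ y ∈ C ∩ gridCell c, edgeHeight c k p ≤ edgeHeight c k y) ?_
  have hcont : Continuous (edgeHeight c k) :=
    Complex.continuous_im.comp ((continuous_id.sub continuous_const).div_const _)
  exact (hC.inter_right (isClosed_gridCell c)).exists_isMinOn h hcont.continuousOn

namespace IsGridExterior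

variable {C U : Set ℂ}

lemma disjoint (h : IsGridExterior C U) : Disjoint U C := by
  rw [Set.disjoint_left]
  intro x hx hxC
  obtain ⟨c, hc⟩ := exists_mem_gridCell x
  exact Set.disjoint_left.1 (h.disjoint_gridCell x hx c hc) hc hxC

lemma disjoint_of_meets (h : IsGridExterior C U) {c : ℤ × ℤ} (hc : (C ∩ gridCell c).Nonempty) :
    Disjoint U (gridCell c) := by
  rw [Set.disjoint_left]
  intro x hx hxc
  obtain ⟨y, hy, hyc⟩ := hc
  exact Set.disjoint_left.1 (h.disjoint_gridCell x hx c hxc) hyc hy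

lemma ray_mem (h : IsGridExterior C U) {v : ℤ × ℤ} {k : Fin 4}
    (hU : cellCenter (v + quad (k + 3)) ∈ U) {t : ℝ} (ht0 : 0 < t) (ht1 : t ≤ 1) :
    gridVertex v + t * (dir k * ((1 - Complex.I) / 2)) ∈ U := by
  have hK : IsPreconnected ((fun t : ℝ => gridVertex v + t * (dir k * ((1 - Complex.I) / 2))) ''
      Set.Ioc 0 1) := isPreconnected_Ioc.image _ (by fun_prop)
  refine h.maximal _ hK ?_ ⟨_, ⟨1, by simp, rfl⟩, ?_⟩ ⟨t, ⟨ht0, ht1⟩, rfl⟩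
  · rintro _ ⟨s, ⟨hs0, hs1⟩, rfl⟩ c hc
    rw [eq_of_mem_gridCell_diagonal hs0 hs1 hc]
    exact h.disjoint_gridCell _ hU _ (cellCenter_mem _)
  · convert hU using 1
    rw [cellCenter_add_quad, dir_add]
    fin_cases k <;> apply Complex.ext <;> simp [dir] <;> ring

lemma meets (h : IsGridExterior C U) {v : ℤ × ℤ} {k : Fin 4}
    (hU : cellCenter (v + quad (k + 3)) ∈ U) (hU' : cellCenter (v + quad k) ∉ U) :
    (C ∩ gridCell (v + quad k)).Nonempty := by
  by_contra hcon
  have hdisj : Disjoint (gridCell (v + quad k)) C := by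
    rw [Set.disjoint_iff_inter_eq_empty, Set.inter_comm]
    exact Set.not_nonempty_iff_eq_empty.1 hcon
  have hK : IsPreconnected ((fun t : ℝ => gridVertex v + dir k * (1 / 2 + t * Complex.I)) ''
      Set.Icc (-1 / 2) (1 / 2)) := isPreconnected_Icc.image _ (by fun_prop)
  refine hU' (h.maximal _ hK ?_ ⟨_, ⟨-1 / 2, by norm_num, rfl⟩, ?_⟩ ⟨1 / 2, by norm_num, ?_⟩)
  · rintro _ ⟨s, ⟨hs0, hs1⟩, rfl⟩ c hc
    rcases eq_or_eq_of_mem_gridCell hs0 hs1 hc with rfl | rfl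
    · exact hdisj
    · exact h.disjoint_gridCell _ hU _ (cellCenter_mem _)
  · convert hU using 1
    rw [cellCenter_add_quad, dir_add]
    fin_cases k <;> apply Complex.ext <;> simp [dir] <;> ring
  · rw [cellCenter_add_quad]
    push_cast; ring

lemma edge_notMem (h : IsGridExterior C U) {v : ℤ × ℤ} {k : Fin 4}
    (hU : cellCenter (v + quad (k + 3)) ∈ U) {t : ℝ} (h0 : 0 ≤ t) (h1 : t ≤ 1) :
    gridVertex v + dir k * t ∉ C :=
  Set.disjoint_left.1 (h.disjoint_gridCell _ hU _ (cellCenter_mem _)) (edge_mem_gridCell v k h0 h1)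

lemma lowPoint_spec (h : IsGridExterior C U) {v : ℤ × ℤ} {k : Fin 4}
    (hU : cellCenter (v + quad (k + 3)) ∈ U) (hU' : cellCenter (v + quad k) ∉ U) :
    ∃ u : ℂ, lowPoint C (v + quad k) k = gridVertex v + dir k * u ∧ 0 ≤ u.re ∧ u.re ≤ 1 ∧
      0 < u.im ∧ gridVertex v + dir k * u ∈ C ∩ gridCell (v + quad k) ∧
      ∀ w, gridVertex v + dir k * w ∈ C ∩ gridCell (v + quad k) → u.im ≤ w.im := by
  obtain ⟨hp, hmin⟩ := exists_lowPoint h.isCompact k (h.meets hU hU')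
  obtain ⟨u, hu⟩ : ∃ u, lowPoint C (v + quad k) k = gridVertex v + dir k * u :=
    ⟨(lowPoint C (v + quad k) k - gridVertex v) / dir k, by
      rw [mul_div_cancel₀ _ (dir_ne_zero k), add_sub_cancel]⟩
  rw [hu] at hp hmin
  obtain ⟨⟨h1, h2⟩, h3, h4⟩ := mem_gridCell_add_quad_iff.1 hp.2
  refine ⟨u, hu, h1, h2, lt_of_le_of_ne h3 fun h0 => ?_, hp, fun w hw => ?_⟩
  · refine h.edge_notMem hU h1 h2 ?_
    convert hp.1
    apply Complex.ext <;> simp [h0]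
  · simpa only [edgeHeight_add] using hmin _ hw

/-- The end points of a boundary edge see the corresponding point of `C`. -/
lemma disjoint_openSegment (h : IsGridExterior C U) {v : ℤ × ℤ} {k : Fin 4}
    (hU : cellCenter (v + quad (k + 3)) ∈ U) (hU' : cellCenter (v + quad k) ∉ U) {t : ℝ}
    (h0 : 0 ≤ t) (h1 : t ≤ 1) :
    Disjoint (openSegment ℝ (gridVertex v + dir k * t) (lowPoint C (v + quad k) k)) C := by
  obtain ⟨u, hu, hu1, hu2, hu3, hp, hmin⟩ := h.lowPoint_spec hU hU'
  rw [hu, Set.disjoint_left]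
  rintro _ ⟨a, b, ha, hb, hab, rfl⟩ hC
  have hmem : gridVertex v + dir k * t ∈ gridCell (v + quad k) := by
    rw [mem_gridCell_add_quad_iff]; simp [h0, h1]
  have hcell := convex_gridCell _ hmem hp.2 ha.le hb.le hab
  have ha' : (a : ℂ) = 1 - b := by rw [← Complex.ofReal_one, ← hab]; push_cast; ring
  have heq : a • (gridVertex v + dir k * t) + b • (gridVertex v + dir k * u) =
      gridVertex v + dir k * (a * t + b * u) := by
    simp only [Complex.real_smul]; rw [ha']; ring
  rw [heq] at hC hcell
  have := hmin _ ⟨hC, hcell⟩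
  simp at this
  nlinarith

end IsGridExterior

/-! ### The inequality at a boundary vertex -/

lemma neg_eq_mul_exp (x : ℂ) : -x = (1 - Complex.I) / 2 *
    ((√2 * ‖x‖ : ℝ) * Complex.exp ((x.arg - 3 * Real.pi / 4 : ℝ) * Complex.I)) := by
  have h1 : Complex.exp ((x.arg - 3 * Real.pi / 4 : ℝ) * Complex.I) =
      Complex.exp (x.arg * Complex.I) * (-(√2 / 2 : ℝ) * (1 + Complex.I)) := by
    have : ((x.arg - 3 * Real.pi / 4 : ℝ) * Complex.I) =
        x.arg * Complex.I + ((Real.pi / 4 : ℝ) * Complex.I - Real.pi * Complex.I) := by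
      push_cast; ring
    rw [this, Complex.exp_add, Complex.exp_sub, Complex.exp_pi_mul_I,
      Complex.exp_mul_I (Real.pi / 4 : ℝ), ← Complex.ofReal_cos, ← Complex.ofReal_sin, Real.cos_pi_div_four, Real.sin_pi_div_four]
    push_cast; ring
  have h2 : ((√2 : ℝ) : ℂ) * (√2 : ℝ) = 2 := by
    rw [← Complex.ofReal_mul, Real.mul_self_sqrt (by norm_num)]; norm_num
  have h3 := Complex.norm_mul_exp_arg_mul_I x
  rw [h1]
  have h4 : (1 - Complex.I) / 2 * ((√2 * ‖x‖ : ℝ) * (Complex.exp (x.arg * Complex.I) *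
      (-(√2 / 2 : ℝ) * (1 + Complex.I)))) = - (((√2 : ℝ) : ℂ) * (√2 : ℝ)) *
        ((1 - Complex.I ^ 2) / 4) * (‖x‖ * Complex.exp (x.arg * Complex.I)) := by
    push_cast; ring
  rw [h4, h2, h3, Complex.I_sq]
  ring

lemma mem_openSegment_of_lt {v a b d e : ℂ} {r s : ℝ} (hr : 0 < r) (hrs : r < s)
    (ha : v - a = d * (r * e)) (hb : v - b = d * (s * e)) : a ∈ openSegment ℝ v b := by
  have hs : 0 < s := hr.trans hrs
  have hsC : (s : ℂ) ≠ 0 := by exact_mod_cast hs.ne'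
  refine ⟨1 - r / s, r / s, sub_pos.2 ((div_lt_one hs).2 hrs), by positivity, by ring, ?_⟩
  simp only [Complex.real_smul]
  push_cast
  field_simp
  linear_combination (s : ℂ) * ha - r * hb

namespace IsGridExterior

variable {C U : Set ℂ}

lemma lowPoint_in_spec (h : IsGridExterior C U) {v : ℤ × ℤ} {m : Fin 4}
    (hU : cellCenter (v + quad (m + 1)) ∈ U) (hU' : cellCenter (v + quad m) ∉ U) :
    (∃ u : ℂ, lowPoint C (v + quad m) (m + 3) = gridVertex v + dir m * u ∧ 0 < u.re ∧ 0 ≤ u.im ∧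
      gridVertex v + dir m * u ∈ C ∩ gridCell (v + quad m) ∧
      ∀ w, gridVertex v + dir m * w ∈ C ∩ gridCell (v + quad m) → u.re ≤ w.re) ∧
    Disjoint (openSegment ℝ (gridVertex v) (lowPoint C (v + quad m) (m + 3))) C := by
  set v' := v + quad m - quad (m + 3) with hv'
  have e1 : v + quad m = v' + quad (m + 3) := by rw [hv', sub_add_cancel]
  have e2 : v + quad (m + 1) = v' + quad (m + 3 + 3) := by
    rw [hv', (Fin.four_add m).2.2.2.2.2.1]
    linear_combination (exp := 1) -quad_add m
  have e3 : gridVertex v = gridVertex v' + dir (m + 3) := by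
    have := gridVertex_sub_quad_add_one (v + quad m) (m + 3)
    rwa [(Fin.four_add m).1, add_sub_cancel_right] at this
  have e4 : dir (m + 3) = -Complex.I * dir m := by
    rw [dir_add, mul_comm]; rfl
  have e5 : ∀ w, gridVertex v + dir m * w =
      gridVertex v' + dir (m + 3) * (1 + Complex.I * w) := fun w => by
    rw [e3, e4]; linear_combination (dir m * w) * Complex.I_sq
  rw [e2] at hU
  rw [e1] at hU' ⊢
  constructor
  · obtain ⟨u, h1, h2, h3, h4, h5, h6⟩ := h.lowPoint_spec hU hU'
    have e6 : gridVertex v' + dir (m + 3) * u =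
        gridVertex v + dir m * (Complex.I * (1 - u)) := by
      rw [e5, ← mul_assoc, Complex.I_mul_I]; ring
    rw [e6] at h1 h5
    refine ⟨_, h1, by simpa, by simpa using h3, h5, fun w hw => ?_⟩
    rw [e5] at hw
    simpa using h6 _ hw
  · have := h.disjoint_openSegment hU hU' zero_le_one le_rfl
    rwa [Complex.ofReal_one, mul_one, ← e3] at this

lemma crossArg_lowPoint_nonneg (h : IsGridExterior C U) {v : ℤ × ℤ} {k l : Fin 4} (hl : l ≠ 3)
    (h1 : cellCenter (v + quad (k + 3)) ∈ U) (h2 : cellCenter (v + quad k) ∉ U)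
    (h3 : cellCenter (v + quad (k + l)) ∉ U) (h4 : cellCenter (v + quad (k + l + 1)) ∈ U)
    (hne : lowPoint C (v + quad k) k ≠ lowPoint C (v + quad (k + l)) (k + l + 3))
    {q : ℂ} (hq : q ∉ C) (hqv : q ≠ gridVertex v) :
    0 ≤ crossArg C (gridVertex v) (lowPoint C (v + quad k) k)
      (lowPoint C (v + quad (k + l)) (k + l + 3)) q := by
  obtain ⟨α, ha, hα1, -, hα2, hamem, hamin⟩ := h.lowPoint_spec h1 h2
  obtain ⟨⟨β, hb, hβ1, hβ2, hbmem, hbmin⟩, hdb⟩ := h.lowPoint_in_spec h4 h3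
  have hda := h.disjoint_openSegment h1 h2 le_rfl zero_le_one
  rw [Complex.ofReal_zero, mul_zero, add_zero] at hda
  have hvC : gridVertex v ∉ C := by
    have := h.edge_notMem h1 le_rfl zero_le_one
    rwa [Complex.ofReal_zero, mul_zero, add_zero] at this
  have hpi := Real.pi_pos
  have hα0 : α ≠ 0 := fun h => by simp [h] at hα2
  have hβ0 : β ≠ 0 := fun h => by simp [h] at hβ1
  have hargα : 0 < α.arg ∧ α.arg ≤ Real.pi / 2 :=
    ⟨lt_of_le_of_ne (Complex.arg_nonneg_iff.2 hα2.le)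
      fun h => hα2.ne' (Complex.arg_eq_zero_iff.1 h.symm).2,
      (abs_le.1 (Complex.abs_arg_le_pi_div_two_iff.2 hα1)).2⟩
  have hargβ : 0 ≤ β.arg ∧ β.arg < Real.pi / 2 :=
    ⟨Complex.arg_nonneg_iff.2 hβ2,
      (abs_lt.1 (Complex.abs_arg_lt_pi_div_two_iff.2 (Or.inl hβ1))).2⟩
  set d := dir k * ((1 - Complex.I) / 2) with hd
  have hd0 : d ≠ 0 := by
    refine mul_ne_zero (dir_ne_zero k) (div_ne_zero (fun h => ?_) two_ne_zero)
    have := congrArg Complex.re h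
    simp at this
  set A := α.arg - 3 * Real.pi / 4 with hA
  have hl3 : (l : ℕ) ≤ 2 := by
    have := l.isLt
    have : (l : ℕ) ≠ 3 := fun h => hl (Fin.ext h)
    omega
  set B := β.arg - 3 * Real.pi / 4 + (l : ℕ) * (Real.pi / 2) with hB
  have hla : gridVertex v - lowPoint C (v + quad k) k =
      d * ((√2 * ‖α‖ : ℝ) * Complex.exp (A * Complex.I)) := by
    rw [ha, hd, hA, mul_assoc, ← neg_eq_mul_exp]; ring
  have hlb : gridVertex v - lowPoint C (v + quad (k + l)) (k + l + 3) =
      d * ((√2 * ‖β‖ : ℝ) * Complex.exp (B * Complex.I)) := by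
    have hdl : Complex.exp (((l : ℕ) * (Real.pi / 2) : ℝ) * Complex.I) = dir l := by
      have : (((l : ℕ) * (Real.pi / 2) : ℝ) * Complex.I) =
          (l : ℕ) * ((Real.pi / 2 : ℝ) * Complex.I) := by push_cast; ring
      rw [this, Complex.exp_nat_mul, Complex.exp_mul_I, ← Complex.ofReal_cos,
        ← Complex.ofReal_sin, Real.cos_pi_div_two, Real.sin_pi_div_two]
      fin_cases l <;> simp [dir]
    have hexp : Complex.exp (B * Complex.I) = dir l *
        Complex.exp ((β.arg - 3 * Real.pi / 4 : ℝ) * Complex.I) := by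
      rw [hB, Complex.ofReal_add, add_mul, Complex.exp_add, hdl, mul_comm]
    have := neg_eq_mul_exp β
    rw [hb, hd, hexp, dir_add]
    linear_combination (dir k * dir l) * this
  have hra : 0 < √2 * ‖α‖ := mul_pos (by positivity) (norm_pos_iff.2 hα0)
  have hrb : 0 < √2 * ‖β‖ := mul_pos (by positivity) (norm_pos_iff.2 hβ0)
  have hle : A ≤ B := by
    rcases Nat.eq_zero_or_pos (l : ℕ) with hl0 | hl0
    · have hl0' : l = 0 := Fin.ext hl0
      subst hl0'
      rw [add_zero] at hbmem hbmin
      have i1 := hamin β hbmem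
      have i2 := hbmin α hamem
      have hα1' := hβ1.trans_le i2
      have : 0 ≤ (β / α).arg := by
        rw [Complex.arg_nonneg_iff, Complex.div_im, ← sub_div]
        refine div_nonneg ?_ (Complex.normSq_nonneg _)
        nlinarith
      rw [Complex.arg_div_eq_of_re_pos hβ1 hα1'] at this
      simp only [hA, hB, hl0]
      push_cast
      linarith
    · have : (1 : ℝ) ≤ (l : ℕ) := by exact_mod_cast hl0
      rw [hA, hB]
      nlinarith
  have hlt : A < B := by
    refine lt_of_le_of_ne hle fun hAB => ?_
    rw [← hAB] at hlb
    rcases lt_trichotomy (√2 * ‖α‖) (√2 * ‖β‖) with hr | hr | hr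
    · exact Set.disjoint_left.1 hdb (mem_openSegment_of_lt hra hr hla hlb) (ha ▸ hamem.1)
    · rw [hr, ← hlb] at hla
      exact hne (sub_right_injective hla)
    · exact Set.disjoint_left.1 hda (mem_openSegment_of_lt hrb hr hlb hla) (hb ▸ hbmem.1)
  have hB1 : B < Real.pi := by
    have : ((l : ℕ) : ℝ) ≤ 2 := by exact_mod_cast hl3
    rw [hB]; nlinarith
  have hvk : ∀ m, gridVertex v ∈ gridCell (v + quad m) := fun m => by
    have := (mem_gridCell_add_quad_iff (v := v) (k := m) (u := 0)).2 (by simp)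
    simpa using this
  have hUa : Disjoint U (segment ℝ (gridVertex v) (lowPoint C (v + quad k) k)) :=
    (h.disjoint_of_meets ⟨_, hamem⟩).mono_right
      ((convex_gridCell _).segment_subset (hvk k) (ha ▸ hamem.2))
  have hUb : Disjoint U (segment ℝ (gridVertex v) (lowPoint C (v + quad (k + l)) (k + l + 3))) :=
    (h.disjoint_of_meets ⟨_, hbmem⟩).mono_right
      ((convex_gridCell _).segment_subset (hvk (k + l)) (hb ▸ hbmem.2))
  exact crossArg_nonneg h.isCompact h.isPreconnected h.isConnected_compl (ha ▸ hamem.1)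
    (hb ▸ hbmem.1) hvC hda hdb h.isPreconnected_exterior h.not_isBounded h.disjoint hUa hUb hd0
    (fun t ht0 ht1 => h.ray_mem h1 ht0 ht1) hra hrb hla hlb (by linarith) hlt hB1 hq hqv

end IsGridExterior

/-! ### Comparison of the displacement with the variation over the continuum -/

lemma Complex.ne_zero_of_div_re_pos {x H : ℂ} (h : 0 < (x / H).re) : x ≠ 0 ∧ H ≠ 0 := by
  constructor <;> rintro rfl <;> simp at h

lemma Complex.arg_div_eq_of_div_re_pos {x y H : ℂ} (hx : 0 < (x / H).re) (hy : 0 < (y / H).re) :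
    (x / y).arg = (x / H).arg - (y / H).arg := by
  rw [← Complex.arg_div_eq_of_re_pos hx hy,
    div_div_div_cancel_right₀ (Complex.ne_zero_of_div_re_pos hx).2]

/-- The correction comparing the displacement of `v` with the motion of `f v` relative to `C`. -/
noncomputable def relArg (C : Set ℂ) (f : ℂ → ℂ) (v p : ℂ) : ℝ :=
  ((f v - v) / (f v - p)).arg - (logVar C (f v) p (f 0)).im

lemma arg_displacement_eq {C : Set ℂ} (hC : IsCompact C) (hCc : IsPreconnected C)
    (hconn : IsConnected Cᶜ) (h0 : 0 ∈ C) {f L : ℂ → ℂ} (hf : Continuous f) (hf0 : f 0 ∈ C)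
    (hfC : ∀ x ∉ C, f x ∉ C) (hL : ContinuousOn L {0}ᶜ)
    (hexp : ∀ x ≠ 0, f x - f 0 = x * Complex.exp (L x)) {v w p H : ℂ}
    (hseg : Disjoint (segment ℝ v w) C) (hp : p ∈ C)
    (hpos : ∀ x ∈ segment ℝ v w, 0 < ((f x - p) / H).re)
    (hv : 0 < ((f v - v) / H).re) (hw : 0 < ((f w - w) / H).re) :
    ((f w - w) / (f v - v)).arg =
      (L w - L v).im + (w / v).arg + (relArg C f w p - relArg C f v p) := by
  have hsC : ∀ x ∈ segment ℝ v w, x ∉ C := fun x hx => Set.disjoint_left.1 hseg hx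
  have hs0 : ∀ x ∈ segment ℝ v w, x ≠ 0 := fun x hx h => hsC x hx (h ▸ h0)
  have hvs := left_mem_segment ℝ v w
  have hws := right_mem_segment ℝ v w
  have hv0 := hs0 v hvs
  have hH := (Complex.ne_zero_of_div_re_pos hv).2
  have hslit : ∀ x ∈ segment ℝ v w, x / v ∈ Complex.slitPlane := by
    intro x hx
    by_contra hcon
    have : (0 : ℂ) ∈ openSegment ℝ x v := by
      refine mem_segment_of_div_notMem_slitPlane hv0.symm (hs0 x hx).symm ?_
      simpa using hcon
    exact hs0 0 ((convex_segment v w).segment_subset hx hvs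
      (openSegment_subset_segment ℝ _ _ this)) rfl
  set G : ℂ → ℂ := fun x => L x + Complex.log (x / v) - Complex.log ((f x - p) / H) -
    logVar C (f x) p (f 0) with hG
  have hGc : ContinuousOn G (segment ℝ v w) := by
    refine ((hL.mono fun x hx => hs0 x hx).add ?_ |>.sub ?_).sub ?_
    · exact ContinuousOn.clog (by fun_prop) hslit
    · exact ContinuousOn.clog (by fun_prop) fun x hx => Or.inl (hpos x hx)
    · intro x hx
      exact ((continuousAt_logVar hC hCc hconn (hfC x (hsC x hx)) hp hf0).comp
        hf.continuousAt).continuousWithinAt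
  have hGexp : ∀ x ∈ segment ℝ v w, Complex.exp (G x) = H / v := by
    intro x hx
    have h1 := (Complex.ne_zero_of_div_re_pos (hpos x hx)).1
    have h2 : f x - f 0 ≠ 0 := sub_ne_zero_of_notMem (hfC x (hsC x hx)) hf0
    have h3 := hexp x (hs0 x hx)
    simp only [hG]
    rw [Complex.exp_sub, Complex.exp_sub, Complex.exp_add,
      exp_logVar hC hCc hconn (hfC x (hsC x hx)) hp hf0,
      Complex.exp_log (div_ne_zero (hs0 x hx) hv0), Complex.exp_log (div_ne_zero h1 hH)]
    field_simp
    rw [h3]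
    ring
  have hGeq := congrArg Complex.im (eq_of_continuousOn_exp_eq (convex_segment v w).isPreconnected
    hGc (fun x hx y hy => (hGexp x hx).trans (hGexp y hy).symm) hvs hws)
  simp only [hG, Complex.sub_im, Complex.add_im, Complex.log_im, div_self hv0, Complex.arg_one]
    at hGeq
  rw [relArg, relArg, Complex.arg_div_eq_of_div_re_pos hw hv,
    Complex.arg_div_eq_of_div_re_pos hw (hpos w hws),
    Complex.arg_div_eq_of_div_re_pos hv (hpos v hvs), Complex.sub_im]
  linarith

lemma relArg_sub_relArg {C : Set ℂ} (hC : IsCompact C) (hCc : IsPreconnected C)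
    (hconn : IsConnected Cᶜ) {f : ℂ → ℂ} (hf0 : f 0 ∈ C) {v a b H : ℂ}
    (hv : f v ∉ C) (ha : a ∈ C) (hb : b ∈ C)
    (hvb : 0 < ((f v - b) / H).re) (hvv : 0 < ((f v - v) / H).re) :
    relArg C f v b - relArg C f v a = crossArg C v a b (f v) := by
  have h := congrArg Complex.im (logVar_add hC hCc hconn hv ha hb hf0)
  rw [Complex.add_im] at h
  rw [relArg, relArg, crossArg, Complex.arg_div_eq_of_div_re_pos hvv hvb,
    Complex.arg_div_eq_of_div_re_pos hvb hvv]
  linarith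

/-! ### Sums over the boundary of a cell -/

lemma Fin.sum_four_telescope (g : Fin 4 → ℝ) : ∑ k : Fin 4, (g (k + 1) - g k) = 0 := by
  rw [Finset.sum_sub_distrib, sub_eq_zero]
  exact Equiv.sum_comp (Equiv.addRight (1 : Fin 4)) g

lemma nbr_sub_quad (c : ℤ × ℤ) (k : Fin 4) : nbr c k - quad (k + 2) = c - quad (k + 1) ∧
    nbr c k - quad (k + 2 + 1) = c - quad k := by
  have := quad_add k
  constructor
  · rw [nbr]; linear_combination (exp := 1) -this
  · rw [nbr, (Fin.four_add k).2.2.2.1]; abel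

lemma gridVertex_div_re_pos {c : ℤ × ℤ} (hc : c ≠ 0) :
    ∃ H : ℂ, ∀ x ∈ gridCell c, 0 < (x / H).re := by
  obtain ⟨m, n⟩ := c
  have key : ∀ {i : ℤ} {r : ℝ}, |r - i| ≤ 1 / 2 → (0 < i → 0 < r) ∧ (i < 0 → r < 0) := by
    intro i r hr
    rw [abs_le] at hr
    constructor <;> intro hi
    · have : (1 : ℝ) ≤ i := by exact_mod_cast hi
      linarith
    · have : (i : ℝ) ≤ -1 := by exact_mod_cast (by omega : i ≤ -1)
      linarith
  rcases lt_trichotomy m 0 with hm | hm | hm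
  · exact ⟨-1, fun x hx => by simpa [Complex.div_re] using (key hx.1).2 hm⟩
  · rcases lt_trichotomy n 0 with hn | hn | hn
    · exact ⟨-Complex.I, fun x hx => by simpa [Complex.div_re] using (key hx.2).2 hn⟩
    · exact absurd (Prod.ext hm hn) hc
    · exact ⟨Complex.I, fun x hx => by simpa [Complex.div_re] using (key hx.2).1 hn⟩
  · exact ⟨1, fun x hx => by simpa using (key hx.1).1 hm⟩

lemma gridVertex_zero_sub_quad (k : Fin 4) :
    gridVertex (0 - quad (k + 1)) / gridVertex (0 - quad k) = Complex.I := by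
  have h : ∀ k, gridVertex (0 - quad k) ≠ 0 := by
    intro k h
    have := congrArg Complex.re h
    revert this
    fin_cases k <;> norm_num [gridVertex, quad]
  rw [div_eq_iff (h k), gridVertex_sub_quad_add_one]
  fin_cases k <;> apply Complex.ext <;> norm_num [gridVertex, quad, dir]

/-- The lifted rotation of an edge of the grid about the origin. -/
noncomputable def edgeTurn (L : ℂ → ℂ) (c : ℤ × ℤ) (k : Fin 4) : ℝ :=
  (L (gridVertex (c - quad (k + 1))) - L (gridVertex (c - quad k))).im +
    (gridVertex (c - quad (k + 1)) / gridVertex (c - quad k)).arg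

/-- The rotation of the displacement of `f` along an edge of the grid. -/
noncomputable def edgeDisplacementTurn (f : ℂ → ℂ) (c : ℤ × ℤ) (k : Fin 4) : ℝ :=
  ((f (gridVertex (c - quad (k + 1))) - gridVertex (c - quad (k + 1))) /
    (f (gridVertex (c - quad k)) - gridVertex (c - quad k))).arg

lemma sum_edgeTurn (L : ℂ → ℂ) (c : ℤ × ℤ) :
    ∑ k, edgeTurn L c k = if c = 0 then 2 * Real.pi else 0 := by
  simp only [edgeTurn, Finset.sum_add_distrib, Complex.sub_im]
  rw [Fin.sum_four_telescope fun k => (L (gridVertex (c - quad k))).im, zero_add]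
  split_ifs with hc
  · subst hc
    simp only [gridVertex_zero_sub_quad, Complex.arg_I, Finset.sum_const, Finset.card_univ,
      Fintype.card_fin, nsmul_eq_mul]
    push_cast; ring
  · obtain ⟨H, hH⟩ := gridVertex_div_re_pos hc
    rw [← Fin.sum_four_telescope fun k => (gridVertex (c - quad k) / H).arg]
    exact Finset.sum_congr rfl fun k _ => Complex.arg_div_eq_of_div_re_pos
      (hH _ (gridVertex_sub_quad_mem c _)) (hH _ (gridVertex_sub_quad_mem c _))

lemma edgeTurn_add_nbr (L : ℂ → ℂ) (c : ℤ × ℤ) (k : Fin 4) :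
    edgeTurn L c k + edgeTurn L (nbr c k) (k + 2) = 0 := by
  rw [edgeTurn, edgeTurn, (nbr_sub_quad c k).1, (nbr_sub_quad c k).2]
  have hne : (gridVertex (c - quad (k + 1)) / gridVertex (c - quad k)).arg ≠ Real.pi := by
    by_cases hc : c = 0
    · rw [hc, gridVertex_zero_sub_quad, Complex.arg_I]
      linarith [Real.pi_pos]
    · obtain ⟨H, hH⟩ := gridVertex_div_re_pos hc
      have h1 := hH _ (gridVertex_sub_quad_mem c (k + 1))
      have h2 := hH _ (gridVertex_sub_quad_mem c k)
      have h3 := abs_lt.1 (Complex.abs_arg_lt_pi_div_two_iff.2 (Or.inl h1))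
      have h4 := abs_lt.1 (Complex.abs_arg_lt_pi_div_two_iff.2 (Or.inl h2))
      rw [Complex.arg_div_eq_of_div_re_pos h1 h2]
      linarith
  have := Complex.arg_inv (gridVertex (c - quad (k + 1)) / gridVertex (c - quad k))
  rw [if_neg hne, inv_div] at this
  rw [this, Complex.sub_im, Complex.sub_im]
  ring

/-- There is no map without fixed points near `C` compatible with a grid exterior of `C`. -/
theorem IsGridExterior.false_of_displacement {C U : Set ℂ} (h : IsGridExterior C U)
    (hfin : {c | cellCenter c ∉ U}.Finite) (h0 : 0 ∈ C) {f L : ℂ → ℂ} (hf : Continuous f)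
    (hf0 : f 0 ∈ C) (hfC : ∀ x ∉ C, f x ∉ C) (hL : ContinuousOn L {0}ᶜ)
    (hexp : ∀ x ≠ 0, f x - f 0 = x * Complex.exp (L x))
    (hdis : ∀ c, cellCenter c ∉ U →
      ∃ H : ℂ, ∀ x ∈ gridCell c, ∀ y ∈ gridCell c, 0 < ((f x - y) / H).re) : False := by
  have hC := h.isCompact
  have hCc := h.isPreconnected
  have hconn := h.isConnected_compl
  set N := hfin.toFinset with hN
  have hmem : ∀ c, c ∈ N ↔ cellCenter c ∉ U := fun c => by simp [hN]
  have hmem' : ∀ c, c ∉ N ↔ cellCenter c ∈ U := fun c => by simp [hN]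
  have hv := gridVertex_sub_quad_mem
  have hN0 : (0 : ℤ × ℤ) ∈ N := by
    have : cellCenter 0 = 0 := by apply Complex.ext <;> simp [cellCenter]
    rw [hmem, this]
    exact fun h' => Set.disjoint_left.1 h.disjoint h' h0
  have hsum1 : ∑ c ∈ N, ∑ k, edgeDisplacementTurn f c k = 0 := by
    refine Finset.sum_eq_zero fun c hc => ?_
    obtain ⟨H, hH⟩ := hdis c ((hmem c).1 hc)
    rw [← Fin.sum_four_telescope fun k =>
      ((f (gridVertex (c - quad k)) - gridVertex (c - quad k)) / H).arg]
    exact Finset.sum_congr rfl fun k _ => Complex.arg_div_eq_of_div_re_pos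
      (hH _ (hv c _) _ (hv c _)) (hH _ (hv c _) _ (hv c _))
  have hsum2 : ∑ c ∈ N, ∑ k, edgeTurn L c k = 2 * Real.pi := by
    simp only [sum_edgeTurn, Finset.sum_ite_eq', hN0, if_true]
  rw [← sum_boundary_eq (fun c hc k _ => ?_)] at hsum1
  swap
  · obtain ⟨H, hH⟩ := hdis c ((hmem c).1 hc)
    have h1 := hH _ (hv c (k + 1)) _ (hv c (k + 1))
    have h2 := hH _ (hv c k) _ (hv c k)
    rw [edgeDisplacementTurn, edgeDisplacementTurn, (nbr_sub_quad c k).1, (nbr_sub_quad c k).2,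
      Complex.arg_div_eq_of_div_re_pos h1 h2, Complex.arg_div_eq_of_div_re_pos h2 h1]
    ring
  rw [← sum_boundary_eq (fun c _ k _ => edgeTurn_add_nbr L c k)] at hsum2
  have hpos := sum_boundary_nonneg (N := N)
    (S := fun c k => relArg C f (gridVertex (c - quad k)) (lowPoint C c k))
    (T := fun c k => relArg C f (gridVertex (c - quad (k + 1))) (lowPoint C c k)) ?_
  · have hsplit : ∑ c ∈ N, ∑ k, (if nbr c k ∉ N then edgeDisplacementTurn f c k else 0) =
        ∑ c ∈ N, ∑ k, (if nbr c k ∉ N then edgeTurn L c k else 0) +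
        ∑ c ∈ N, ∑ k, (if nbr c k ∉ N then
          relArg C f (gridVertex (c - quad (k + 1))) (lowPoint C c k) -
            relArg C f (gridVertex (c - quad k)) (lowPoint C c k) else 0) := by
      simp only [← Finset.sum_add_distrib]
      refine Finset.sum_congr rfl fun c hc => Finset.sum_congr rfl fun k _ => ?_
      by_cases hck : nbr c k ∈ N
      · simp [hck]
      · simp only [hck, not_false_eq_true, if_true]
        obtain ⟨v, rfl⟩ : ∃ v, c = v + quad k := ⟨c - quad k, by rw [sub_add_cancel]⟩
        rw [nbr, add_sub_cancel_right, hmem'] at hck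
        have hc' := (hmem _).1 hc
        obtain ⟨H, hH⟩ := hdis _ hc'
        obtain ⟨u, hu, -, -, -, hpC, -⟩ := h.lowPoint_spec hck hc'
        rw [← hu] at hpC
        have hsub := (convex_gridCell (v + quad k)).segment_subset (hv (v + quad k) k)
          (hv (v + quad k) (k + 1))
        refine arg_displacement_eq hC hCc hconn h0 hf hf0 hfC hL hexp ?_ hpC.1
          (fun x hx => hH x (hsub hx) _ hpC.2) (hH _ (hv _ _) _ (hv _ _))
          (hH _ (hv _ _) _ (hv _ _))
        rw [gridVertex_sub_quad_add_one, add_sub_cancel_right, Set.disjoint_left]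
        rintro _ ⟨a, b, ha, hb, hab, rfl⟩
        have ha' : (a : ℂ) = 1 - b := by rw [← Complex.ofReal_one, ← hab]; push_cast; ring
        have heq : a • gridVertex v + b • (gridVertex v + dir k) = gridVertex v + dir k * b := by
          simp only [Complex.real_smul]; rw [ha']; ring
        rw [heq]
        exact h.edge_notMem hck hb (by linarith)
    have := Real.pi_pos
    linarith
  · intro v k l hl h1 h2 h3 h4
    rw [hmem'] at h1 h4
    rw [hmem] at h2 h3
    simp only [add_sub_cancel_right, (Fin.four_add (k + l)).1]
    obtain ⟨H, hH⟩ := hdis _ h3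
    obtain ⟨u, hu, -, -, -, ha, -⟩ := h.lowPoint_spec h1 h2
    obtain ⟨⟨u', hu', -, -, hb, -⟩, -⟩ := h.lowPoint_in_spec h4 h3
    rw [← hu] at ha
    rw [← hu'] at hb
    have hvb : gridVertex v ∈ gridCell (v + quad (k + l)) := by
      simpa using hv (v + quad (k + l)) (k + l)
    have hvC : gridVertex v ∉ C := by
      simpa using h.edge_notMem h1 le_rfl zero_le_one
    by_cases hne : lowPoint C (v + quad k) k = lowPoint C (v + quad (k + l)) (k + l + 3)
    · rw [hne]
    · rw [← sub_nonneg, relArg_sub_relArg hC hCc hconn hf0 (hfC _ hvC) ha.1 hb.1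
        (hH _ hvb _ hb.2) (hH _ hvb _ hvb)]
      exact h.crossArg_lowPoint_nonneg hl h1 h2 h3 h4 hne (hfC _ hvC)
        (sub_ne_zero.1 (Complex.ne_zero_of_div_re_pos (hH _ hvb _ hvb)).1)

/-! ### Logarithm of the difference quotient of an isotopy -/

lemma exists_log_of_isotopy {F : ℝ → ℂ → ℂ} (hF : Continuous fun q : ℝ × ℂ => F q.1 q.2)
    (hinj : ∀ t, Function.Injective (F t)) (hF0 : F 0 = id) :
    ∃ L : ℂ → ℂ, ContinuousOn L {0}ᶜ ∧
      ∀ x ≠ 0, F 1 x - F 1 0 = x * Complex.exp (L x) := by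
  have hne : ∀ t : ℝ, ∀ x : {x : ℂ // x ≠ 0}, (F t x - F t 0) / x ≠ 0 := fun t x =>
    div_ne_zero (sub_ne_zero.2 fun h => x.2 (hinj t h)) x.2
  let H : C(unitInterval × {x : ℂ // x ≠ 0}, {z : ℂ // z ≠ 0}) :=
    ⟨fun q => ⟨(F q.1 q.2 - F q.1 0) / q.2, hne _ _⟩, by
      refine Continuous.subtype_mk (Continuous.div ?_ (by fun_prop) fun q => q.2.2) _
      exact (hF.comp (f := fun q : unitInterval × {x : ℂ // x ≠ 0} => ((q.1 : ℝ), (q.2 : ℂ)))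
        (by fun_prop)).sub
        (hF.comp (f := fun q : unitInterval × {x : ℂ // x ≠ 0} => ((q.1 : ℝ), (0 : ℂ)))
        (by fun_prop))⟩
  have hH0 : ∀ a, H (0, a) = (fun z => (⟨Complex.exp z, Complex.exp_ne_zero z⟩ : {z : ℂ // z ≠ 0}))
      ((ContinuousMap.const {x : ℂ // x ≠ 0} (0 : ℂ)) a) := by
    intro a
    apply Subtype.ext
    simp [H, hF0, a.2]
  obtain ⟨G, hG⟩ : ∃ G : C(unitInterval × {x : ℂ // x ≠ 0}, ℂ), ∀ q, Complex.exp (G q) = H q :=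
    ⟨Complex.isCoveringMap_exp.liftHomotopy H (ContinuousMap.const _ 0) hH0, fun q =>
      congrArg Subtype.val (congrFun
        (Complex.isCoveringMap_exp.liftHomotopy_lifts H (ContinuousMap.const _ 0) hH0) q)⟩
  refine ⟨fun x => if h : x ≠ 0 then G (1, ⟨x, h⟩) else 0, ?_, ?_⟩
  · rw [continuousOn_iff_continuous_domRestrict]
    have hc : Continuous fun x : ({0}ᶜ : Set ℂ) =>
        ((1 : unitInterval), (⟨x.1, x.2⟩ : {x : ℂ // x ≠ 0})) := by fun_prop
    refine (G.continuous.comp hc).congr fun x => ?_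
    have hx : x.1 ≠ 0 := x.2
    simp [Set.domRestrict, hx]
  · intro x hx
    simp only [hx, ne_eq, not_false_eq_true, dif_pos]
    rw [hG (1, ⟨x, hx⟩)]
    simp only [H, ContinuousMap.coe_mk, Set.Icc.coe_one]
    field_simp

/-! ### A connected unbounded set staying away from a nonseparating compact set -/

lemma isPreconnected_norm_gt (R : ℝ) : IsPreconnected {x : ℂ | R < ‖x‖} := by
  have h := ((isPreconnected_Ioi (a := R)).prod (isPreconnected_univ (α := ℝ))).image
    (fun q : ℝ × ℝ => (q.1 : ℂ) * Complex.exp (q.2 * Complex.I)) (by fun_prop)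
  convert h
  ext x
  constructor
  · exact fun hx => ⟨(‖x‖, x.arg), ⟨hx, trivial⟩, Complex.norm_mul_exp_arg_mul_I x⟩
  · rintro ⟨⟨r, θ⟩, ⟨hr, -⟩, rfl⟩
    have hr' : R < r := hr
    simp only [Set.mem_ofPred_eq, norm_mul, Complex.norm_real, Complex.norm_exp_ofReal_mul_I,
      mul_one, Real.norm_eq_abs]
    exact hr'.trans_le (le_abs_self r)

lemma IsCompact.exists_compact_preconnected_superset {O K : Set ℂ} (hO : IsOpen O)
    (hOc : IsConnected O) (hK : IsCompact K) (hKO : K ⊆ O) {q : ℂ} (hq : q ∈ O) :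
    ∃ K', IsCompact K' ∧ IsPreconnected K' ∧ q ∈ K' ∧ K ⊆ K' ∧ K' ⊆ O := by
  have hpath := (hO.isConnected_iff_isPathConnected).1 hOc
  refine hK.induction_on (p := fun K => ∃ K', IsCompact K' ∧ IsPreconnected K' ∧ q ∈ K' ∧
    K ⊆ K' ∧ K' ⊆ O) ?_ ?_ ?_ ?_
  · exact ⟨{q}, isCompact_singleton, isPreconnected_singleton, rfl, by simp, by simpa⟩
  · rintro s t hst ⟨K', h1, h2, h3, h4, h5⟩
    exact ⟨K', h1, h2, h3, hst.trans h4, h5⟩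
  · rintro s t ⟨K', h1, h2, h3, h4, h5⟩ ⟨K'', h1', h2', h3', h4', h5'⟩
    exact ⟨K' ∪ K'', h1.union h1', h2.union q h3 h3' h2', Or.inl h3,
      Set.union_subset_union h4 h4', Set.union_subset h5 h5'⟩
  · intro x hx
    obtain ⟨r, hr, hrO⟩ := Metric.nhds_basis_closedBall.mem_iff.1 (hO.mem_nhds (hKO hx))
    obtain ⟨γ, hγ⟩ := hpath.joinedIn q hq x (hKO hx)
    refine ⟨Metric.closedBall x r, mem_nhdsWithin_of_mem_nhds (Metric.closedBall_mem_nhds x hr),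
      Set.range γ ∪ Metric.closedBall x r, (isCompact_range γ.continuous).union
        (isCompact_closedBall x r), ?_, Or.inl ⟨0, γ.source⟩, Set.subset_union_right,
      Set.union_subset (Set.range_subset_iff.2 hγ) hrO⟩
    exact (isPreconnected_range γ.continuous).union x ⟨1, γ.target⟩
      (Metric.mem_closedBall_self hr.le) (convex_closedBall x r).isPreconnected

lemma exists_unbounded_preconnected_away {C : Set ℂ} (hC : IsCompact C) (hconn : IsConnected Cᶜ)
    {δ : ℝ} (hδ : 0 < δ) : ∃ s, 0 < s ∧ s < δ ∧ ∃ W : Set ℂ, IsPreconnected W ∧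
      ¬ Bornology.IsBounded W ∧ (∀ x ∈ W, ∀ y ∈ C, 2 * s < dist x y) ∧
      ∀ x, (∀ y ∈ C, δ ≤ dist x y) → x ∈ W := by
  obtain ⟨M, hM⟩ := hC.isBounded.exists_norm_le
  set R := max M 0 + 1 with hR
  have hRM : ∀ x : ℂ, R < ‖x‖ → ∀ y ∈ C, 1 < dist x y := by
    intro x hx y hy
    have h1 := norm_sub_norm_le x y
    have h2 := hM y hy
    have h3 := le_max_left M 0
    rw [dist_eq_norm]
    linarith
  have hqn : R < ‖((R + 1 : ℝ) : ℂ)‖ := by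
    rw [Complex.norm_real, Real.norm_eq_abs]
    exact lt_of_lt_of_le (by linarith) (le_abs_self _)
  have hfar : ∀ x : ℂ, R < ‖x‖ → x ∈ Cᶜ := fun x hx hxC => by
    have := hRM x hx x hxC
    rw [dist_self] at this
    linarith
  have hK : IsCompact (Metric.closedBall (0 : ℂ) R ∩ ⋂ y ∈ C, {x | δ ≤ dist x y}) :=
    (isCompact_closedBall 0 R).inter_right (isClosed_biInter fun y _ =>
      isClosed_le continuous_const (by fun_prop))
  have hKC : Metric.closedBall (0 : ℂ) R ∩ ⋂ y ∈ C, {x | δ ≤ dist x y} ⊆ Cᶜ := by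
    rintro x ⟨-, hx⟩ hxC
    have : δ ≤ dist x x := Set.mem_iInter₂.1 hx x hxC
    rw [dist_self] at this
    linarith
  obtain ⟨K', h1, h2, h3, h4, h5⟩ := hK.exists_compact_preconnected_superset
    hC.isClosed.isOpen_compl hconn hKC (hfar _ hqn)
  obtain ⟨r, hr, hrK⟩ := Metric.exists_pos_forall_lt_edist h1 hC.isClosed
    (Set.disjoint_left.2 fun x hx => h5 hx)
  have hr' : (0 : ℝ) < r := hr
  set s := min (min (δ / 2) (r / 2)) (1 / 2) with hs
  have hsδ : s ≤ δ / 2 := (min_le_left _ _).trans (min_le_left _ _)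
  have hsr : s ≤ r / 2 := (min_le_left _ _).trans (min_le_right _ _)
  have hs1 : s ≤ 1 / 2 := min_le_right _ _
  refine ⟨s, by positivity, by linarith, K' ∪ {x | R < ‖x‖},
    h2.union _ h3 hqn (isPreconnected_norm_gt R), ?_, ?_, ?_⟩
  · intro hb
    obtain ⟨B, hB⟩ := (hb.subset Set.subset_union_right).exists_norm_le
    have hlt : R < ‖((max R B + 1 : ℝ) : ℂ)‖ := by
      rw [Complex.norm_real, Real.norm_eq_abs]
      exact lt_of_lt_of_le (by linarith [le_max_left R B]) (le_abs_self _)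
    have := hB _ hlt
    rw [Complex.norm_real, Real.norm_eq_abs] at this
    linarith [le_abs_self (max R B + 1), le_max_right R B]
  · rintro x (hx | hx) y hy
    · have := hrK x hx y hy
      rw [edist_dist, ENNReal.lt_ofReal_iff_toReal_lt ENNReal.coe_ne_top,
        ENNReal.coe_toReal] at this
      linarith
    · linarith [hRM x hx y hy]
  · intro x hx
    by_cases hxR : R < ‖x‖
    · exact Or.inr hxR
    · exact Or.inl (h4 ⟨by simpa using hxR, Set.mem_iInter₂.2 hx⟩)

/-! ### The fixed point theorem in the complex plane -/

lemma false_of_far_unbounded_preconnected {C W : Set ℂ} (hC : IsCompact C) (hCc : IsPreconnected C)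
    (hCo : IsConnected Cᶜ) (h0 : 0 ∈ C) (hW : IsPreconnected W) (hWb : ¬ Bornology.IsBounded W)
    (hWC : ∀ x ∈ W, ∀ y ∈ C, 2 < dist x y) {D ε : ℝ} (hD : ∀ x, (∀ y ∈ C, D ≤ dist x y) → x ∈ W)
    {F : ℝ → ℂ → ℂ} (hF : Continuous fun q : ℝ × ℂ => F q.1 q.2)
    (hinj : ∀ t, Function.Injective (F t)) (hF0 : F 0 = id) (hinv : F 1 '' C = C)
    (hε : ∀ z ∈ C, ε ≤ dist (F 1 z) z)
    (hunif : ∀ z ∈ C, ∀ x, dist x z < D + 2 → dist (F 1 x) (F 1 z) < ε / 4)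
    (hDε : D + 2 ≤ ε / 4) : False := by
  set O : Set ℂ := {x | ∀ c, x ∈ gridCell c → Disjoint (gridCell c) C} with hO
  have hWO : W ⊆ O := fun x hx c hxc => Set.disjoint_left.2 fun y hyc hyC =>
    ((hWC x hx y hyC).trans (dist_le_of_mem_gridCell hxc hyc)).false
  obtain ⟨q, hq⟩ : W.Nonempty := by
    by_contra h
    rw [Set.not_nonempty_iff_eq_empty] at h
    exact hWb (h ▸ Bornology.isBounded_empty)
  set U := connectedComponentIn O q with hU
  have hWU : W ⊆ U := hW.subset_connectedComponentIn hq hWO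
  have hUO : U ⊆ O := connectedComponentIn_subset O q
  have hext : IsGridExterior C U :=
    { isCompact := hC
      isPreconnected := hCc
      isConnected_compl := hCo
      isPreconnected_exterior := isPreconnected_connectedComponentIn
      not_isBounded := fun h => hWb (h.subset hWU)
      disjoint_gridCell := fun x hx => hUO hx
      maximal := by
        rintro K hK hKO ⟨p, hpK, hpU⟩
        rw [hU, connectedComponentIn_eq hpU]
        exact hK.subset_connectedComponentIn hpK hKO }
  have hnear : ∀ c, cellCenter c ∉ U → ∃ z ∈ C, dist (cellCenter c) z < D := by
    intro c hc
    by_contra! h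
    exact hc (hWU (hD _ h))
  have hf : Continuous (F 1) := hF.comp (f := fun x : ℂ => ((1 : ℝ), x)) (by fun_prop)
  obtain ⟨L, hL, hexp⟩ := exists_log_of_isotopy hF hinj hF0
  refine hext.false_of_displacement ?_ h0 hf (hinv ▸ Set.mem_image_of_mem _ h0) ?_ hL hexp ?_
  · obtain ⟨R, hR⟩ := hC.isBounded.exists_norm_le
    refine (Set.finite_Icc ((-⌈D + R⌉, -⌈D + R⌉) : ℤ × ℤ) (⌈D + R⌉, ⌈D + R⌉)).subset fun c hc => ?_
    obtain ⟨z, hz, hcz⟩ := hnear c hc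
    have hn : ‖cellCenter c‖ ≤ D + R := by
      have := norm_sub_norm_le (cellCenter c) z
      rw [← dist_eq_norm] at this
      linarith [hR z hz]
    have h1 := abs_le.1 ((Complex.abs_re_le_norm (cellCenter c)).trans (hn.trans (Int.le_ceil _)))
    have h2 := abs_le.1 ((Complex.abs_im_le_norm (cellCenter c)).trans (hn.trans (Int.le_ceil _)))
    simp only [cellCenter] at h1 h2
    refine ⟨⟨?_, ?_⟩, ⟨?_, ?_⟩⟩
    · exact_mod_cast h1.1
    · exact_mod_cast h2.1
    · exact_mod_cast h1.2
    · exact_mod_cast h2.2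
  · intro x hx hfx
    rw [← hinv] at hfx
    obtain ⟨y, hy, hyx⟩ := hfx
    exact hx (hinj 1 hyx ▸ hy)
  · intro c hc
    obtain ⟨z, hz, hcz⟩ := hnear c hc
    have hclose : ∀ x ∈ gridCell c, dist x z < D + 2 := fun x hx =>
      (dist_triangle _ (cellCenter c) _).trans_lt (by
        linarith [dist_le_of_mem_gridCell hx (cellCenter_mem c)])
    refine ⟨F 1 z - z, fun x hx y hy => ?_⟩
    have hεz := hε z hz
    have h1 := hunif z hz x (hclose x hx)
    have h2 := hclose y hy
    rw [dist_eq_norm] at hεz h1 h2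
    set H := F 1 z - z with hH
    have hHpos : 0 < ‖H‖ := by linarith [norm_nonneg (F 1 x - F 1 z)]
    have hH0 : H ≠ 0 := norm_pos_iff.1 hHpos
    have hlt : ‖(F 1 x - F 1 z - (y - z)) / H‖ < 1 := by
      rw [norm_div, div_lt_one hHpos]
      linarith [norm_sub_le (F 1 x - F 1 z) (y - z)]
    have heq : (F 1 x - y) / H = 1 + (F 1 x - F 1 z - (y - z)) / H := by
      field_simp
      rw [hH]
      ring
    rw [heq, Complex.add_re, Complex.one_re]
    linarith [(abs_le.1 (Complex.abs_re_le_norm ((F 1 x - F 1 z - (y - z)) / H))).1]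

lemma exists_fixedPoint_of_isotopy {C : Set ℂ} (hC : IsCompact C) (hCc : IsConnected C)
    (hCo : IsConnected Cᶜ) {F : ℝ → ℂ → ℂ} (hF : Continuous fun q : ℝ × ℂ => F q.1 q.2)
    (hinj : ∀ t, Function.Injective (F t)) (hF0 : F 0 = id) (hinv : F 1 '' C = C) :
    ∃ x ∈ C, F 1 x = x := by
  by_contra! hne
  have hf : Continuous (F 1) := hF.comp (f := fun x : ℂ => ((1 : ℝ), x)) (by fun_prop)
  obtain ⟨z₀, hz₀⟩ := hCc.nonempty
  obtain ⟨z₁, hz₁, hmin⟩ := hC.exists_isMinOn ⟨z₀, hz₀⟩ (hf.dist continuous_id).continuousOn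
  set ε := dist (F 1 z₁) z₁ with hεdef
  have hε : 0 < ε := dist_pos.2 (hne z₁ hz₁)
  obtain ⟨η, hη, hunif⟩ : ∃ η > 0, ∀ z ∈ C, ∀ x, dist x z < η → dist (F 1 x) (F 1 z) < ε / 4 := by
    have := hC.uniformContinuousAt_of_continuousAt (F 1) (fun z _ => hf.continuousAt)
      (Metric.dist_mem_uniformity (show 0 < ε / 4 by positivity))
    obtain ⟨η, hη, h⟩ := Metric.mem_uniformity_dist.1 this
    exact ⟨η, hη, fun z hz x hx => by
      rw [dist_comm]; exact h (by rwa [dist_comm]) hz⟩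
  set δ := min (η / 4) (ε / 16) with hδdef
  have hδ : 0 < δ := by positivity
  have hδη : 4 * δ ≤ η := by linarith [min_le_left (η / 4) (ε / 16)]
  have hδε : 4 * δ ≤ ε / 4 := by linarith [min_le_right (η / 4) (ε / 16)]
  obtain ⟨s, hs, hsδ, W, hW, hWb, hWC, hWδ⟩ := exists_unbounded_preconnected_away hC hCo hδ
  have hs0 : (s : ℂ) ≠ 0 := by exact_mod_cast hs.ne'
  let e : ℂ ≃ₜ ℂ := (Homeomorph.mulLeft₀ (s : ℂ) hs0).trans (Homeomorph.addLeft z₀)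
  have he : ∀ x, e x = z₀ + s * x := fun x => rfl
  have hes : ∀ x, e.symm x = (x - z₀) / s := fun x => by
    rw [Homeomorph.symm_apply_eq, he]
    field_simp
    ring
  have hdist : ∀ x y, dist (e x) (e y) = s * dist x y := fun x y => by
    rw [he, he, dist_add_left, dist_eq_norm, ← mul_sub, norm_mul, Complex.norm_real,
      Real.norm_of_nonneg hs.le, dist_eq_norm]
  have hdist' : ∀ x y, dist (e.symm x) y = dist x (e y) / s := fun x y => by
    rw [eq_div_iff hs.ne', mul_comm, ← hdist, e.apply_symm_apply]
  have hpre : ∀ S, e ⁻¹' S = e.symm '' S := fun S => (e.symm.image_eq_preimage_symm S).symm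
  refine false_of_far_unbounded_preconnected (C := e ⁻¹' C) (W := e ⁻¹' W) (D := δ / s)
    (ε := ε / s) (F := fun t x => e.symm (F t (e x))) ?_ ?_ ?_ ?_ ?_ ?_ ?_ ?_ ?_ ?_ ?_ ?_ ?_ ?_ ?_
  · rw [hpre]
    exact hC.image e.symm.continuous
  · rw [hpre]
    exact hCc.isPreconnected.image _ e.symm.continuous.continuousOn
  · rw [← Set.preimage_compl, hpre]
    exact hCo.image _ e.symm.continuous.continuousOn
  · simpa [he] using hz₀
  · rw [hpre]
    exact hW.image _ e.symm.continuous.continuousOn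
  · intro hb
    refine hWb ?_
    obtain ⟨R, hR⟩ := hb.exists_norm_le
    refine (isBounded_iff_forall_norm_le).2 ⟨‖z₀‖ + s * R, fun x hx => ?_⟩
    have h := hR (e.symm x) (by simpa using hx)
    calc ‖x‖ = ‖z₀ + s * e.symm x‖ := by rw [← he, e.apply_symm_apply]
      _ ≤ ‖z₀‖ + ‖(s : ℂ) * e.symm x‖ := norm_add_le _ _
      _ ≤ _ := by
        rw [norm_mul, Complex.norm_real, Real.norm_of_nonneg hs.le]
        gcongr
  · intro x hx y hy
    have := hWC _ hx _ hy
    rw [hdist] at this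
    nlinarith
  · intro x hx
    refine hWδ _ fun y hy => ?_
    have := hx (e.symm y) (by simpa using hy)
    rw [div_le_iff₀' hs, ← hdist, e.apply_symm_apply] at this
    exact this
  · exact e.symm.continuous.comp (hF.comp (f := fun q : ℝ × ℂ => (q.1, e q.2))
      (continuous_fst.prodMk (e.continuous.comp continuous_snd)))
  · exact fun t => e.symm.injective.comp ((hinj t).comp e.injective)
  · funext x
    simp [hF0]
  · rw [hpre, ← Set.image_comp]
    conv_rhs => rw [← hinv]
    rw [← Set.image_comp]
    refine Set.image_congr fun x _ => by simp
  · intro z hz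
    rw [hdist']
    gcongr
    exact hmin hz
  · intro z hz x hx
    rw [hdist', e.apply_symm_apply, div_right_comm]
    gcongr
    refine hunif _ hz _ ?_
    rw [hdist]
    have : s * dist x z < s * (δ / s + 2) := by gcongr
    rw [mul_add, mul_div_cancel₀ _ hs.ne'] at this
    linarith
  · rw [div_right_comm, le_div_iff₀ hs, add_mul, div_mul_cancel₀ _ hs.ne']
    linarith

/-- **Cartwright–Littlewood fixed point theorem.** An orientation preserving
planar homeomorphism with an invariant acyclic continuum `C` has a fixed point
in `C`. -/
theorem cartwright_littlewood
    (f : (ℝ × ℝ) ≃ₜ (ℝ × ℝ)) (hor : IsotopicToIdentity f)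
    (C : Set (ℝ × ℝ)) (hC : IsContinuum C) (hacyc : IsAcyclic C)
    (hinv : ⇑f '' C = C) :
    ∃ x ∈ C, f x = x := by
  obtain ⟨F, hF, hhomeo, hF0, hF1⟩ := hor
  let e : ℂ ≃ₜ ℝ × ℝ := Complex.equivRealProdCLM.toHomeomorph
  have hpre : ∀ S, e ⁻¹' S = e.symm '' S := fun S => (e.symm.image_eq_preimage_symm S).symm
  obtain ⟨x, hx, hfx⟩ := exists_fixedPoint_of_isotopy (C := e ⁻¹' C)
    (F := fun t x => e.symm (F t (e x)))
    (by rw [hpre]; exact hC.1.image e.symm.continuous)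
    (by rw [hpre]; exact hC.2.1.image _ e.symm.continuous.continuousOn)
    (by
      rw [← Set.preimage_compl, hpre]
      exact IsConnected.image hacyc _ e.symm.continuous.continuousOn)
    (e.symm.continuous.comp (hF.comp (f := fun q : ℝ × ℂ => (q.1, e q.2))
      (continuous_fst.prodMk (e.continuous.comp continuous_snd))))
    (fun t => by
      obtain ⟨g, hg⟩ := hhomeo t
      rw [← hg]
      exact e.symm.injective.comp (g.injective.comp e.injective))
    (by funext x; simp [hF0])
    (by
      rw [hpre, ← Set.image_comp]
      conv_rhs => rw [← hinv]
      rw [← Set.image_comp]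
      exact Set.image_congr fun x _ => by simp [hF1])
  refine ⟨e x, hx, ?_⟩
  rw [← hF1]
  exact (e.symm_apply_eq).1 hfx
end

section
/- Let h : ℝ² → ℝ² be an orientation preserving homeomorphism and let X ⊆ ℝ² be a one-dimensional acyclic continuum. Suppose there are n pairwise distinct connected components C₁, …, Cₙ of X ∩ h(X), each of which contains a periodic orbit of h of least period k > 1. Then h has at least n fixed points in X (indeed at least one fixed point in each Cᵢ). -/
/-- The (Lebesgue covering) dimension of `X` is at most `n`: every cover of `X`
by open sets of the plane admits an open shrinking/refinement (indexed by the
same set) covering `X` in which no point of `X` lies in more than `n + 1`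
sets. -/
def CovDimLE (X : Set (ℝ × ℝ)) (n : ℕ) : Prop :=
  ∀ (ι : Type) (U : ι → Set (ℝ × ℝ)), (∀ i, IsOpen (U i)) → X ⊆ ⋃ i, U i →
    ∃ V : ι → Set (ℝ × ℝ), (∀ i, IsOpen (V i)) ∧ (∀ i, V i ⊆ U i) ∧
      X ⊆ ⋃ i, V i ∧ ∀ x ∈ X, {i | x ∈ V i}.Finite ∧ {i | x ∈ V i}.ncard ≤ n + 1

/-- `X` is one-dimensional: its covering dimension equals `1`. -/
def IsOneDimensional (X : Set (ℝ × ℝ)) : Prop :=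
  CovDimLE X 1 ∧ ¬ CovDimLE X 0

section

open Complex Set Topology unitInterval

/-- `φ` has a continuous logarithm on `s`. -/
def HasLogOn {α : Type*} [TopologicalSpace α] (φ : α → ℂ) (s : Set α) : Prop :=
  ∃ g : α → ℂ, ContinuousOn g s ∧ ∀ z ∈ s, exp (g z) = φ z

theorem HasLogOn.mono {α : Type*} [TopologicalSpace α] {φ : α → ℂ} {s t : Set α}
    (h : HasLogOn φ s) (hts : t ⊆ s) : HasLogOn φ t := by
  obtain ⟨g, hg, hg'⟩ := h
  exact ⟨g, hg.mono hts, fun z hz => hg' z (hts hz)⟩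

theorem exists_log_homotopy {A : Type*} [TopologicalSpace A] (H : I × A → ℂ) (hH : Continuous H)
    (hne : ∀ p, H p ≠ 0) (g₀ : A → ℂ) (hg₀ : Continuous g₀)
    (h0 : ∀ a, exp (g₀ a) = H (0, a)) :
    ∃ G : I × A → ℂ, Continuous G ∧ (∀ p, exp (G p) = H p) ∧ ∀ a, G (0, a) = g₀ a := by
  let H' : C(I × A, {z : ℂ // z ≠ 0}) := ⟨fun p => ⟨H p, hne p⟩, by fun_prop⟩
  let g' : C(A, ℂ) := ⟨g₀, hg₀⟩
  have hz : ∀ a, H' (0, a) = ⟨_, (g' a).exp_ne_zero⟩ := fun a => Subtype.ext (h0 a).symm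
  refine ⟨isCoveringMap_exp.liftHomotopy H' g' hz, ContinuousMap.continuous _, fun p => ?_,
    fun a => isCoveringMap_exp.liftHomotopy_zero H' g' hz a⟩
  exact congrArg Subtype.val (congrFun (isCoveringMap_exp.liftHomotopy_lifts H' g' hz) p)

theorem hasLogOn_of_convex {E : Type*} [AddCommGroup E] [Module ℝ E] [TopologicalSpace E]
    [IsTopologicalAddGroup E] [ContinuousSMul ℝ E] {S : Set E} (hS : Convex ℝ S) {φ : E → ℂ}
    (hφ : ContinuousOn φ S) (hne : ∀ z ∈ S, φ z ≠ 0) : HasLogOn φ S := by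
  classical
  rcases S.eq_empty_or_nonempty with rfl | ⟨p, hp⟩
  · exact ⟨0, by simp, by simp⟩
  have hmem : ∀ (t : I) (a : S), AffineMap.lineMap p (a : E) (t : ℝ) ∈ S := fun t a =>
    hS.lineMap_mem hp a.2 t.2
  have hcont : Continuous fun q : I × S => φ (AffineMap.lineMap p (q.2 : E) (q.1 : ℝ)) := by
    refine hφ.comp_continuous ?_ fun q => hmem q.1 q.2
    simp only [AffineMap.lineMap_apply_module']
    fun_prop
  obtain ⟨G, hG, hG', -⟩ := exists_log_homotopy _ hcont (fun q => hne _ (hmem q.1 q.2))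
    (fun _ => log (φ p)) continuous_const (fun a => by simp [exp_log (hne p hp)])
  refine ⟨fun z => if hz : z ∈ S then G (1, ⟨z, hz⟩) else 0, ?_, fun z hz => ?_⟩
  · rw [continuousOn_iff_continuous_domRestrict]
    have : Continuous fun z : S => G (1, z) := by fun_prop
    refine this.congr fun z => ?_
    rw [domRestrict_apply]
    split_ifs with hz
    · rfl
    · exact absurd z.2 hz
  · simp [hz, hG']

theorem eq_of_exp_eq_of_isPreconnected {α : Type*} [TopologicalSpace α] {S : Set α}
    (hS : IsPreconnected S) {q : α → ℂ} (hq : ContinuousOn q S) {K : ℂ}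
    (hK : ∀ z ∈ S, exp (q z) = K) {x y : α} (hx : x ∈ S) (hy : y ∈ S) : q x = q y := by
  refine isCoveringMap_exp.isSeparatedMap.constOn_of_comp
    isCoveringMap_exp.isLocalHomeomorph.isLocallyInjective hS hq ?_ hx hy
  intro a ha b hb
  exact Subtype.ext ((hK a ha).trans (hK b hb).symm)

theorem ContinuousOn.eq_of_exp_eq_exp {α : Type*} [TopologicalSpace α] {S : Set α}
    (hS : IsPreconnected S) {p q : α → ℂ} (hp : ContinuousOn p S) (hq : ContinuousOn q S)
    (h : ∀ z ∈ S, exp (p z) = exp (q z)) {x y : α} (hx : x ∈ S) (hy : y ∈ S) :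
    p x - q x = p y - q y :=
  eq_of_exp_eq_of_isPreconnected hS (q := fun z => p z - q z) (hp.sub hq) (K := 1)
    (fun z hz => by rw [exp_sub, h z hz, div_self (exp_ne_zero _)]) hx hy

/-- A homeomorphism joined to the identity by injective maps has a symmetric continuous
logarithm of its difference quotient. -/
theorem exists_symm_log_difference_quotient {f : ℂ → ℂ} {F : ℝ → ℂ → ℂ}
    (hF : Continuous fun q : ℝ × ℂ => F q.1 q.2) (hinj : ∀ t, Function.Injective (F t))
    (h0 : F 0 = id) (h1 : F 1 = f) :
    ∃ L : ℂ × ℂ → ℂ, ContinuousOn L {p | p.1 ≠ p.2} ∧ (∀ x y, L (x, y) = L (y, x)) ∧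
      ∀ x y, x ≠ y → f x - f y = exp (L (x, y)) * (x - y) := by
  classical
  have hsub : ∀ a : {p : ℂ × ℂ // p.1 ≠ p.2}, a.1.1 - a.1.2 ≠ 0 := fun a => sub_ne_zero.2 a.2
  let H : I × {p : ℂ × ℂ // p.1 ≠ p.2} → ℂ := fun q =>
    (F q.1 q.2.1.1 - F q.1 q.2.1.2) / (q.2.1.1 - q.2.1.2)
  have hH : Continuous H := by
    refine Continuous.div ?_ (by fun_prop) fun q => hsub q.2
    refine Continuous.sub ?_ ?_
    · exact hF.comp (f := fun q : I × {p : ℂ × ℂ // p.1 ≠ p.2} => ((q.1 : ℝ), q.2.1.1))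
        (by fun_prop)
    · exact hF.comp (f := fun q : I × {p : ℂ × ℂ // p.1 ≠ p.2} => ((q.1 : ℝ), q.2.1.2))
        (by fun_prop)
  obtain ⟨G, hG, hG', hG0⟩ := exists_log_homotopy H hH
    (fun q => div_ne_zero (sub_ne_zero.2 fun h => q.2.2 (hinj _ h)) (hsub q.2))
    (fun _ => 0) continuous_const (fun a => by simp [H, h0, div_self (hsub a)])
  let sw : {p : ℂ × ℂ // p.1 ≠ p.2} → {p : ℂ × ℂ // p.1 ≠ p.2} := fun a => ⟨a.1.swap, a.2.symm⟩
  have hsw : Continuous sw := by fun_prop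
  have hsymm : ∀ a : {p : ℂ × ℂ // p.1 ≠ p.2}, G (1, sw a) = G (1, a) := by
    intro a
    have := ContinuousOn.eq_of_exp_eq_exp (S := (univ : Set I)) isPreconnected_univ
      (p := fun t => G (t, sw a)) (q := fun t => G (t, a)) (by fun_prop) (by fun_prop)
      (fun t _ => by
        rw [hG', hG']
        simp only [H, sw, Prod.fst_swap, Prod.snd_swap]
        rw [← neg_sub, ← neg_sub (a : ℂ × ℂ).1, neg_div_neg_eq]) (mem_univ 1) (mem_univ 0)
    simp only [hG0, sub_self] at this
    exact sub_eq_zero.1 this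
  refine ⟨fun p => if hp : p.1 ≠ p.2 then G (1, ⟨p, hp⟩) else 0, ?_, fun x y => ?_,
    fun x y hxy => ?_⟩
  · rw [continuousOn_iff_continuous_domRestrict]
    have : Continuous fun z : {p : ℂ × ℂ // p.1 ≠ p.2} => G (1, z) := by fun_prop
    refine this.congr fun z => ?_
    rw [domRestrict_apply]
    split_ifs with hz
    · rfl
    · exact absurd z.2 hz
  · by_cases hxy : x = y
    · simp [hxy]
    · simp only [ne_eq, hxy, not_false_eq_true, dite_true, Ne.symm hxy]
      exact hsymm ⟨(y, x), Ne.symm hxy⟩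
  · simp only [ne_eq, hxy, not_false_eq_true, dite_true, hG', H]
    rw [div_mul_cancel₀ _ (sub_ne_zero.2 hxy)]
    simp [h1]

end

section

open Complex Set Topology

theorem convex_band {A J K : Set ℝ} (hA : Convex ℝ A) (hJ : Convex ℝ J) (hK : Convex ℝ K) :
    Convex ℝ {p : ℝ × ℝ | p.1 ∈ A ∧ p.2 ∈ J ∧ p.2 - p.1 ∈ K} :=
  (hA.linear_preimage (LinearMap.fst ℝ ℝ ℝ)).inter ((hJ.linear_preimage (LinearMap.snd ℝ ℝ ℝ)).inter
    (hK.linear_preimage (LinearMap.snd ℝ ℝ ℝ - LinearMap.fst ℝ ℝ ℝ)))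

/-- An equivariant curve that returns to itself cannot stay in a region on which the displacement
of the homeomorphism has a logarithm. -/
theorem false_of_equivariant_curve {f : ℂ → ℂ} (hf : Function.Injective f) {L : ℂ × ℂ → ℂ}
    (hL : ContinuousOn L {p | p.1 ≠ p.2}) (hsymm : ∀ x y, L (x, y) = L (y, x))
    (hexp : ∀ x y, x ≠ y → f x - f y = exp (L (x, y)) * (x - y))
    {D : Set ℂ} (hD : HasLogOn (fun z => f z - z) D) {Γ : ℝ → ℂ} (hΓ : Continuous Γ)
    (hshift : ∀ s, 0 ≤ s → Γ (s + 1) = f (Γ s)) (hinj : InjOn Γ (Ico 0 2)) {T : ℝ}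
    (hΓD : ∀ s ∈ Icc 0 T, Γ s ∈ D)
    (hret : ∃ s t, 0 ≤ s ∧ s + 1 ≤ t ∧ t ≤ T ∧ Γ s = Γ t) : False := by
  obtain ⟨θ, hθ, hθ'⟩ := hD
  simp only at hθ'
  have hfix : ∀ s ∈ Icc 0 T, Γ s ≠ Γ (s + 1) := fun s hs h => by
    have := hθ' _ (hΓD s hs)
    rw [← hshift s hs.1, ← h, sub_self] at this
    exact exp_ne_zero _ this
  -- the first return
  let S : Set (ℝ × ℝ) := {p | 0 ≤ p.1 ∧ p.1 + 1 ≤ p.2 ∧ p.2 ≤ T ∧ Γ p.1 = Γ p.2}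
  have hSc : IsCompact S := by
    refine (isCompact_Icc (a := (0 : ℝ)) (b := T)).prod (isCompact_Icc (a := (0 : ℝ)) (b := T))
      |>.of_isClosed_subset ?_ ?_
    · have c1 : IsClosed {p : ℝ × ℝ | 0 ≤ p.1} := isClosed_le (by fun_prop) (by fun_prop)
      have c2 : IsClosed {p : ℝ × ℝ | p.1 + 1 ≤ p.2} := isClosed_le (by fun_prop) (by fun_prop)
      have c3 : IsClosed {p : ℝ × ℝ | p.2 ≤ T} := isClosed_le (by fun_prop) (by fun_prop)
      have c4 : IsClosed {p : ℝ × ℝ | Γ p.1 = Γ p.2} := isClosed_eq (by fun_prop) (by fun_prop)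
      exact c1.inter (c2.inter (c3.inter c4))
    · rintro ⟨u, v⟩ ⟨h1, h2, h3, -⟩
      simp only [mem_prod, mem_Icc] at *
      constructor <;> constructor <;> linarith
  obtain ⟨⟨s, t⟩, ⟨hs0, hst1, htT, hst⟩, hmin⟩ := hSc.exists_isMinOn
    (let ⟨s, t, h⟩ := hret; ⟨(s, t), h⟩) continuous_snd.continuousOn
  simp only at hs0 hst1 htT hst
  have hst1' : s + 1 < t := lt_of_le_of_ne hst1 fun h =>
    hfix s ⟨hs0, by linarith⟩ (h ▸ hst)
  have hback : ∀ n : ℕ, ∀ u v, 0 ≤ u → 0 ≤ v → Γ (u + n) = Γ (v + n) → Γ u = Γ v := by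
    intro n
    induction n with
    | zero => intro u v _ _ h; simpa using h
    | succ n ih =>
      intro u v hu hv h
      push_cast at h
      rw [← add_assoc, ← add_assoc, hshift _ (by positivity), hshift _ (by positivity)] at h
      exact ih u v hu hv (hf h)
  have hstrip : ∀ u v, 0 ≤ u → u < v → v < u + 1 → Γ u ≠ Γ v := by
    intro u v hu huv hvu h
    have h1 := Nat.floor_le hu
    have h2 := Nat.lt_floor_add_one u
    have h3 := hback ⌊u⌋₊ (u - ⌊u⌋₊) (v - ⌊u⌋₊) (by linarith) (by linarith) (by simpa using h)
    have := hinj ⟨by linarith, by linarith⟩ ⟨by linarith, by linarith⟩ h3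
    linarith
  have hfirst : ∀ u v, 0 ≤ u → u < v → v ≤ t → Γ u = Γ v → v = t := by
    intro u v hu huv hv h
    rcases lt_or_ge v (u + 1) with h1 | h1
    · exact absurd h (hstrip u v hu huv h1)
    · exact le_antisymm hv (hmin (a := (u, v)) ⟨hu, h1, by simp; linarith, h⟩)
  let R₁ : Set (ℝ × ℝ) := {p | p.1 ∈ Ici s ∧ p.2 ∈ Iic t ∧ p.2 - p.1 ∈ Ioo 0 (t - s)}
  let R₂ : Set (ℝ × ℝ) := {p | p.1 ∈ Icc s t ∧ p.2 ∈ univ ∧ p.2 - p.1 ∈ Ioc 0 1}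
  have hR₁ : Convex ℝ R₁ := convex_band (convex_Ici _) (convex_Iic _) (convex_Ioo _ _)
  have hR₂ : Convex ℝ R₂ := convex_band (convex_Icc _ _) convex_univ (convex_Ioc _ _)
  obtain ⟨A₁, hA₁, hA₁'⟩ := hasLogOn_of_convex hR₁ (φ := fun p => Γ p.2 - Γ p.1)
    (by fun_prop) (by
      rintro ⟨u, v⟩ ⟨h1, h2, h3, h4⟩ h
      simp only [mem_Ici, mem_Iic] at h1 h2 h3 h4
      rw [sub_eq_zero] at h
      have hv := hfirst u v (by linarith) (by linarith) h2 h.symm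
      subst hv
      have := hfirst s u hs0 (by linarith) (by linarith) (hst.trans h)
      linarith)
  obtain ⟨A₂, hA₂, hA₂'⟩ := hasLogOn_of_convex hR₂ (φ := fun p => Γ p.2 - Γ p.1)
    (by fun_prop) (by
      rintro ⟨u, v⟩ ⟨⟨h1, h2⟩, -, h3, h4⟩ h
      simp only at h1 h2 h3 h4
      rw [sub_eq_zero] at h
      rcases h4.lt_or_eq with h4 | h4
      · exact hstrip u v (by linarith) (by linarith) (by linarith) h.symm
      · obtain rfl : v = u + 1 := by linarith
        exact hfix u ⟨by linarith, by linarith⟩ h.symm)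
  simp only at hA₁' hA₂'
  have hdiff : ∀ p ∈ R₁ ∩ R₂, ∀ q ∈ R₁ ∩ R₂, A₁ p - A₂ p = A₁ q - A₂ q := fun p hp q hq =>
    ContinuousOn.eq_of_exp_eq_exp (hR₁.inter hR₂).isPreconnected (hA₁.mono inter_subset_left)
      (hA₂.mono inter_subset_right) (fun z hz => by rw [hA₁' z hz.1, hA₂' z hz.2]) hp hq
  let sh : ℝ × ℝ → ℝ × ℝ := fun p => (p.1 + 1, p.2 + 1)
  have hsh : Continuous sh := by fun_prop
  -- transport of logarithms along the shift
  have htrans : ∀ (R V : Set (ℝ × ℝ)) (A : ℝ × ℝ → ℂ), ContinuousOn A R →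
      (∀ p ∈ R, exp (A p) = Γ p.2 - Γ p.1) → Convex ℝ V → V ⊆ R → MapsTo sh V R →
      (∀ p ∈ V, 0 ≤ p.1 ∧ 0 ≤ p.2) → ∀ p ∈ V, ∀ q ∈ V,
      L (Γ p.1, Γ p.2) + A p - A (sh p) = L (Γ q.1, Γ q.2) + A q - A (sh q) := by
    intro R V A hA hA' hV hVR hVsh hpos p hp q hq
    have hne : ∀ p ∈ V, Γ p.1 ≠ Γ p.2 := fun p hp h => by
      have := hA' p (hVR hp)
      rw [h, sub_self] at this
      exact exp_ne_zero _ this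
    refine ContinuousOn.eq_of_exp_eq_exp hV.isPreconnected
      (p := fun p => L (Γ p.1, Γ p.2) + A p) (q := fun p => A (sh p)) ?_ ?_ ?_ hp hq
    · refine ContinuousOn.add ?_ (hA.mono hVR)
      exact hL.comp (f := fun p : ℝ × ℝ => (Γ p.1, Γ p.2)) (by fun_prop) fun p hp => hne p hp
    · exact hA.comp hsh.continuousOn hVsh
    · intro z hz
      have := hexp _ _ (hne z hz)
      rw [exp_add, hA' z (hVR hz), hA' _ (hVsh hz)]
      simp only [sh]
      rw [hshift _ (hpos z hz).1, hshift _ (hpos z hz).2]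
      linear_combination this
  set m := min (s + 1) (t - 1) with hm
  have hm1 : m ≤ s + 1 := min_le_left _ _
  have hm2 : m ≤ t - 1 := min_le_right _ _
  have hm3 : s < m := lt_min (by linarith) (by linarith)
  have E₁ := htrans R₂ {p | p.1 ∈ Icc s (t - 1) ∧ p.2 ∈ univ ∧ p.2 - p.1 ∈ Ioc 0 1} A₂ hA₂ hA₂'
    (convex_band (convex_Icc _ _) convex_univ (convex_Ioc _ _))
    (fun p ⟨⟨h1, h2⟩, h3⟩ => ⟨⟨h1, by linarith⟩, h3⟩)
    (fun p ⟨⟨h1, h2⟩, _, h3, h4⟩ => ⟨⟨by simp [sh]; linarith, by simp [sh]; linarith⟩, mem_univ _,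
      by simp [sh]; linarith, by simp [sh]; linarith⟩)
    (fun p ⟨⟨h1, h2⟩, _, h3, h4⟩ => ⟨by linarith, by linarith⟩)
    (s, m) ⟨⟨le_rfl, by simp; linarith⟩, mem_univ _, by simp; linarith, by simp; linarith⟩
    (t - 1, t) ⟨⟨by simp; linarith, le_rfl⟩, mem_univ _, by simp, by simp⟩
  have E₂ := htrans R₁ {p | p.1 ∈ Ici s ∧ p.2 ∈ Iic (t - 1) ∧ p.2 - p.1 ∈ Ioi 0} A₁ hA₁ hA₁'
    (convex_band (convex_Ici _) (convex_Iic _) (convex_Ioi _))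
    (fun p ⟨h1, h2, h3⟩ => by
      simp only [mem_Ici, mem_Iic, mem_Ioi] at h1 h2 h3
      exact ⟨h1, by simp; linarith, by linarith, by linarith⟩)
    (fun p ⟨h1, h2, h3⟩ => by
      simp only [mem_Ici, mem_Iic, mem_Ioi] at h1 h2 h3
      exact ⟨by simp [sh]; linarith, by simp [sh]; linarith, by simp [sh]; linarith,
        by simp [sh]; linarith⟩)
    (fun p ⟨h1, h2, h3⟩ => by
      simp only [mem_Ici, mem_Iic, mem_Ioi] at h1 h2 h3
      exact ⟨by linarith, by linarith⟩)
    (s, m) ⟨by simp, by simpa using hm2, by simp; linarith⟩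
    (s, t - 1) ⟨by simp, by simp, by simp; linarith⟩
  simp only [sh, sub_add_cancel] at E₁ E₂
  have memR : ∀ u v, s ≤ u → u < v → v ≤ t → v ≤ u + 1 → (u, v) ∈ R₁ ∩ R₂ := by
    intro u v h1 h2 h3 h4
    exact ⟨⟨h1, h3, by simp; linarith, by simp; linarith⟩,
      ⟨h1, by simp; linarith⟩, mem_univ _, by simp; linarith, by simp; linarith⟩
  have hb := memR (t - 1) t (by linarith) (by linarith) le_rfl (by linarith)
  have F₁ := hdiff _ (memR s m le_rfl hm3 (by linarith) hm1) _ hb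
  have F₂ := hdiff _ (memR (s + 1) (m + 1) (by linarith) (by linarith) (by linarith)
    (by linarith)) _ hb
  have F₃ := hdiff _ (memR s (s + 1) le_rfl (by linarith) (by linarith) le_rfl) _ hb
  have E₃ : θ (Γ s) - A₂ (s, s + 1) = θ (Γ t) - A₂ (t, t + 1) := by
    refine ContinuousOn.eq_of_exp_eq_exp (S := Icc s t) isPreconnected_Icc
      (p := fun u => θ (Γ u)) (q := fun u => A₂ (u, u + 1)) ?_ ?_ ?_
      (left_mem_Icc.2 (by linarith)) (right_mem_Icc.2 (by linarith))
    · exact hθ.comp hΓ.continuousOn fun u hu => hΓD u ⟨by linarith [hu.1], by linarith [hu.2]⟩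
    · exact hA₂.comp (f := fun u : ℝ => (u, u + 1)) (by fun_prop)
        fun u hu => ⟨hu, mem_univ _, by simp, by simp⟩
    · intro u hu
      rw [hθ' _ (hΓD u ⟨by linarith [hu.1], by linarith [hu.2]⟩),
        hA₂' _ ⟨hu, mem_univ _, by simp, by simp⟩, ← hshift u (by linarith [hu.1])]
  have hw : ∀ w ∈ Ioo s t, (w, t) ∈ R₁ ∧ (s, w) ∈ R₁ := fun w hw =>
    ⟨⟨hw.1.le, by simp, by simpa using hw.2, by simpa using hw.1⟩,
      ⟨by simp, hw.2.le, by simpa using hw.1, by simpa using hw.2⟩⟩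
  have hneg : ∀ w ∈ Ioo s t, exp (A₁ (w, t) - A₁ (s, w)) = -1 := by
    intro w hw'
    rw [exp_sub, hA₁' _ (hw w hw').1, hA₁' _ (hw w hw').2]
    have h0 : Γ w - Γ s ≠ 0 := by
      rw [← hA₁' _ (hw w hw').2]
      exact exp_ne_zero _
    simp only
    rw [div_eq_iff h0, ← hst]
    ring
  have hms : s + 1 ∈ Ioo s t := ⟨by linarith, by linarith⟩
  have hmt : t - 1 ∈ Ioo s t := ⟨by linarith, by linarith⟩
  have E₄ : A₁ (s + 1, t) - A₁ (s, s + 1) = A₁ (t - 1, t) - A₁ (s, t - 1) := by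
    refine eq_of_exp_eq_of_isPreconnected (q := fun w => A₁ (w, t) - A₁ (s, w))
      isPreconnected_Ioo ?_ hneg hms hmt
    refine ContinuousOn.sub ?_ ?_
    · exact hA₁.comp (f := fun w : ℝ => (w, t)) (by fun_prop) fun w h => (hw w h).1
    · exact hA₁.comp (f := fun w : ℝ => (s, w)) (by fun_prop) fun w h => (hw w h).2
  have hzero : A₁ (s + 1, t) - A₁ (s, s + 1) = 0 := by
    rw [← hst] at E₁ E₃
    rw [hsymm (Γ (t - 1))] at E₁
    linear_combination (1/2) * E₄ - (1/2) * (E₁ - E₂ + F₁ - F₂ - E₃ + F₃)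
  have := hneg _ hms
  rw [hzero, exp_zero] at this
  norm_num at this

theorem exists_closer_of_image_lt (f : ℂ → ℂ) (hf : Continuous f) {x₀ z : ℂ} {r : ℝ} (hr : 0 < r)
    (hz : ‖z - x₀‖ ≤ r) (hfz : ‖f z - x₀‖ < r) : ∃ w, ‖w - x₀‖ < r ∧ ‖f w - x₀‖ < r := by
  have hc : ContinuousAt (fun ε : ℝ => ‖f (x₀ + (1 - ε) * (z - x₀)) - x₀‖) 0 := by fun_prop
  have h1 : ∀ᶠ ε : ℝ in 𝓝[>] 0, ‖f (x₀ + (1 - ε) * (z - x₀)) - x₀‖ < r :=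
    (hc.eventually_lt continuousAt_const (by simpa using hfz)).filter_mono nhdsWithin_le_nhds
  have h2 : ∀ᶠ ε : ℝ in 𝓝[>] 0, ε ∈ Ioo (0 : ℝ) 1 := Ioo_mem_nhdsGT one_pos
  obtain ⟨ε, hε, hε0, hε1⟩ := (h1.and h2).exists
  refine ⟨_, ?_, hε⟩
  have : ‖(1 - ε : ℂ)‖ = 1 - ε := by
    rw [← ofReal_one, ← ofReal_sub, norm_real, Real.norm_of_nonneg (by linarith)]
  rw [add_sub_cancel_left, norm_mul, this]
  nlinarith

/-- A translation arc through `x₀` inside the disc of radius `‖f x₀ - x₀‖` about `x₀`. -/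
theorem exists_translation_arc (f : ℂ ≃ₜ ℂ) (x₀ : ℂ)
    (hfix : ∀ z ∈ Metric.closedBall x₀ ‖f x₀ - x₀‖, f z ≠ z) :
    ∃ γ : ℝ → ℂ, Continuous γ ∧ (∀ s ∈ Icc 0 1, γ s ∈ Metric.closedBall x₀ ‖f x₀ - x₀‖) ∧
      InjOn γ (Icc 0 1) ∧ γ 1 = f (γ 0) ∧ γ (1 / 2) = x₀ ∧
      ∀ u ∈ Icc (0 : ℝ) 1, ∀ v ∈ Icc (0 : ℝ) 1, γ u = f (γ v) → u = 1 ∨ v = 1 := by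
  have hx₀ : f x₀ ≠ x₀ := hfix x₀ (by simp)
  let M : ℂ → ℝ := fun z => max ‖z - x₀‖ ‖f z - x₀‖
  have hM : Continuous M := by fun_prop
  have hM₀ : M x₀ = ‖f x₀ - x₀‖ := by simp [M]
  obtain ⟨y, hy, hmin'⟩ := (isCompact_closedBall x₀ ‖f x₀ - x₀‖).exists_isMinOn ⟨x₀, by simp⟩
    hM.continuousOn
  have hmin : ∀ z, M y ≤ M z := by
    intro z
    by_cases hz : z ∈ Metric.closedBall x₀ ‖f x₀ - x₀‖
    · exact hmin' hz
    · rw [mem_closedBall_iff_norm, not_le] at hz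
      exact (hmin' (Metric.mem_closedBall_self (norm_nonneg _))).trans
        (hM₀.le.trans (hz.le.trans (le_max_left _ _)))
  set r := M y with hr
  have hr0 : 0 < r := by
    refine lt_of_le_of_ne ((norm_nonneg _).trans (le_max_left _ _)) fun h => ?_
    have h1 : ‖y - x₀‖ ≤ 0 := h ▸ le_max_left _ _
    have h2 : ‖f y - x₀‖ ≤ 0 := h ▸ le_max_right _ _
    rw [norm_le_zero_iff, sub_eq_zero] at h1 h2
    exact hx₀ (h1 ▸ h2)
  have hrd : r ≤ ‖f x₀ - x₀‖ := hM₀ ▸ hmin x₀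
  have heq : ∀ z, ‖z - x₀‖ ≤ r → ‖f z - x₀‖ ≤ r → ‖z - x₀‖ = r ∧ ‖f z - x₀‖ = r := by
    intro z h1 h2
    constructor
    · refine h1.eq_of_not_lt fun h => ?_
      obtain ⟨w, hw1, hw2⟩ := exists_closer_of_image_lt f.symm f.symm.continuous hr0 h2
        (by simpa using h)
      exact (hmin (f.symm w)).not_gt (max_lt hw2 (by simpa using hw1))
    · refine h2.eq_of_not_lt fun h => ?_
      obtain ⟨w, hw1, hw2⟩ := exists_closer_of_image_lt f f.continuous hr0 h1 h
      exact (hmin w).not_gt (max_lt hw1 hw2)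
  obtain ⟨hy1, hy2⟩ := heq y (le_max_left _ _) (le_max_right _ _)
  have hfy := hfix y hy
  let γ : ℝ → ℂ := fun s => x₀ + (max (1 - 2 * s) 0 : ℝ) * (y - x₀) +
    (max (2 * s - 1) 0 : ℝ) * (f y - x₀)
  have hγ1 : ∀ s, s ≤ 1 / 2 → γ s = x₀ + (1 - 2 * s : ℝ) * (y - x₀) := fun s hs => by
    simp only [γ]
    rw [max_eq_left (by linarith), max_eq_right (by linarith)]
    simp
  have hγ2 : ∀ s, 1 / 2 ≤ s → γ s = x₀ + (2 * s - 1 : ℝ) * (f y - x₀) := fun s hs => by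
    simp only [γ]
    rw [max_eq_right (by linarith), max_eq_left (by linarith)]
    simp
  have hnorm : ∀ s, ‖γ s - x₀‖ = |1 - 2 * s| * r := by
    intro s
    rcases le_total s (1 / 2) with hs | hs
    · rw [hγ1 s hs, add_sub_cancel_left, norm_mul, norm_real, hy1, Real.norm_eq_abs]
    · rw [hγ2 s hs, add_sub_cancel_left, norm_mul, norm_real, hy2, Real.norm_eq_abs,
        abs_sub_comm]
  have hnorm_le : ∀ s ∈ Icc (0 : ℝ) 1, ‖γ s - x₀‖ ≤ r := fun s hs => by
    rw [hnorm]
    have : |1 - 2 * s| ≤ 1 := abs_le.2 ⟨by linarith [hs.2], by linarith [hs.1]⟩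
    nlinarith
  have hmix : ∀ s t, s ≤ 1 / 2 → 1 / 2 ≤ t → γ s = γ t → s = t := by
    intro s t hs ht h
    have h1 := hnorm s
    rw [h, hnorm t, mul_left_inj' hr0.ne', abs_of_nonpos (by linarith),
      abs_of_nonneg (by linarith)] at h1
    rcases hs.eq_or_lt with rfl | hs
    · linarith
    rw [hγ1 s hs.le, hγ2 t ht, add_right_inj, show 2 * t - 1 = 1 - 2 * s by linarith,
      mul_right_inj' (ofReal_ne_zero.2 (by linarith)), sub_left_inj] at h
    exact absurd h.symm hfy
  have hinj : ∀ s t, s ≤ t → γ s = γ t → s = t := by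
    intro s t hst h
    rcases le_total t (1 / 2) with ht | ht
    · have h1 := hnorm s
      rw [h, hnorm t, mul_left_inj' hr0.ne', abs_of_nonneg (by linarith),
        abs_of_nonneg (by linarith)] at h1
      linarith
    · rcases le_total s (1 / 2) with hs | hs
      · exact hmix s t hs ht h
      · have h1 := hnorm s
        rw [h, hnorm t, mul_left_inj' hr0.ne', abs_of_nonpos (by linarith),
          abs_of_nonpos (by linarith)] at h1
        linarith
  refine ⟨γ, by fun_prop, fun s hs => mem_closedBall_iff_norm.2 ((hnorm_le s hs).trans hrd),
    fun s _ t _ h => ?_, ?_, ?_, fun u hu v hv h => ?_⟩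
  · rcases le_total s t with hst | hst
    · exact hinj s t hst h
    · exact (hinj t s hst h.symm).symm
  · rw [hγ1 0 (by norm_num), hγ2 1 (by norm_num)]
    norm_num
  · rw [hγ1 _ le_rfl]
    norm_num
  · obtain ⟨h1, h2⟩ := heq (γ v) (hnorm_le v hv) (h ▸ hnorm_le u hu)
    rw [← h] at h2
    rw [hnorm, mul_eq_right₀ hr0.ne'] at h1 h2
    rcases abs_cases (1 - 2 * v) with h3 | h3 <;> rcases abs_cases (1 - 2 * u) with h4 | h4
    · obtain rfl : v = 0 := by linarith
      obtain rfl : u = 0 := by linarith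
      rw [hγ1 0 (by norm_num)] at h
      norm_num at h
      exact absurd h.symm hfy
    all_goals first | (left; linarith) | (right; linarith)

/-- The curve obtained by concatenating the images of an arc under the iterates of `f`. -/
noncomputable def iterateArc (f : ℂ → ℂ) (γ : ℝ → ℂ) (s : ℝ) : ℂ :=
  f^[⌊s⌋₊] (γ (s - ⌊s⌋₊))

theorem iterateArc_add_one (f : ℂ → ℂ) (γ : ℝ → ℂ) {s : ℝ} (hs : 0 ≤ s) :
    iterateArc f γ (s + 1) = f (iterateArc f γ s) := by
  rw [iterateArc, iterateArc, Nat.floor_add_one hs, Function.iterate_succ_apply']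
  push_cast
  rw [add_sub_add_right_eq_sub]

theorem iterateArc_add_nat (f : ℂ → ℂ) (γ : ℝ → ℂ) {s : ℝ} (hs : s ∈ Ico 0 1) (n : ℕ) :
    iterateArc f γ (s + n) = f^[n] (γ s) := by
  rw [iterateArc, Nat.floor_add_natCast hs.1, Nat.floor_eq_zero.2 hs.2]
  simp

theorem continuous_iterateArc {f : ℂ → ℂ} (hf : Continuous f) {γ : ℝ → ℂ} (hγ : Continuous γ)
    (h01 : γ 1 = f (γ 0)) : Continuous (iterateArc f γ) := by
  have hon : ∀ n : ℕ, ContinuousOn (iterateArc f γ) (Iic n) := by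
    intro n
    induction n with
    | zero =>
      refine hγ.continuousOn.congr fun s hs => ?_
      rw [iterateArc, Nat.floor_eq_zero.2 (lt_of_le_of_lt hs (by norm_num))]
      simp
    | succ n ih =>
      have : (Iic ((n + 1 : ℕ) : ℝ)) = Iic (n : ℝ) ∪ Icc (n : ℝ) (n + 1) := by
        rw [Iic_union_Icc_eq_Iic (by simp)]
        push_cast
        rfl
      rw [this]
      refine ih.union_of_isClosed ?_ isClosed_Iic isClosed_Icc
      have hc : Continuous fun s : ℝ => f^[n] (γ (s - n)) :=
        (hf.iterate n).comp (by fun_prop)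
      refine hc.continuousOn.congr fun s hs => ?_
      rcases hs.2.eq_or_lt with rfl | hs2
      · have := iterateArc_add_nat f γ (s := 0) (by simp) (n + 1)
        push_cast at this
        rw [zero_add] at this
        rw [this, Function.iterate_succ_apply, ← h01]
        simp
      · have := iterateArc_add_nat f γ (s := s - n) ⟨by linarith [hs.1], by linarith⟩ n
        rwa [sub_add_cancel] at this
  rw [continuous_iff_continuousAt]
  intro s
  obtain ⟨n, hn⟩ := exists_nat_gt s
  exact (hon n).continuousAt (Iic_mem_nhds hn)

theorem injOn_iterateArc {f : ℂ → ℂ} (hf : Function.Injective f) {γ : ℝ → ℂ}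
    (hinj : InjOn γ (Icc 0 1))
    (hmeet : ∀ u ∈ Icc (0 : ℝ) 1, ∀ v ∈ Icc (0 : ℝ) 1, γ u = f (γ v) → u = 1 ∨ v = 1) :
    InjOn (iterateArc f γ) (Ico 0 2) := by
  have h0 : ∀ s ∈ Ico (0 : ℝ) 1, iterateArc f γ s = γ s := fun s hs => by
    simpa using iterateArc_add_nat f γ hs 0
  have h1 : ∀ s ∈ Ico (1 : ℝ) 2, iterateArc f γ s = f (γ (s - 1)) := fun s hs => by
    simpa using iterateArc_add_nat f γ (s := s - 1) ⟨by linarith [hs.1], by linarith [hs.2]⟩ 1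
  have key : ∀ s ∈ Ico (0 : ℝ) 1, ∀ t ∈ Ico (1 : ℝ) 2, iterateArc f γ s ≠ iterateArc f γ t := by
    intro s hs t ht h
    rw [h0 s hs, h1 t ht] at h
    rcases hmeet s ⟨hs.1, hs.2.le⟩ (t - 1) ⟨by linarith [ht.1], by linarith [ht.2]⟩ h with h | h
    · linarith [hs.2]
    · linarith [ht.2]
  intro s hs t ht h
  rcases lt_or_ge s 1 with hs1 | hs1 <;> rcases lt_or_ge t 1 with ht1 | ht1
  · rw [h0 s ⟨hs.1, hs1⟩, h0 t ⟨ht.1, ht1⟩] at h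
    exact hinj ⟨hs.1, hs1.le⟩ ⟨ht.1, ht1.le⟩ h
  · exact absurd h (key s ⟨hs.1, hs1⟩ t ⟨ht1, ht.2⟩)
  · exact absurd h.symm (key t ⟨ht.1, ht1⟩ s ⟨hs1, hs.2⟩)
  · rw [h1 s ⟨hs1, hs.2⟩, h1 t ⟨ht1, ht.2⟩] at h
    have := hinj ⟨by linarith, by linarith [hs.2]⟩ ⟨by linarith, by linarith [ht.2]⟩ (hf h)
    linarith

/-- No periodic orbit lies, after a change of coordinates, in a round disc whose first iterates
stay in a region on which the displacement has a logarithm. -/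
theorem false_of_periodic_of_closedBall (f : ℂ ≃ₜ ℂ) {L : ℂ × ℂ → ℂ}
    (hL : ContinuousOn L {p | p.1 ≠ p.2}) (hsymm : ∀ x y, L (x, y) = L (y, x))
    (hexp : ∀ x y, x ≠ y → f x - f y = exp (L (x, y)) * (x - y))
    {D : Set ℂ} (hD : HasLogOn (fun z => f z - z) D) (ψ : ℂ ≃ₜ ℂ) {x₀ : ℂ} {k : ℕ} (hk : 1 ≤ k)
    (hper : f^[k] x₀ = x₀)
    (hball : ∀ z, ψ z ∈ Metric.closedBall (ψ x₀) ‖ψ (f x₀) - ψ x₀‖ →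
      ∀ i ≤ k + 1, f^[i] z ∈ D) : False := by
  let f' : ℂ ≃ₜ ℂ := (ψ.symm.trans f).trans ψ
  have hf' : ∀ z, f' z = ψ (f (ψ.symm z)) := fun z => rfl
  obtain ⟨γ, hγ, hγb, hγi, hγ01, hγh, hγm⟩ := exists_translation_arc f' (ψ x₀) (by
    intro z hz hfz
    simp only [hf', ψ.symm_apply_apply] at hz hfz
    obtain ⟨g, -, hg⟩ := hD
    have h1 := hball (ψ.symm z) (by simpa using hz) 0 (by simp)
    have h2 : f (ψ.symm z) = ψ.symm z := ψ.injective (by simpa using hfz)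
    have := hg _ h1
    simp [h2] at this)
  simp only [hf', ψ.symm_apply_apply] at hγb hγ01 hγm
  set δ : ℝ → ℂ := fun s => ψ.symm (γ s) with hδ
  have hδc : Continuous δ := by fun_prop
  refine false_of_equivariant_curve f.injective hL hsymm hexp hD (Γ := iterateArc f δ)
    (continuous_iterateArc f.continuous hδc (by simp [hδ, hγ01]))
    (fun s hs => iterateArc_add_one f δ hs)
    (injOn_iterateArc f.injective (ψ.symm.injective.comp_injOn hγi) fun u hu v hv h =>
      hγm u hu v hv (by rw [← h]; simp [hδ])) (T := k + 1) (fun s hs => ?_)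
    ⟨1 / 2, 1 / 2 + k, by norm_num, ?_, by linarith, ?_⟩
  · refine hball _ ?_ _ ?_
    · have h1 := Nat.floor_le hs.1
      have h2 := Nat.lt_floor_add_one s
      simpa [hδ] using hγb _ ⟨by linarith, by linarith⟩
    · exact_mod_cast (Nat.floor_le hs.1).trans hs.2
  · have : (1 : ℝ) ≤ k := by exact_mod_cast hk
    linarith
  · rw [iterateArc_add_nat f δ ⟨by norm_num, by norm_num⟩ k]
    have := iterateArc_add_nat f δ (s := 1 / 2) ⟨by norm_num, by norm_num⟩ 0
    rw [Nat.cast_zero, add_zero] at this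
    rw [this]
    simp only [hδ, hγh, Function.iterate_zero, id, ψ.symm_apply_apply, hper]

theorem exists_homeomorph_push {a b : ℂ} {δ : ℝ} (hb : b ∈ Metric.ball a δ) :
    ∃ ψ : ℂ ≃ₜ ℂ, ψ a = b ∧ ∀ z ∉ Metric.ball a δ, ψ z = z := by
  rw [mem_ball_iff_norm] at hb
  have hδ : 0 < δ := (norm_nonneg _).trans_lt hb
  let c : NNReal := ⟨‖b - a‖ / δ, by positivity⟩
  let φ : ℂ → ℂ := fun z => z + (max (1 - ‖z - a‖ / δ) 0 : ℝ) * (b - a)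
  have happrox : ApproximatesLinearOn φ
      ((ContinuousLinearEquiv.refl ℝ ℂ : ℂ ≃L[ℝ] ℂ) : ℂ →L[ℝ] ℂ) univ c := by
    intro x _ y _
    have h1 : φ x - φ y - (x - y) =
        ((max (1 - ‖x - a‖ / δ) 0 - max (1 - ‖y - a‖ / δ) 0 : ℝ) : ℂ) * (b - a) := by
      simp only [φ]
      push_cast
      ring
    have h2 : |max (1 - ‖x - a‖ / δ) 0 - max (1 - ‖y - a‖ / δ) 0| ≤ ‖x - y‖ / δ := by
      refine (abs_max_sub_max_le_abs _ _ _).trans ?_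
      rw [show 1 - ‖x - a‖ / δ - (1 - ‖y - a‖ / δ) = (‖y - a‖ - ‖x - a‖) / δ by ring, abs_div,
        abs_of_pos hδ]
      gcongr
      refine (abs_norm_sub_norm_le _ _).trans ?_
      rw [sub_sub_sub_cancel_right, norm_sub_rev]
    change ‖φ x - φ y - (x - y)‖ ≤ ‖b - a‖ / δ * ‖x - y‖
    rw [h1, norm_mul, norm_real, Real.norm_eq_abs]
    calc _ ≤ ‖x - y‖ / δ * ‖b - a‖ := by gcongr
      _ = _ := by ring
  have hc : c < ‖((ContinuousLinearEquiv.refl ℝ ℂ).symm : ℂ →L[ℝ] ℂ)‖₊⁻¹ := by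
    have : ‖((ContinuousLinearEquiv.refl ℝ ℂ).symm : ℂ →L[ℝ] ℂ)‖₊ = 1 :=
      NNReal.eq ContinuousLinearMap.norm_id
    rw [this, inv_one]
    exact (div_lt_one hδ).2 hb
  refine ⟨happrox.toHomeomorph φ (Or.inr hc), ?_, fun z hz => ?_⟩
  · change φ a = b
    simp [φ]
  · rw [mem_ball_iff_norm, not_lt] at hz
    change φ z = z
    simp only [φ]
    rw [max_eq_right (by rw [sub_nonpos]; exact (one_le_div hδ).2 hz)]
    simp

/-- Inside a connected open set any two points can be brought into a round disc of the set by a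
homeomorphism preserving the set. -/
theorem exists_homeomorph_closedBall_subset {V : Set ℂ} (hV : IsOpen V) (hVc : IsPreconnected V)
    {x₀ x₁ : ℂ} (h₀ : x₀ ∈ V) (h₁ : x₁ ∈ V) :
    ∃ ψ : ℂ ≃ₜ ℂ, (∀ z, ψ z ∈ V ↔ z ∈ V) ∧ Metric.closedBall (ψ x₀) ‖ψ x₁ - ψ x₀‖ ⊆ V := by
  let S : Set ℂ := {a | a ∈ V ∧ ∃ ψ : ℂ ≃ₜ ℂ, (∀ z, ψ z ∈ V ↔ z ∈ V) ∧
    Metric.closedBall (ψ x₀) ‖ψ a - ψ x₀‖ ⊆ V}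
  have hx₀ : x₀ ∈ S := ⟨h₀, Homeomorph.refl _, fun z => Iff.rfl, by simpa⟩
  have hSo : IsOpen S := by
    rw [isOpen_iff_mem_nhds]
    rintro a ⟨haV, ψ, hψV, hψ⟩
    obtain ⟨ε, hε, hsub⟩ :=
      (isCompact_closedBall (ψ x₀) ‖ψ a - ψ x₀‖).exists_cthickening_subset_open
      hV hψ
    rw [cthickening_closedBall hε.le (norm_nonneg _)] at hsub
    have hc : ContinuousAt (fun z => ‖ψ z - ψ x₀‖) a := by fun_prop
    filter_upwards [hV.mem_nhds haV,
      hc.eventually_lt continuousAt_const (show _ < ε + ‖ψ a - ψ x₀‖ by linarith)] with z hz hz'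
    exact ⟨hz, ψ, hψV, (Metric.closedBall_subset_closedBall hz'.le).trans hsub⟩
  refine (hVc.subset_of_closure_inter_subset hSo ⟨x₀, h₀, hx₀⟩ ?_ h₁).2
  rintro a ⟨ha, haV⟩
  rcases eq_or_ne a x₀ with rfl | hne
  · exact hx₀
  obtain ⟨δ, hδ, hsub⟩ := Metric.isOpen_iff.1 (hV.sdiff (isClosed_singleton (x := x₀))) a ⟨haV, hne⟩
  obtain ⟨b, ⟨hbV, ψ, hψV, hψ⟩, hab⟩ := Metric.mem_closure_iff.1 ha δ hδ
  obtain ⟨φ, hφa, hφ⟩ := exists_homeomorph_push (a := a) (b := b) (δ := δ)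
    (by rwa [Metric.mem_ball, dist_comm])
  have hφ₀ : φ x₀ = x₀ := hφ _ fun h => (hsub h).2 rfl
  have hφV : ∀ z, φ z ∈ V ↔ z ∈ V := by
    intro z
    by_cases hz : z ∈ Metric.ball a δ
    · have : φ z ∈ Metric.ball a δ := by
        by_contra h
        have h1 := φ.injective (hφ _ h)
        exact h (by rwa [h1])
      exact iff_of_true (hsub this).1 (hsub hz).1
    · rw [hφ z hz]
  exact ⟨haV, φ.trans ψ, fun z => (hψV _).trans (hφV z), by
    simpa [Homeomorph.trans_apply, hφ₀, hφa] using hψ⟩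

/-- For every closed subset and every point off it, the difference to that point has a
logarithm. -/
def HasLinearLogs (Y : Set ℂ) : Prop :=
  ∀ Z ⊆ Y, IsClosed Z → ∀ w ∉ Z, HasLogOn (fun z => z - w) Z

theorem HasLinearLogs.mono {Y Z : Set ℂ} (h : HasLinearLogs Y) (hZ : Z ⊆ Y) : HasLinearLogs Z :=
  fun W hW => h W (hW.trans hZ)

theorem hasLogOn_sub_of_isPreconnected_compl {Z : Set ℂ} (hZ : IsCompact Z)
    (hc : IsPreconnected Zᶜ) {w : ℂ} (hw : w ∉ Z) : HasLogOn (fun z => z - w) Z := by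
  classical
  obtain ⟨r, hr⟩ := hZ.isBounded.subset_ball 0
  have hre : ∀ z ∈ Z, z.re < r := fun z hz =>
    (re_le_norm z).trans_lt (by simpa using hr hz)
  have hr' : (r : ℂ) ∉ Z := fun h => by simpa using hre _ h
  have hpath : IsPathConnected Zᶜ :=
    hZ.isClosed.isOpen_compl.isConnected_iff_isPathConnected.1 ⟨⟨w, hw⟩, hc⟩
  obtain ⟨γ, hγ⟩ := hpath.joinedIn _ hr' _ hw
  have hslit : ∀ z ∈ Z, (r : ℂ) - z ∈ slitPlane := fun z hz =>
    Or.inl (by simpa using hre z hz)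
  obtain ⟨G, hG, hG', -⟩ := exists_log_homotopy (A := Z) (fun p => (p.2 : ℂ) - γ p.1)
    (by fun_prop) (fun p h => hγ p.1 (sub_eq_zero.1 h ▸ p.2.2))
    (fun z => log (r - z) + Real.pi * I)
    ((Continuous.clog (by fun_prop) fun z : Z => hslit z z.2).add continuous_const) (fun z => by
      rw [exp_add, exp_log (slitPlane_ne_zero (hslit z z.2)), exp_pi_mul_I]
      simp)
  refine ⟨fun z => if hz : z ∈ Z then G (1, ⟨z, hz⟩) else 0, ?_, fun z hz => ?_⟩
  · rw [continuousOn_iff_continuous_domRestrict]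
    have : Continuous fun z : Z => G (1, z) := by fun_prop
    refine this.congr fun z => ?_
    rw [domRestrict_apply]
    split_ifs with hz
    · rfl
    · exact absurd z.2 hz
  · simp [hz, hG']

theorem hasLinearLogs_of_isConnected_compl {X : Set ℂ} (hX : IsCompact X)
    (hc : IsPreconnected Xᶜ) (hi : interior X = ∅) : HasLinearLogs X := by
  intro Z hZ hZc w hw
  refine hasLogOn_sub_of_isPreconnected_compl (hX.of_isClosed_subset hZc hZ) ?_ hw
  refine hc.subset_closure (compl_subset_compl.2 hZ) ?_
  rw [closure_compl, hi, compl_empty]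
  exact subset_univ _

theorem eq_of_exp_eq_of_norm_sub_lt {a b : ℂ} (h : exp a = exp b) (hab : ‖a - b‖ < 1) : a = b := by
  obtain ⟨n, hn⟩ := exp_eq_exp_iff_exists_int.1 h
  rw [hn, add_sub_cancel_left, norm_mul] at hab
  have h1 : (1 : ℝ) ≤ ‖2 * (Real.pi : ℂ) * I‖ := by
    simp [abs_of_pos Real.pi_pos]
    linarith [Real.pi_gt_three]
  rcases eq_or_ne n 0 with rfl | h0
  · simpa using hn
  · have h2 : (1 : ℝ) ≤ ‖(n : ℂ)‖ := by
      rw [norm_intCast]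
      exact_mod_cast Int.one_le_abs h0
    nlinarith

theorem exists_pos_forall_eq_of_exp_eq_one {T : Set ℂ} (hT : IsCompact T) {q : ℂ → ℂ}
    (hq : ContinuousOn q T) (hq1 : ∀ z ∈ T, exp (q z) = 1) :
    ∃ δ > 0, ∀ z ∈ T, ∀ w ∈ T, ‖z - w‖ < δ → q z = q w := by
  obtain ⟨δ, hδ, h⟩ := Metric.uniformContinuousOn_iff.1 (hT.uniformContinuousOn_of_continuous hq)
    1 one_pos
  refine ⟨δ, hδ, fun z hz w hw hzw => eq_of_exp_eq_of_norm_sub_lt ((hq1 z hz).trans (hq1 w hw).symm)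
    ?_⟩
  rw [← dist_eq_norm] at *
  exact h z hz w hw hzw

/-- Two logarithms on the halves of a set can be corrected on the part of the cutting line below a
point `w` off the set, without changing anything on the part above `w`. -/
theorem exists_log_correction {Y : Set ℂ} {d w : ℂ} (hd : d ≠ 0)
    (hw : w ∉ Y) (hlog : HasLogOn (fun z => z - w) Y) :
    ∃ a b : ℂ → ℂ, ContinuousOn a {z ∈ Y | (d * z).re ≤ (d * w).re} ∧
      ContinuousOn b {z ∈ Y | (d * w).re ≤ (d * z).re} ∧
      (∀ z ∈ Y, exp (a z) = 1) ∧ (∀ z ∈ Y, exp (b z) = 1) ∧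
      (∀ z ∈ Y, (d * z).re = (d * w).re → (d * w).im ≤ (d * z).im → a z = b z) ∧
      ∀ z ∈ Y, (d * z).re = (d * w).re → (d * z).im ≤ (d * w).im →
        a z = b z + 2 * Real.pi * I := by
  obtain ⟨l, hl, hl'⟩ := hlog
  simp only at hl'
  have hne : ∀ z ∈ Y, d * (z - w) ≠ 0 := fun z hz => mul_ne_zero hd
    (sub_ne_zero.2 fun h => hw (h ▸ hz))
  have him : ∀ z ∈ Y, (d * z).re = (d * w).re → (d * z).im ≠ (d * w).im := fun z hz h1 h2 =>
    hne z hz (by rw [mul_sub, sub_eq_zero]; exact Complex.ext h1 h2)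
  have hslit : ∀ z : ℂ, z ≠ 0 → 0 ≤ z.re → z ∈ slitPlane := by
    intro z hz h
    rcases h.eq_or_lt with h | h
    · exact Or.inr fun h' => hz (Complex.ext h.symm h')
    · exact Or.inl h
  refine ⟨fun z => log (-(d * (z - w))) + Real.pi * I - log d - l z,
    fun z => log (d * (z - w)) - log d - l z, ?_, ?_, fun z hz => ?_, fun z hz => ?_,
    fun z hz h1 h2 => ?_, fun z hz h1 h2 => ?_⟩
  · refine ContinuousOn.sub (ContinuousOn.sub (ContinuousOn.add (ContinuousOn.clog (by fun_prop)
      fun z hz => hslit _ (neg_ne_zero.2 (hne z hz.1)) ?_) continuousOn_const)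
      continuousOn_const) (hl.mono fun z hz => hz.1)
    have := hz.2
    rw [mul_sub, neg_re, sub_re]
    linarith
  · refine ContinuousOn.sub (ContinuousOn.sub (ContinuousOn.clog (by fun_prop)
      fun z hz => hslit _ (hne z hz.1) ?_) continuousOn_const) (hl.mono fun z hz => hz.1)
    have := hz.2
    rw [mul_sub, sub_re]
    linarith
  · have h0 := hne z hz
    rw [exp_sub, exp_sub, exp_add, exp_log (neg_ne_zero.2 h0), exp_log hd, exp_pi_mul_I, hl' z hz]
    field_simp [right_ne_zero_of_mul h0]
  · have h0 := hne z hz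
    rw [exp_sub, exp_sub, exp_log h0, exp_log hd, hl' z hz]
    field_simp [right_ne_zero_of_mul h0]
  · have h3 : 0 < (d * (z - w)).im := by
      rw [mul_sub, sub_im, sub_pos]
      exact lt_of_le_of_ne h2 (him z hz h1).symm
    have : log (-(d * (z - w))) + Real.pi * I = log (d * (z - w)) := by
      rw [log, log, arg_neg_eq_arg_sub_pi_of_im_pos h3, norm_neg]
      push_cast
      ring
    simp only [this]
  · have h3 : (d * (z - w)).im < 0 := by
      rw [mul_sub, sub_im, sub_neg]
      exact lt_of_le_of_ne h2 (him z hz h1)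
    have : log (-(d * (z - w))) = log (d * (z - w)) + Real.pi * I := by
      rw [log, log, arg_neg_eq_arg_add_pi_of_im_neg h3, norm_neg]
      push_cast
      ring
    simp only [this]
    ring

theorem HasLogOn.of_halves {Y : Set ℂ} (hY : IsCompact Y) (hlin : HasLinearLogs Y) {d : ℂ}
    (hd : ‖d‖ = 1) (c : ℝ) {φ : ℂ → ℂ} (h₁ : HasLogOn φ {z ∈ Y | (d * z).re ≤ c})
    (h₂ : HasLogOn φ {z ∈ Y | c ≤ (d * z).re}) : HasLogOn φ Y := by
  classical
  obtain ⟨g₁, hg₁, hg₁'⟩ := h₁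
  obtain ⟨g₂, hg₂, hg₂'⟩ := h₂
  have hd0 : d ≠ 0 := by rintro rfl; simp at hd
  set P := {z ∈ Y | (d * z).re ≤ c} with hP
  set Q := {z ∈ Y | c ≤ (d * z).re} with hQ
  have hcont : Continuous fun z : ℂ => (d * z).re := by fun_prop
  have hPc : IsClosed P := hY.isClosed.inter (isClosed_le hcont continuous_const)
  have hQc : IsClosed Q := hY.isClosed.inter (isClosed_le continuous_const hcont)
  have hPQ : IsCompact (P ∩ Q) :=
    hY.of_isClosed_subset (hPc.inter hQc) fun z hz => hz.1.1
  obtain ⟨δ, hδ, hconst⟩ := exists_pos_forall_eq_of_exp_eq_one hPQ (q := fun z => g₁ z - g₂ z)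
    ((hg₁.mono inter_subset_left).sub (hg₂.mono inter_subset_right)) (fun z hz => by
      rw [exp_sub, hg₁' z hz.1, hg₂' z hz.2, div_self]
      rw [← hg₁' z hz.1]
      exact exp_ne_zero _)
  obtain ⟨r, hr⟩ := hY.isBounded.subset_closedBall 0
  have him : ∀ z ∈ Y, |(d * z).im| ≤ r := fun z hz => (abs_im_le_norm _).trans (by
    rw [norm_mul, hd, one_mul]
    simpa using hr hz)
  have key : ∀ n : ℕ, ∃ a b : ℂ → ℂ, ∃ κ : ℂ, ContinuousOn a P ∧ ContinuousOn b Q ∧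
      (∀ z ∈ P, exp (a z) = φ z) ∧ (∀ z ∈ Q, exp (b z) = φ z) ∧
      (∀ z ∈ P ∩ Q, r + 1 - n * (δ / 2) ≤ (d * z).im → a z = b z) ∧
      (∀ z ∈ P ∩ Q, (d * z).im ≤ r + 1 - n * (δ / 2) → a z - b z = g₁ z - g₂ z + κ) := by
    intro n
    induction n with
    | zero =>
      refine ⟨g₁, g₂, 0, hg₁, hg₂, hg₁', hg₂', fun z hz h => ?_, fun z hz h => by ring⟩
      have := (abs_le.1 (him z hz.1.1)).2
      rw [Nat.cast_zero, zero_mul, sub_zero] at h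
      linarith
    | succ n ih =>
      obtain ⟨a, b, κ, ha, hb, ha', hb', hab, hκ⟩ := ih
      set y := r + 1 - n * (δ / 2) with hy
      have hy' : r + 1 - ((n + 1 : ℕ) : ℝ) * (δ / 2) = y - δ / 2 := by push_cast; rw [hy]; ring
      rw [hy']
      obtain ⟨w, hw⟩ : ∃ w : ℂ, d * w = ⟨c, y⟩ := ⟨⟨c, y⟩ / d, by field_simp⟩
      have hwre : (d * w).re = c := by rw [hw]
      have hwim : (d * w).im = y := by rw [hw]
      have hclose : ∀ z ∈ P ∩ Q, ∀ z' ∈ P ∩ Q, y - δ / 2 ≤ (d * z).im → (d * z).im ≤ y →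
          y - δ / 2 ≤ (d * z').im → (d * z').im ≤ y → a z - b z = a z' - b z' := by
        intro z hz z' hz' h1 h2 h3 h4
        rw [hκ z hz h2, hκ z' hz' h4, add_left_inj]
        refine hconst z hz z' hz' ?_
        have hre : (d * (z - z')).re = 0 := by
          rw [mul_sub, sub_re, le_antisymm hz.1.2 hz.2.2, le_antisymm hz'.1.2 hz'.2.2, sub_self]
        have h5 : ‖z - z'‖ = ‖d * (z - z')‖ := by rw [norm_mul, hd, one_mul]
        have h6 := norm_le_abs_re_add_abs_im (d * (z - z'))
        rw [hre, abs_zero, zero_add, mul_sub, sub_im] at h6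
        rw [h5, mul_sub]
        refine h6.trans_lt (lt_of_le_of_lt (abs_le.2 ⟨?_, ?_⟩) (half_lt_self hδ)) <;> linarith
      by_cases hwY : w ∈ Y
      · have hwPQ : w ∈ P ∩ Q := ⟨⟨hwY, hwre.le⟩, ⟨hwY, hwre.ge⟩⟩
        refine ⟨a, b, κ, ha, hb, ha', hb', fun z hz h => ?_, fun z hz h => hκ z hz (by linarith)⟩
        rcases le_total y (d * z).im with h1 | h1
        · exact hab z hz h1
        · have := hclose z hz w hwPQ h h1 (by linarith) hwim.le
          rwa [hab w hwPQ hwim.ge, sub_self, sub_eq_zero] at this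
      · obtain ⟨α, β, hα, hβ, hα', hβ', hup, hdown⟩ := exists_log_correction hd0 hwY
          (hlin Y subset_rfl hY.isClosed w hwY)
        rw [hwre] at hα hβ
        rw [hwre, hwim] at hup hdown
        obtain ⟨m, hm⟩ : ∃ m : ℤ, ∀ z ∈ P ∩ Q, y - δ / 2 ≤ (d * z).im → (d * z).im ≤ y →
            a z - b z = m * (2 * Real.pi * I) := by
          by_cases hex : ∃ z ∈ P ∩ Q, y - δ / 2 ≤ (d * z).im ∧ (d * z).im ≤ y
          · obtain ⟨z₀, hz₀, h1, h2⟩ := hex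
            obtain ⟨m, hm⟩ := exp_eq_one_iff.1 (show exp (a z₀ - b z₀) = 1 by
              rw [exp_sub, ha' z₀ hz₀.1, hb' z₀ hz₀.2, div_self]
              rw [← ha' z₀ hz₀.1]
              exact exp_ne_zero _)
            exact ⟨m, fun z hz h3 h4 => (hclose z hz z₀ hz₀ h3 h4 h1 h2).trans hm⟩
          · exact ⟨0, fun z hz h3 h4 => absurd ⟨z, hz, h3, h4⟩ hex⟩
        refine ⟨fun z => a z - m * α z, fun z => b z - m * β z, κ - m * (2 * Real.pi * I),
          ha.sub (continuousOn_const.mul hα), hb.sub (continuousOn_const.mul hβ),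
          fun z hz => ?_, fun z hz => ?_, fun z hz h => ?_, fun z hz h => ?_⟩
        · rw [exp_sub, exp_int_mul, hα' z hz.1, one_zpow, div_one, ha' z hz]
        · rw [exp_sub, exp_int_mul, hβ' z hz.1, one_zpow, div_one, hb' z hz]
        · have hre := le_antisymm hz.1.2 hz.2.2
          rcases le_total y (d * z).im with h1 | h1
          · simp only
            rw [hab z hz h1, hup z hz.1.1 hre h1]
          · simp only
            rw [hdown z hz.1.1 hre h1]
            linear_combination hm z hz h h1
        · have hre := le_antisymm hz.1.2 hz.2.2
          simp only
          rw [hdown z hz.1.1 hre (by linarith)]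
          linear_combination hκ z hz (by linarith)
  obtain ⟨n, hn⟩ := exists_nat_gt ((2 * r + 1) / (δ / 2))
  rw [div_lt_iff₀ (by positivity)] at hn
  obtain ⟨a, b, -, ha, hb, ha', hb', hab, -⟩ := key n
  have hab' : ∀ z ∈ P ∩ Q, a z = b z := fun z hz => hab z hz (by
    have := (abs_le.1 (him z hz.1.1)).1
    linarith)
  have hYPQ : Y = P ∪ Q := by
    ext z
    simp only [hP, hQ, mem_union, mem_ofPred_eq, ← and_or_left, le_total, and_true]
  refine ⟨fun z => if z ∈ P then a z else b z, ?_, fun z hz => ?_⟩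
  · refine ContinuousOn.mono (s := P ∪ Q) (ContinuousOn.union_of_isClosed ?_ ?_ hPc hQc) hYPQ.le
    · exact ha.congr fun z hz => if_pos hz
    · refine hb.congr fun z hz => ?_
      by_cases hzP : z ∈ P
      · simp only [if_pos hzP]
        exact hab' z ⟨hzP, hz⟩
      · exact if_neg hzP
  · simp only
    split_ifs with hzP
    · exact ha' z hzP
    · rw [hYPQ] at hz
      exact hb' z (hz.resolve_left hzP)

theorem HasLogOn.of_strips {Y : Set ℂ} (hY : IsCompact Y) (hlin : HasLinearLogs Y) {d : ℂ}
    (hd : ‖d‖ = 1) {η : ℝ} (hη : 0 < η) {φ : ℂ → ℂ}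
    (h : ∀ c, HasLogOn φ {z ∈ Y | c ≤ (d * z).re ∧ (d * z).re ≤ c + η}) : HasLogOn φ Y := by
  obtain ⟨r, hr⟩ := hY.isBounded.subset_closedBall 0
  have hre : ∀ z ∈ Y, |(d * z).re| ≤ r := fun z hz => (abs_re_le_norm _).trans (by
    rw [norm_mul, hd, one_mul]
    simpa using hr hz)
  have hcont : Continuous fun z : ℂ => (d * z).re := by fun_prop
  have key : ∀ n : ℕ, HasLogOn φ {z ∈ Y | (d * z).re ≤ -r - 1 + n * η} := by
    intro n
    induction n with
    | zero =>
      refine ⟨0, by fun_prop, fun z hz => ?_⟩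
      have h1 := (abs_le.1 (hre z hz.1)).1
      have h2 : (d * z).re ≤ -r - 1 + (0 : ℕ) * η := hz.2
      rw [Nat.cast_zero, zero_mul, add_zero] at h2
      linarith
    | succ n ih =>
      have hsub : {z ∈ Y | (d * z).re ≤ -r - 1 + (n + 1 : ℕ) * η} ⊆ Y := fun z hz => hz.1
      refine HasLogOn.of_halves (hY.of_isClosed_subset (hY.isClosed.inter
        (isClosed_le hcont continuous_const)) hsub) (hlin.mono hsub) hd (-r - 1 + n * η)
        (ih.mono fun z hz => ⟨hz.1.1, hz.2⟩)
        ((h (-r - 1 + n * η)).mono fun z hz => ⟨hz.1.1, hz.2, ?_⟩)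
      have h1 : (d * z).re ≤ -r - 1 + (n + 1 : ℕ) * η := hz.1.2
      push_cast at h1
      linarith
  obtain ⟨n, hn⟩ := exists_nat_gt ((2 * r + 1) / η)
  rw [div_lt_iff₀ hη] at hn
  refine (key n).mono fun z hz => ⟨hz, ?_⟩
  have := (abs_le.1 (hre z hz)).2
  linarith

theorem HasLinearLogs.hasLogOn {Y : Set ℂ} (hlin : HasLinearLogs Y) (hY : IsCompact Y)
    {φ : ℂ → ℂ} (hφ : ContinuousOn φ Y) (hne : ∀ z ∈ Y, φ z ≠ 0) : HasLogOn φ Y := by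
  rcases Y.eq_empty_or_nonempty with rfl | hYne
  · exact ⟨0, by simp, by simp⟩
  obtain ⟨z₁, hz₁, hmin⟩ := hY.exists_isMinOn hYne hφ.norm
  obtain ⟨δ, hδ, hδ'⟩ := Metric.uniformContinuousOn_iff.1 (hY.uniformContinuousOn_of_continuous hφ)
    ‖φ z₁‖ (norm_pos_iff.2 (hne z₁ hz₁))
  have hη : 0 < δ / 3 := by positivity
  have hsub : ∀ a : ℝ, {z ∈ Y | a ≤ (1 * z).re ∧ (1 * z).re ≤ a + δ / 3} ⊆ Y :=
    fun a z hz => hz.1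
  refine HasLogOn.of_strips hY hlin (d := 1) (by simp) hη fun a => ?_
  have hcl : IsClosed {z ∈ Y | a ≤ (1 * z).re ∧ (1 * z).re ≤ a + δ / 3} := by
    have hc : Continuous fun z : ℂ => (1 * z).re := by fun_prop
    exact hY.isClosed.inter ((isClosed_le continuous_const hc).inter
      (isClosed_le hc continuous_const))
  refine HasLogOn.of_strips (hY.of_isClosed_subset hcl (hsub a)) (hlin.mono (hsub a))
    (d := -I) (by simp) hη fun b => ?_
  set Z := {z ∈ {z ∈ Y | a ≤ (1 * z).re ∧ (1 * z).re ≤ a + δ / 3} |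
    b ≤ (-I * z).re ∧ (-I * z).re ≤ b + δ / 3} with hZ
  have hZY : Z ⊆ Y := fun z hz => hz.1.1
  rcases Z.eq_empty_or_nonempty with h0 | ⟨z₀, hz₀⟩
  · rw [h0]
    exact ⟨0, by simp, by simp⟩
  have hn0 := hne z₀ (hZY hz₀)
  have hslit : ∀ z ∈ Z, φ z / φ z₀ ∈ slitPlane := by
    intro z hz
    refine mem_slitPlane_of_norm_lt_one (z := φ z / φ z₀ - 1) ?_ |> fun h => by simpa using h
    rw [div_sub_one hn0, norm_div, div_lt_one (norm_pos_iff.2 hn0), ← dist_eq_norm]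
    refine (hδ' z (hZY hz) z₀ (hZY hz₀) ?_).trans_le (hmin (hZY hz₀))
    obtain ⟨⟨-, h1, h2⟩, h3, h4⟩ := hz
    obtain ⟨⟨-, h5, h6⟩, h7, h8⟩ := hz₀
    simp only [one_mul, neg_mul, neg_re, mul_re, I_re, I_im, zero_mul, zero_sub, neg_neg] at *
    rw [dist_eq_norm]
    refine (norm_le_abs_re_add_abs_im _).trans_lt ?_
    have e1 : |(z - z₀).re| ≤ δ / 3 := abs_le.2 ⟨by rw [sub_re]; linarith, by rw [sub_re]; linarith⟩
    have e2 : |(z - z₀).im| ≤ δ / 3 := abs_le.2 ⟨by rw [sub_im]; linarith, by rw [sub_im]; linarith⟩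
    linarith
  refine ⟨fun z => log (φ z₀) + log (φ z / φ z₀), ?_, fun z hz => ?_⟩
  · exact continuousOn_const.add (ContinuousOn.clog ((hφ.mono hZY).div_const _) hslit)
  · rw [exp_add, exp_log hn0, exp_log (slitPlane_ne_zero (hslit z hz))]
    field_simp

/-- Unicoherence: in a compact set all of whose nonvanishing functions have logarithms, the
intersection of two closed connected sets is connected. -/
theorem HasLinearLogs.isPreconnected_inter {A B : Set ℂ} (hlin : HasLinearLogs (A ∪ B))
    (hA : IsCompact A) (hB : IsCompact B) (hAc : IsPreconnected A) (hBc : IsPreconnected B) :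
    IsPreconnected (A ∩ B) := by
  classical
  rw [isPreconnected_closed_iff]
  rintro t t' ht ht' hcov ⟨p, hp, hpt⟩ ⟨q, hq, hqt⟩
  by_contra hemp
  rw [not_nonempty_iff_eq_empty] at hemp
  have hABc : IsClosed (A ∩ B) := hA.isClosed.inter hB.isClosed
  obtain ⟨a, ha0, ha1, -⟩ := exists_continuous_zero_one_of_isClosed (hABc.inter ht) (hABc.inter ht')
    (disjoint_left.2 fun z h1 h2 => by
      have : z ∈ A ∩ B ∩ (t ∩ t') := ⟨h1.1, h1.2, h2.2⟩
      rwa [hemp] at this)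
  let φ : ℂ → ℂ := fun z => if z ∈ A then exp (2 * Real.pi * I * a z) else 1
  have hφA : ∀ z ∈ A, φ z = exp (2 * Real.pi * I * a z) := fun z hz => if_pos hz
  have hφB : ∀ z ∈ B, φ z = 1 := by
    intro z hz
    by_cases hzA : z ∈ A
    · rw [hφA z hzA]
      rcases hcov ⟨hzA, hz⟩ with h | h
      · rw [ha0 ⟨⟨hzA, hz⟩, h⟩]
        simp
      · rw [ha1 ⟨⟨hzA, hz⟩, h⟩]
        simp
    · exact if_neg hzA
  have hφ : ContinuousOn φ (A ∪ B) := by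
    refine ContinuousOn.union_of_isClosed ?_ ?_ hA.isClosed hB.isClosed
    · have : Continuous fun z => exp (2 * Real.pi * I * a z) := by fun_prop
      exact this.continuousOn.congr hφA
    · exact continuousOn_const.congr hφB
  obtain ⟨g, hg, hg'⟩ := hlin.hasLogOn (hA.union hB) hφ (by
    rintro z (hz | hz)
    · rw [hφA z hz]
      exact exp_ne_zero _
    · rw [hφB z hz]
      exact one_ne_zero)
  have h1 : g p = g q := eq_of_exp_eq_of_isPreconnected hBc (hg.mono subset_union_right)
    (fun z hz => (hg' z (Or.inr hz)).trans (hφB z hz)) hp.2 hq.2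
  have h2 := ContinuousOn.eq_of_exp_eq_exp hAc (hg.mono subset_union_left)
    (q := fun z => 2 * Real.pi * I * a z) (by fun_prop)
    (fun z hz => (hg' z (Or.inl hz)).trans (hφA z hz)) hp.1 hq.1
  rw [h1, ha0 ⟨hp, hpt⟩, ha1 ⟨hq, hqt⟩] at h2
  simp only [Pi.zero_apply, Pi.one_apply, ofReal_zero, ofReal_one, mul_zero, mul_one,
    sub_zero] at h2
  exact two_pi_I_ne_zero (by linear_combination h2)

theorem not_hasLogOn_id_sphere : ¬ HasLogOn (fun z : ℂ => z) (Metric.sphere 0 1) := by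
  rintro ⟨g, hg, hg'⟩
  have hmem : ∀ t : ℝ, exp (t * I) ∈ Metric.sphere (0 : ℂ) 1 := fun t => by
    simp [norm_exp_ofReal_mul_I]
  have h := ContinuousOn.eq_of_exp_eq_exp (S := (univ : Set ℝ)) isPreconnected_univ
    (p := fun t => g (exp (t * I))) (q := fun t => t * I)
    (hg.comp (by fun_prop) fun t _ => hmem t) (by fun_prop) (fun t _ => hg' _ (hmem t))
    (mem_univ 0) (mem_univ (2 * Real.pi))
  push_cast at h
  rw [exp_two_pi_mul_I, zero_mul, exp_zero, sub_right_inj] at h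
  exact two_pi_I_ne_zero h.symm

/-- A disc is not covered by three open sets with empty triple intersection, each avoiding one of
three arcs of the boundary circle. -/
theorem false_of_three_sets_cover_closedBall {a : ℂ} {r : ℝ} (hr : 0 < r) {A B C : Set ℂ}
    (hA : IsOpen A) (hB : IsOpen B) (hC : IsOpen C)
    (hA' : ∀ z ∈ A, -(r / 2) < (z - a).re)
    (hB' : ∀ z ∈ B, -(r / 2) < -(z - a).re / 2 + √3 / 2 * (z - a).im)
    (hC' : ∀ z ∈ C, -(r / 2) < -(z - a).re / 2 - √3 / 2 * (z - a).im)
    (hcov : Metric.closedBall a r ⊆ A ∪ B ∪ C)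
    (hemp : ∀ z ∈ Metric.closedBall a r, z ∈ A → z ∈ B → z ∈ C → False) : False := by
  have h3 : √3 ^ 2 = 3 := Real.sq_sqrt (by norm_num)
  let x : ℂ → ℝ := fun z => Metric.infDist z Aᶜ
  let y : ℂ → ℝ := fun z => Metric.infDist z Bᶜ
  let w : ℂ → ℝ := fun z => Metric.infDist z Cᶜ
  have hx : Continuous x := Metric.continuous_infDist_pt _
  have hy : Continuous y := Metric.continuous_infDist_pt _
  have hw : Continuous w := Metric.continuous_infDist_pt _
  have pos : ∀ {S : Set ℂ}, IsOpen S → Sᶜ.Nonempty → ∀ z ∈ S, 0 < Metric.infDist z Sᶜ :=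
    fun hS hne z hz => (hS.isClosed_compl.notMem_iff_infDist_pos hne).1 fun h => h hz
  have zero : ∀ {S : Set ℂ}, ∀ z ∉ S, Metric.infDist z Sᶜ = 0 :=
    fun z hz => Metric.infDist_zero_of_mem hz
  have hA0 : Aᶜ.Nonempty := ⟨a - r, fun h => by
    have := hA' _ h
    simp at this
    linarith⟩
  have hB0 : Bᶜ.Nonempty := ⟨a + r, fun h => by
    have := hB' _ h
    simp at this
    linarith⟩
  have hC0 : Cᶜ.Nonempty := ⟨a + r, fun h => by
    have := hC' _ h
    simp at this
    linarith⟩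
  have hx0 : ∀ z, 0 ≤ x z := fun z => Metric.infDist_nonneg
  have hy0 : ∀ z, 0 ≤ y z := fun z => Metric.infDist_nonneg
  have hw0 : ∀ z, 0 ≤ w z := fun z => Metric.infDist_nonneg
  have hsum : ∀ z ∈ Metric.closedBall a r, 0 < x z + y z + w z := by
    intro z hz
    have h1 := hx0 z
    have h2 := hy0 z
    have h3 := hw0 z
    rcases hcov hz with (h | h) | h
    · linarith [show 0 < x z from pos hA hA0 z h]
    · linarith [show 0 < y z from pos hB hB0 z h]
    · linarith [show 0 < w z from pos hC hC0 z h]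
  let G : ℂ → ℂ := fun z => ((x z - (y z + w z) / 2 : ℝ) : ℂ) + (√3 / 2 * (y z - w z) : ℝ) * I
  have hG : Continuous G := by fun_prop
  have hGre : ∀ z, (G z).re = x z - (y z + w z) / 2 := fun z => by simp [G]
  have hGim : ∀ z, (G z).im = √3 / 2 * (y z - w z) := fun z => by simp [G]
  have hGn : ∀ z ∈ Metric.closedBall a r,
      (x z + y z + w z) ^ 2 ≤ 4 * ((G z).re ^ 2 + (G z).im ^ 2) := by
    intro z hz
    rw [hGre, hGim]
    have e : 4 * ((x z - (y z + w z) / 2) ^ 2 + (√3 / 2 * (y z - w z)) ^ 2) =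
        4 * (x z - (y z + w z) / 2) ^ 2 + 3 * (y z - w z) ^ 2 := by
      linear_combination (y z - w z) ^ 2 * h3
    rw [e]
    have : x z = 0 ∨ y z = 0 ∨ w z = 0 := by
      by_contra! h
      exact hemp z hz (by_contra fun h' => h.1 (zero z h')) (by_contra fun h' => h.2.1 (zero z h'))
        (by_contra fun h' => h.2.2 (zero z h'))
    rcases this with h | h | h <;> rw [h]
    · nlinarith [sq_nonneg (y z - w z)]
    · nlinarith [sq_nonneg (x z - w z)]
    · nlinarith [sq_nonneg (x z - y z)]
  have hG0 : ∀ z ∈ Metric.closedBall a r, G z ≠ 0 := by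
    intro z hz h
    have h1 := hGn z hz
    rw [h] at h1
    have h2 := hsum z hz
    simp at h1
    nlinarith
  obtain ⟨l, hl, hl'⟩ := hasLogOn_of_convex (convex_closedBall a r) hG.continuousOn hG0
  have hmem : ∀ u ∈ Metric.sphere (0 : ℂ) 1, a + r * u ∈ Metric.closedBall a r := fun u hu => by
    rw [mem_sphere_zero_iff_norm] at hu
    rw [mem_closedBall_iff_norm, add_sub_cancel_left, norm_mul, hu, norm_real,
      Real.norm_of_nonneg hr.le, mul_one]
  have hu0 : ∀ u ∈ Metric.sphere (0 : ℂ) 1, u ≠ 0 := fun u hu => by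
    rintro rfl
    simp at hu
  have hslit : ∀ u ∈ Metric.sphere (0 : ℂ) 1, G (a + r * u) / u ∈ slitPlane := by
    intro u hu
    have hm := hmem u hu
    have hun : u.re ^ 2 + u.im ^ 2 = 1 := by
      rw [mem_sphere_zero_iff_norm] at hu
      have := Complex.sq_norm u
      rw [hu, normSq_apply] at this
      linarith
    set z := a + r * u with hz
    have hre : (z - a).re = r * u.re := by simp [hz]
    have him : (z - a).im = r * u.im := by simp [hz]
    by_contra hns
    rw [mem_slitPlane_iff, not_or, not_lt, not_not] at hns
    obtain ⟨t, ht⟩ : ∃ t : ℝ, t = -(G z / u).re := ⟨_, rfl⟩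
    have hGt : G z = -(t * u) := by
      have : G z / u = ((-t : ℝ) : ℂ) := Complex.ext (by simp [ht]) (by simpa using hns.2)
      rw [div_eq_iff (hu0 u hu)] at this
      rw [this]
      push_cast
      ring
    have ht0 : 0 ≤ t := by rw [ht]; linarith [hns.1]
    have e1 : (G z).re = -(t * u.re) := by rw [hGt]; simp
    have e2 : (G z).im = -(t * u.im) := by rw [hGt]; simp
    have h1 := hGn z hm
    have h2 := hsum z hm
    have h4 : x z + y z + w z ≤ 2 * t := by
      rw [e1, e2] at h1
      refine abs_le_of_sq_le_sq' ?_ (by linarith) |>.2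
      calc _ ≤ _ := h1
        _ = (2 * t) ^ 2 * (u.re ^ 2 + u.im ^ 2) := by ring
        _ = _ := by rw [hun, mul_one]
    have h5 : -t = x z * u.re + y z * (-u.re / 2 + √3 / 2 * u.im) +
        w z * (-u.re / 2 - √3 / 2 * u.im) := by
      rw [hGre] at e1
      rw [hGim] at e2
      linear_combination t * hun - u.re * e1 - u.im * e2
    have bound : ∀ {S : Set ℂ} {c : ℝ}, IsOpen S → Sᶜ.Nonempty → (z ∈ S → -(r / 2) < r * c) →
        -(Metric.infDist z Sᶜ / 2) ≤ Metric.infDist z Sᶜ * c ∧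
        (z ∈ S → -(Metric.infDist z Sᶜ / 2) < Metric.infDist z Sᶜ * c) := by
      intro S c hS hS0 h
      by_cases hzS : z ∈ S
      · have h6 := pos hS hS0 z hzS
        have h7 : -(1 / 2) < c := by
          have := h hzS
          by_contra! hc
          nlinarith
        have : -(Metric.infDist z Sᶜ / 2) < Metric.infDist z Sᶜ * c := by nlinarith
        exact ⟨this.le, fun _ => this⟩
      · rw [zero z hzS]
        simp [hzS]
    have bA := bound (c := u.re) hA hA0 fun h => by rw [← hre]; exact hA' z h
    have bB := bound (c := -u.re / 2 + √3 / 2 * u.im) hB hB0 fun h => by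
      have := hB' z h
      rw [hre, him] at this
      linarith
    have bC := bound (c := -u.re / 2 - √3 / 2 * u.im) hC hC0 fun h => by
      have := hC' z h
      rw [hre, him] at this
      linarith
    change -(x z / 2) ≤ x z * _ ∧ (_ → -(x z / 2) < x z * _) at bA
    change -(y z / 2) ≤ y z * _ ∧ (_ → -(y z / 2) < y z * _) at bB
    change -(w z / 2) ≤ w z * _ ∧ (_ → -(w z / 2) < w z * _) at bC
    rcases hcov hm with (h | h) | h
    · linarith [bA.2 h, bB.1, bC.1]
    · linarith [bA.1, bB.2 h, bC.1]
    · linarith [bA.1, bB.1, bC.2 h]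
  refine not_hasLogOn_id_sphere ⟨fun u => l (a + r * u) - log (G (a + r * u) / u), ?_,
    fun u hu => ?_⟩
  · refine ContinuousOn.sub (hl.comp (by fun_prop) hmem) (ContinuousOn.clog ?_ hslit)
    exact ContinuousOn.div (by fun_prop) (by fun_prop) hu0
  · have h0 := hG0 _ (hmem u hu)
    rw [exp_sub, exp_log (slitPlane_ne_zero (hslit u hu)), hl' _ (hmem u hu), div_div_cancel₀ h0]

theorem exists_isOpen_hasLogOn {C : Set ℂ} (hC : IsClosed C) {φ : ℂ → ℂ} (hφ : Continuous φ)
    (h : HasLogOn φ C) : ∃ U, IsOpen U ∧ C ⊆ U ∧ HasLogOn φ U := by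
  obtain ⟨g, hg, hg'⟩ := h
  obtain ⟨G, hG⟩ := ContinuousMap.exists_restrict_eq hC
    (⟨C.domRestrict g, continuousOn_iff_continuous_domRestrict.1 hg⟩ : C(C, ℂ))
  have hGC : ∀ z ∈ C, G z = g z := fun z hz => congrArg (fun q : C(C, ℂ) => q ⟨z, hz⟩) hG
  have hc : Continuous fun z => φ z * exp (-G z) := by fun_prop
  refine ⟨(fun z => φ z * exp (-G z)) ⁻¹' slitPlane, isOpen_slitPlane.preimage hc, fun z hz => ?_,
    fun z => G z + log (φ z * exp (-G z)), ?_, fun z hz => ?_⟩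
  · rw [mem_preimage, hGC z hz, ← hg' z hz, ← exp_add]
    simp
  · exact G.continuous.continuousOn.add (hc.continuousOn.clog fun z hz => hz)
  · rw [exp_add, exp_log (slitPlane_ne_zero hz)]
    change exp (G z) * (φ z * exp (-G z)) = φ z
    rw [mul_comm (φ z), ← mul_assoc, ← exp_add]
    simp

theorem exists_fixedPoint_of_periodic_orbit (f : ℂ ≃ₜ ℂ) {F : ℝ → ℂ → ℂ}
    (hF : Continuous fun q : ℝ × ℂ => F q.1 q.2) (hinj : ∀ t, Function.Injective (F t))
    (hF0 : F 0 = id) (hF1 : F 1 = f) {X C : Set ℂ} (hX : HasLinearLogs X) (hCX : C ⊆ X)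
    (hCf : C ⊆ f '' X) (hC : IsCompact C) (hCc : IsPreconnected C) {x₀ : ℂ} {k : ℕ} (hk : 1 ≤ k)
    (hper : f^[k] x₀ = x₀) (horb : ∀ j, f^[j] x₀ ∈ C) : ∃ z ∈ C, f z = z := by
  by_contra! hfix
  obtain ⟨L, hL, hsymm, hexp⟩ := exists_symm_log_difference_quotient hF hinj hF0 hF1
  have key : ∀ n : ℕ, ∃ K, IsCompact K ∧ IsPreconnected K ∧ (∀ j, f^[j] x₀ ∈ K) ∧ K ⊆ C ∧
      ∀ z ∈ K, ∀ i ≤ n, f^[i] z ∈ C := by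
    intro n
    induction n with
    | zero =>
      refine ⟨C, hC, hCc, horb, subset_rfl, fun z hz i hi => ?_⟩
      obtain rfl := Nat.le_zero.1 hi
      exact hz
    | succ n ih =>
      obtain ⟨K, hK, hKc, hKo, hKC, hKi⟩ := ih
      have hpre : IsCompact (f ⁻¹' K) := f.isCompact_preimage.2 hK
      have hpreX : f ⁻¹' K ⊆ X := by
        intro z hz
        obtain ⟨w, hw, hwz⟩ := hCf (hKC hz)
        rwa [← f.injective hwz]
      refine ⟨C ∩ f ⁻¹' K, hC.inter hpre,
        (hX.mono (union_subset hCX hpreX)).isPreconnected_inter hC hpre hCc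
          (f.isPreconnected_preimage.2 hKc), fun j => ⟨horb j, ?_⟩, inter_subset_left,
        fun z hz i hi => ?_⟩
      · have := hKo (j + 1)
        rwa [Function.iterate_succ_apply'] at this
      · cases i with
        | zero => exact hz.1
        | succ i =>
          rw [Function.iterate_succ_apply]
          exact hKi _ hz.2 i (by omega)
  have hlog : HasLogOn (fun z => f z - z) C := (hX.mono hCX).hasLogOn hC (by fun_prop)
    fun z hz => sub_ne_zero.2 (hfix z hz)
  obtain ⟨U, hU, hCU, hUlog⟩ := exists_isOpen_hasLogOn hC.isClosed (by fun_prop) hlog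
  obtain ⟨K, -, hKc, hKo, -, hKi⟩ := key (k + 1)
  let W : Set ℂ := ⋂ i ∈ Finset.range (k + 2), f^[i] ⁻¹' U
  have hW : IsOpen W := isOpen_biInter_finset fun i _ => hU.preimage (f.continuous.iterate i)
  have hKW : K ⊆ W := fun z hz => mem_iInter₂.2 fun i hi =>
    hCU (hKi z hz i (by rw [Finset.mem_range] at hi; omega))
  have hKV : K ⊆ connectedComponentIn W x₀ :=
    hKc.subset_connectedComponentIn (hKo 0) hKW
  obtain ⟨ψ, hψV, hψ⟩ := exists_homeomorph_closedBall_subset hW.connectedComponentIn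
    isPreconnected_connectedComponentIn (hKV (hKo 0)) (hKV (hKo 1))
  refine false_of_periodic_of_closedBall f hL hsymm hexp hUlog ψ hk hper fun z hz i hi => ?_
  have hzW := connectedComponentIn_subset _ _ ((hψV z).1 (hψ hz))
  exact mem_iInter₂.1 hzW i (by rw [Finset.mem_range]; omega)

theorem isClosed_connectedComponentIn {α : Type*} [TopologicalSpace α] {S : Set α}
    (hS : IsClosed S) (x : α) : IsClosed (connectedComponentIn S x) := by
  by_cases hx : x ∈ S
  · refine isClosed_of_closure_subset ?_
    exact isPreconnected_connectedComponentIn.closure.subset_connectedComponentIn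
      (subset_closure (mem_connectedComponentIn hx))
      (closure_minimal (connectedComponentIn_subset S x) hS)
  · rw [connectedComponentIn_eq_empty hx]
    exact isClosed_empty

theorem interior_eq_empty_of_covDimLE_one {X : Set (ℝ × ℝ)} (hX : CovDimLE X 1) :
    interior X = ∅ := by
  by_contra hne
  obtain ⟨p, hp⟩ := nonempty_iff_ne_empty.2 hne
  let e : ℂ ≃ₜ ℝ × ℝ := equivRealProdCLM.toHomeomorph
  have hpre : e ⁻¹' X ∈ 𝓝 (e.symm p) :=
    e.continuous.continuousAt.preimage_mem_nhds (by simpa using mem_interior_iff_mem_nhds.1 hp)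
  obtain ⟨r, hr, hball⟩ := Metric.nhds_basis_closedBall.mem_iff.1 hpre
  set a := e.symm p with ha
  let l : Fin 3 → ℝ × ℝ → ℝ := ![fun q => q.1 - a.re,
    fun q => -(q.1 - a.re) / 2 + √3 / 2 * (q.2 - a.im),
    fun q => -(q.1 - a.re) / 2 - √3 / 2 * (q.2 - a.im)]
  have hl : ∀ i, Continuous (l i) := by
    intro i
    fin_cases i
    · change Continuous fun q : ℝ × ℝ => q.1 - a.re
      fun_prop
    · change Continuous fun q : ℝ × ℝ => -(q.1 - a.re) / 2 + √3 / 2 * (q.2 - a.im)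
      fun_prop
    · change Continuous fun q : ℝ × ℝ => -(q.1 - a.re) / 2 - √3 / 2 * (q.2 - a.im)
      fun_prop
  obtain ⟨V, hVo, hVU, hVX, hVcard⟩ := hX (Fin 3) (fun i => {q | -(r / 2) < l i q})
    (fun i => isOpen_lt continuous_const (hl i)) (fun q _ => by
      have hsum : l 0 q + l 1 q + l 2 q = 0 := by
        change (q.1 - a.re) + (-(q.1 - a.re) / 2 + √3 / 2 * (q.2 - a.im)) +
          (-(q.1 - a.re) / 2 - √3 / 2 * (q.2 - a.im)) = 0
        ring
      by_contra h
      simp only [mem_iUnion, mem_ofPred_eq, not_exists, not_lt] at h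
      linarith [h 0, h 1, h 2])
  refine false_of_three_sets_cover_closedBall hr ((hVo 0).preimage e.continuous)
    ((hVo 1).preimage e.continuous) ((hVo 2).preimage e.continuous) (fun z hz => hVU 0 hz)
    (fun z hz => hVU 1 hz) (fun z hz => hVU 2 hz) (fun z hz => ?_) fun z hz h0 h1 h2 => ?_
  · obtain ⟨i, hi⟩ := mem_iUnion.1 (hVX (hball hz))
    fin_cases i
    · exact Or.inl (Or.inl hi)
    · exact Or.inl (Or.inr hi)
    · exact Or.inr hi
  · have huniv : {i | e z ∈ V i} = univ := by
      ext i
      fin_cases i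
      · simpa using h0
      · simpa using h1
      · simpa using h2
    have := (hVcard _ (hball hz)).2
    rw [huniv, ncard_univ, Nat.card_eq_fintype_card, Fintype.card_fin] at this
    omega

theorem exists_fixedPoint_mem_connectedComponentIn {h : (ℝ × ℝ) ≃ₜ (ℝ × ℝ)}
    (hor : IsotopicToIdentity h) {X : Set (ℝ × ℝ)} (hX : IsCompact X) (hXacyc : IsAcyclic X)
    (hXdim : CovDimLE X 1) {C : Set (ℝ × ℝ)}
    (hcomp : ∃ x ∈ X ∩ ⇑h '' X, C = connectedComponentIn (X ∩ ⇑h '' X) x) {k : ℕ} (hk : 1 ≤ k)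
    {c : ℝ × ℝ} (hc : ∀ j < k, (⇑h)^[j] c ∈ C) (hper : (⇑h)^[k] c = c) :
    ∃ z ∈ C, z ∈ X ∧ h z = z := by
  obtain ⟨x, -, rfl⟩ := hcomp
  set C := connectedComponentIn (X ∩ ⇑h '' X) x with hC
  have hCsub : C ⊆ X ∩ ⇑h '' X := connectedComponentIn_subset _ _
  have hCcl : IsClosed C :=
    isClosed_connectedComponentIn (hX.isClosed.inter (hX.image h.continuous).isClosed) x
  have horb : ∀ j, (⇑h)^[j] c ∈ C := fun j => by
    rw [← Function.IsPeriodicPt.iterate_mod_apply hper]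
    exact hc _ (Nat.mod_lt _ hk)
  let e : ℂ ≃ₜ ℝ × ℝ := equivRealProdCLM.toHomeomorph
  obtain ⟨F, hF, hFg, hF0, hF1⟩ := hor
  have hiter : ∀ j, ((e.trans h).trans e.symm)^[j] (e.symm c) = e.symm ((⇑h)^[j] c) := fun j =>
    (Function.Semiconj.iterate_right (f := e.symm) (fun z => by simp) j c).symm
  have hlin : HasLinearLogs (e ⁻¹' X) := by
    refine hasLinearLogs_of_isConnected_compl (e.isCompact_preimage.2 hX) ?_ ?_
    · rw [← preimage_compl]
      exact e.isPreconnected_preimage.2 hXacyc.isPreconnected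
    · rw [← e.preimage_interior, interior_eq_empty_of_covDimLE_one hXdim, preimage_empty]
  obtain ⟨z, hz, hfz⟩ := exists_fixedPoint_of_periodic_orbit ((e.trans h).trans e.symm)
    (F := fun t z => e.symm (F t (e z)))
    (e.symm.continuous.comp (hF.comp (f := fun q : ℝ × ℂ => (q.1, e q.2)) (by fun_prop)))
    (fun t => by
      obtain ⟨g, hg⟩ := hFg t
      rw [← hg]
      exact e.symm.injective.comp (g.injective.comp e.injective))
    (by rw [hF0]; ext1 z; simp) (by rw [hF1]; rfl) hlin
    (C := e ⁻¹' C) (preimage_mono fun z hz => (hCsub hz).1) (fun z hz => by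
      obtain ⟨y, hy, hyz⟩ := (hCsub hz).2
      exact ⟨e.symm y, by simpa using hy, by simp [hyz]⟩)
    (e.isCompact_preimage.2 (hX.of_isClosed_subset hCcl fun z hz => (hCsub hz).1))
    (e.isPreconnected_preimage.2 isPreconnected_connectedComponentIn) hk
    (by rw [hiter, hper]) (fun j => by rw [hiter]; simpa using horb j)
  refine ⟨e z, hz, (hCsub hz).1, ?_⟩
  have : e.symm (h (e z)) = z := hfz
  exact e.symm.injective (by rw [this, e.symm_apply_apply])

end

/-- **Corollary (1).** If `h` is an orientation preserving planar
homeomorphism, `X` a one-dimensional acyclic continuum, and `C₁, …, Cₙ` are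
pairwise distinct connected components of `X ∩ h(X)` each containing a
periodic orbit of `h` of least period `k > 1`, then `h` has at least `n`
fixed points in `X`: one in each `Cᵢ`. -/
theorem fixed_points_in_components_orientation_preserving
    (h : (ℝ × ℝ) ≃ₜ (ℝ × ℝ)) (hor : IsotopicToIdentity h)
    (X : Set (ℝ × ℝ)) (hX : IsContinuum X) (hXacyc : IsAcyclic X)
    (hXdim : IsOneDimensional X)
    (n : ℕ) (C : Fin n → Set (ℝ × ℝ))
    (hcomp : ∀ i, ∃ x ∈ X ∩ ⇑h '' X, C i = connectedComponentIn (X ∩ ⇑h '' X) x)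
    (hdist : Function.Injective C)
    (k : ℕ) (hk : 1 < k)
    (hper : ∀ i, ∃ c : ℝ × ℝ, (∀ j : ℕ, j < k → (⇑h)^[j] c ∈ C i) ∧
      (⇑h)^[k] c = c ∧ ∀ j : ℕ, 1 ≤ j → j < k → (⇑h)^[j] c ≠ c) :
    ∃ F : Fin n → ℝ × ℝ, Function.Injective F ∧
      ∀ i, F i ∈ C i ∧ F i ∈ X ∧ h (F i) = F i := by
  choose c hc hck _ using hper
  choose F hFC hFX hF using fun i => exists_fixedPoint_mem_connectedComponentIn hor hX.1 hXacyc
    hXdim.1 (hcomp i) hk.le (hc i) (hck i)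
  refine ⟨F, fun i j hij => hdist ?_, fun i => ⟨hFC i, hFX i, hF i⟩⟩
  obtain ⟨x, -, hx⟩ := hcomp i
  obtain ⟨y, -, hy⟩ := hcomp j
  have hi := hFC i
  have hj := hFC j
  rw [hx] at hi
  rw [← hij, hy] at hj
  rw [hx, hy, connectedComponentIn_eq hi, connectedComponentIn_eq hj]
end
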